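/- Let S be a compact subset of ℂⁿ × ℂᵐ whose projection P = π(S) is contained in ℝⁿ. Then S is a Stein compactum in ℂⁿ × ℂᵐ if and only if for every set U, open in ℝⁿ × ℂᵐ, with S ⊆ U, there exist sets V and Ω, open in ℝⁿ × ℂᵐ, with S ⊆ V, the closure of V compact and contained in Ω, and Ω ⊆ U, such that for every u ∈ P the fiber Ω_u is a Stein open subset of ℂᵐ and the O(Ω_u)-hull of S_u is contained in V_u. -/

import Mathlib

open Set Topology

noncomputable section

/-- The `𝒪(Ω)`-hull of a set `K` inside `Ω`: points of `Ω` where every function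
holomorphic on `Ω` is bounded by its sup over `K`. -/
def hullO {E : Type*} [NormedAddCommGroup E] [NormedSpace ℂ E] (Ω K : Set E) : Set E :=
  {z ∈ Ω | ∀ f : E → ℂ, DifferentiableOn ℂ f Ω → ‖f z‖ ≤ ⨆ w ∈ K, ‖f w‖}

/-- An open set is Stein if the `𝒪(Ω)`-hull of every compact subset is compact. -/
def IsSteinOpen {E : Type*} [NormedAddCommGroup E] [NormedSpace ℂ E] (Ω : Set E) : Prop :=
  IsOpen Ω ∧ ∀ K : Set E, K ⊆ Ω → IsCompact K → IsCompact (hullO Ω K)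

/-- A compact set is a Stein compactum if every open neighborhood contains a
Stein open neighborhood. -/
def IsSteinCompactum {E : Type*} [NormedAddCommGroup E] [NormedSpace ℂ E] (S : Set E) : Prop :=
  ∀ U : Set E, IsOpen U → S ⊆ U → ∃ Ω : Set E, IsSteinOpen Ω ∧ S ⊆ Ω ∧ Ω ⊆ U

/-- `ℝⁿ` viewed as the real subspace of `ℂⁿ`. -/
def realSlice (n : ℕ) : Set (EuclideanSpace ℂ (Fin n)) := {x | ∀ i, (x i).im = 0}

/-- The fiber of a subset of a product over a point of the first factor. -/
def fiberOf {α β : Type*} (S : Set (α × β)) (u : α) : Set β := {z | (u, z) ∈ S}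

/-- A subset of `ℝⁿ × ℂᵐ` that is open in the subspace topology of `ℝⁿ × ℂᵐ ⊆ ℂⁿ × ℂᵐ`. -/
def OpenInSlice {n m : ℕ}
    (U : Set (EuclideanSpace ℂ (Fin n) × EuclideanSpace ℂ (Fin m))) : Prop :=
  ∃ W, IsOpen W ∧ U = W ∩ (realSlice n ×ˢ (univ : Set (EuclideanSpace ℂ (Fin m))))

set_option linter.all false
set_option linter.deprecated false
set_option linter.unusedSectionVars false
set_option linter.unusedVariables false

namespace SteinAux
open MeasureTheory Complex Filter
open scoped ContDiff ComplexConjugate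

section Wirtinger

variable {E : Type*} [NormedAddCommGroup E] [NormedSpace ℂ E] [NormedSpace ℝ E]

/-- Wirtinger derivative `∂` in direction `v`. -/
def dz (v : E) (f : E → ℂ) (x : E) : ℂ :=
  (fderiv ℝ f x v - I * fderiv ℝ f x (I • v)) / 2

/-- Wirtinger derivative `∂bar` in direction `v`. -/
def dzb (v : E) (f : E → ℂ) (x : E) : ℂ :=
  (fderiv ℝ f x v + I * fderiv ℝ f x (I • v)) / 2

/-- Smooth functions with compact support in `D`. -/
structure Tst (D : Set E) (f : E → ℂ) : Prop where
  smooth : ContDiff ℝ ∞ f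
  cpt : HasCompactSupport f
  sub : tsupport f ⊆ D

variable {D : Set E} {f g : E → ℂ} {x v w : E}

lemma dz_mul (hf : DifferentiableAt ℝ f x) (hg : DifferentiableAt ℝ g x) :
    dz v (fun y => f y * g y) x = f x * dz v g x + dz v f x * g x := by
  simp only [dz, fderiv_fun_mul hf hg]
  simp only [ContinuousLinearMap.add_apply, ContinuousLinearMap.smul_apply, smul_eq_mul]
  ring

lemma dzb_mul (hf : DifferentiableAt ℝ f x) (hg : DifferentiableAt ℝ g x) :
    dzb v (fun y => f y * g y) x = f x * dzb v g x + dzb v f x * g x := by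
  simp only [dzb, fderiv_fun_mul hf hg]
  simp only [ContinuousLinearMap.add_apply, ContinuousLinearMap.smul_apply, smul_eq_mul]
  ring

lemma dz_add (hf : DifferentiableAt ℝ f x) (hg : DifferentiableAt ℝ g x) :
    dz v (fun y => f y + g y) x = dz v f x + dz v g x := by
  simp only [dz, fderiv_fun_add hf hg, ContinuousLinearMap.add_apply]
  ring

lemma dzb_add (hf : DifferentiableAt ℝ f x) (hg : DifferentiableAt ℝ g x) :
    dzb v (fun y => f y + g y) x = dzb v f x + dzb v g x := by
  simp only [dzb, fderiv_fun_add hf hg, ContinuousLinearMap.add_apply]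
  ring

lemma dz_sub (hf : DifferentiableAt ℝ f x) (hg : DifferentiableAt ℝ g x) :
    dz v (fun y => f y - g y) x = dz v f x - dz v g x := by
  simp only [dz, fderiv_fun_sub hf hg, ContinuousLinearMap.sub_apply]
  ring

lemma dzb_sub (hf : DifferentiableAt ℝ f x) (hg : DifferentiableAt ℝ g x) :
    dzb v (fun y => f y - g y) x = dzb v f x - dzb v g x := by
  simp only [dzb, fderiv_fun_sub hf hg, ContinuousLinearMap.sub_apply]
  ring

lemma fderiv_conj (x v : E) : fderiv ℝ (fun y => conj (f y)) x v = conj (fderiv ℝ f x v) := by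
  have := (Complex.conjCLE : ℂ ≃L[ℝ] ℂ).comp_fderiv (f := f) (x := x)
  have h2 : (fun y => conj (f y)) = (⇑Complex.conjCLE ∘ f) := by
    ext y; simp
  rw [h2, this]; simp

lemma dz_conj : dz v (fun y => conj (f y)) x = conj (dzb v f x) := by
  simp only [dz, dzb, fderiv_conj]
  simp [sub_eq_add_neg, Complex.conj_ofNat]

lemma dzb_conj : dzb v (fun y => conj (f y)) x = conj (dz v f x) := by
  simp only [dz, dzb, fderiv_conj]
  simp [sub_eq_add_neg, Complex.conj_ofNat]

lemma dz_congr (h : f =ᶠ[𝓝 x] g) : dz v f x = dz v g x := by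
  simp only [dz, h.fderiv_eq]

lemma dzb_congr (h : f =ᶠ[𝓝 x] g) : dzb v f x = dzb v g x := by
  simp only [dzb, h.fderiv_eq]

lemma contDiff_fderiv_apply (hf : ContDiff ℝ ∞ f) (v : E) :
    ContDiff ℝ ∞ (fun x => fderiv ℝ f x v) :=
  (hf.fderiv_right (m := ∞) (by simp)).clm_apply contDiff_const

lemma contDiff_dz (hf : ContDiff ℝ ∞ f) (v : E) : ContDiff ℝ ∞ (dz v f) := by
  unfold dz
  exact ((contDiff_fderiv_apply hf v).sub
    (contDiff_const.mul (contDiff_fderiv_apply hf _))).div_const _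

lemma contDiff_dzb (hf : ContDiff ℝ ∞ f) (v : E) : ContDiff ℝ ∞ (dzb v f) := by
  unfold dzb
  exact ((contDiff_fderiv_apply hf v).add
    (contDiff_const.mul (contDiff_fderiv_apply hf _))).div_const _

lemma support_dz (v : E) (f : E → ℂ) : tsupport (dz v f) ⊆ tsupport f := by
  refine closure_minimal ?_ (isClosed_tsupport f)
  intro x hx
  by_contra h
  have h0 : fderiv ℝ f x = 0 := by
    have := support_fderiv_subset ℝ (f := f)
    by_contra h1
    exact h (this h1)
  apply hx
  simp [dz, h0]

lemma support_dzb (v : E) (f : E → ℂ) : tsupport (dzb v f) ⊆ tsupport f := by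
  refine closure_minimal ?_ (isClosed_tsupport f)
  intro x hx
  by_contra h
  have h0 : fderiv ℝ f x = 0 := by
    have := support_fderiv_subset ℝ (f := f)
    by_contra h1
    exact h (this h1)
  apply hx
  simp [dzb, h0]

lemma contDiff_diff (hf : ContDiff ℝ ∞ f) (x : E) : DifferentiableAt ℝ f x :=
  hf.contDiffAt.differentiableAt (by simp)

namespace Tst

lemma diff (hf : Tst D f) (x : E) : DifferentiableAt ℝ f x :=
  contDiff_diff hf.smooth x

lemma mono {D' : Set E} (hf : Tst D f) (h : D ⊆ D') : Tst D' f := ⟨hf.1, hf.2, hf.3.trans h⟩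

lemma dz (hf : Tst D f) (v : E) : Tst D (dz v f) :=
  ⟨contDiff_dz hf.smooth v, hf.cpt.mono' ((subset_tsupport _).trans (support_dz v f)),
    (support_dz v f).trans hf.sub⟩

lemma dzb (hf : Tst D f) (v : E) : Tst D (dzb v f) :=
  ⟨contDiff_dzb hf.smooth v, hf.cpt.mono' ((subset_tsupport _).trans (support_dzb v f)),
    (support_dzb v f).trans hf.sub⟩

lemma of_support {K : Set E} (hK : IsCompact K) (hKD : K ⊆ D) (hD : IsOpen D)
    (hf : ContDiffOn ℝ ∞ f D) (h0 : ∀ x, x ∉ K → f x = 0) : Tst D f := by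
  have hs : tsupport f ⊆ K := closure_minimal (fun x hx => by
    by_contra h; exact hx (h0 x h)) hK.isClosed
  refine ⟨?_, HasCompactSupport.of_support_subset_isCompact hK ((subset_tsupport _).trans hs),
    hs.trans hKD⟩
  rw [contDiff_iff_contDiffAt]
  intro x
  by_cases hx : x ∈ D
  · exact hf.contDiffAt (hD.mem_nhds hx)
  · have : f =ᶠ[𝓝 x] fun _ => 0 := by
      filter_upwards [hK.isClosed.isOpen_compl.mem_nhds (fun h => hx (hKD h))] with y hy
      exact h0 y hy
    exact contDiffAt_const.congr_of_eventuallyEq this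

lemma eq_zero (hf : Tst D f) {x : E} (hx : x ∉ tsupport f) : f x = 0 :=
  image_eq_zero_of_notMem_tsupport hx

lemma smul_on {a : E → ℂ} (hf : Tst D f) (hD : IsOpen D) (ha : ContDiffOn ℝ ∞ a D) :
    Tst D (fun x => a x * f x) := by
  refine of_support hf.cpt hf.sub hD (ha.mul hf.smooth.contDiffOn) ?_
  intro x hx
  simp [hf.eq_zero hx]

lemma mul_smooth {a : E → ℂ} (hf : Tst D f) (ha : ContDiff ℝ ∞ a) :
    Tst D (fun x => a x * f x) :=
  ⟨ha.mul hf.smooth, hf.cpt.mul_left, (tsupport_mul_subset_right).trans hf.sub⟩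

lemma conj' (hf : Tst D f) : Tst D (fun x => conj (f x)) := by
  refine ⟨(Complex.conjCLE.contDiff).comp hf.smooth, ?_, ?_⟩
  · exact hf.cpt.mono' (fun x hx => by
      apply subset_tsupport; intro h; apply hx; simp [h])
  · refine (closure_mono ?_).trans hf.sub
    intro x hx h; apply hx; simp [h]

lemma add (hf : Tst D f) (hg : Tst D g) : Tst D (fun x => f x + g x) :=
  ⟨hf.smooth.add hg.smooth, hf.cpt.add hg.cpt,
    (tsupport_add f g).trans (union_subset hf.sub hg.sub)⟩

lemma neg (hf : Tst D f) : Tst D (fun x => - f x) := by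
  have := hf.mul_smooth (a := fun _ => -1) contDiff_const
  simpa using this

lemma sub' (hf : Tst D f) (hg : Tst D g) : Tst D (fun x => f x - g x) := by
  simpa [sub_eq_add_neg] using hf.add hg.neg

lemma zero : Tst D (fun _ : E => (0:ℂ)) := by
  refine ⟨contDiff_const, HasCompactSupport.zero, ?_⟩
  simp [tsupport, Function.support]

lemma sum {ι : Type*} (s : Finset ι) {F : ι → E → ℂ} (h : ∀ i, Tst D (F i)) :
    Tst D (fun x => ∑ i ∈ s, F i x) := by
  classical
  induction s using Finset.induction_on with
  | empty => simpa using zero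
  | insert a s ha ih => simpa [Finset.sum_insert ha] using (h a).add ih

lemma cont (hf : Tst D f) : Continuous f := hf.smooth.continuous

variable [MeasurableSpace E] [BorelSpace E] {μ : Measure E} [IsFiniteMeasureOnCompacts μ]

lemma integrable (hf : Tst D f) : Integrable f μ :=
  hf.cont.integrable_of_hasCompactSupport hf.cpt

lemma memLp (hf : Tst D f) (p : ENNReal) : MemLp f p μ :=
  hf.cont.memLp_of_hasCompactSupport hf.cpt

end Tst

section ibp
variable [FiniteDimensional ℝ E] [MeasurableSpace E] [BorelSpace E] {μ : Measure E}
  [μ.IsAddHaarMeasure]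

lemma ibp_fderiv (hf : ContDiff ℝ ∞ f) (hg : Tst D g) (v : E) :
    ∫ x, f x * fderiv ℝ g x v ∂μ = - ∫ x, fderiv ℝ f x v * g x ∂μ := by
  apply integral_mul_fderiv_eq_neg_fderiv_mul_of_integrable
  · exact (hg.mul_smooth (contDiff_fderiv_apply hf v)).integrable
  · refine Continuous.integrable_of_hasCompactSupport
      (hf.continuous.mul (contDiff_fderiv_apply hg.smooth v).continuous) ?_
    exact ((hg.cpt.fderiv_apply ℝ v)).mul_left
  · exact (hg.mul_smooth hf).integrable
  · intro x _; exact contDiff_diff hf x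
  · intro x _; exact hg.diff x

lemma integrable_mul_fderiv (hf : ContDiff ℝ ∞ f) (hg : Tst D g) (v : E) :
    Integrable (fun x => f x * fderiv ℝ g x v) μ := by
  refine Continuous.integrable_of_hasCompactSupport
    (hf.continuous.mul (contDiff_fderiv_apply hg.smooth v).continuous) ?_
  exact ((hg.cpt.fderiv_apply ℝ v)).mul_left

lemma ibp_dz (hf : ContDiff ℝ ∞ f) (hg : Tst D g) (v : E) :
    ∫ x, f x * dz v g x ∂μ = - ∫ x, dz v f x * g x ∂μ := by
  have h1 := ibp_fderiv (μ := μ) hf hg v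
  have h2 := ibp_fderiv (μ := μ) hf hg (I • v)
  have e1 : ∀ x, f x * dz v g x = (f x * fderiv ℝ g x v - I * (f x * fderiv ℝ g x (I • v))) / 2 := by
    intro x; simp only [dz]; ring
  have e2 : ∀ x, dz v f x * g x = (fderiv ℝ f x v * g x - I * (fderiv ℝ f x (I • v) * g x)) / 2 := by
    intro x; simp only [dz]; ring
  simp_rw [e1, e2, integral_div]
  rw [integral_sub (integrable_mul_fderiv hf hg v) ((integrable_mul_fderiv hf hg _).const_mul _),
    integral_sub (hg.mul_smooth (contDiff_fderiv_apply hf v)).integrable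
      ((hg.mul_smooth (contDiff_fderiv_apply hf _)).integrable.const_mul _),
    integral_const_mul, integral_const_mul, h1, h2]
  ring

lemma ibp_dzb (hf : ContDiff ℝ ∞ f) (hg : Tst D g) (v : E) :
    ∫ x, f x * dzb v g x ∂μ = - ∫ x, dzb v f x * g x ∂μ := by
  have h1 := ibp_fderiv (μ := μ) hf hg v
  have h2 := ibp_fderiv (μ := μ) hf hg (I • v)
  have e1 : ∀ x, f x * dzb v g x = (f x * fderiv ℝ g x v + I * (f x * fderiv ℝ g x (I • v))) / 2 := by
    intro x; simp only [dzb]; ring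
  have e2 : ∀ x, dzb v f x * g x = (fderiv ℝ f x v * g x + I * (fderiv ℝ f x (I • v) * g x)) / 2 := by
    intro x; simp only [dzb]; ring
  simp_rw [e1, e2, integral_div]
  rw [integral_add (integrable_mul_fderiv hf hg v) ((integrable_mul_fderiv hf hg _).const_mul _),
    integral_add (hg.mul_smooth (contDiff_fderiv_apply hf v)).integrable
      ((hg.mul_smooth (contDiff_fderiv_apply hf _)).integrable.const_mul _),
    integral_const_mul, integral_const_mul, h1, h2]
  ring

end ibp

/-- second derivative commutes -/
lemma fderiv_fderiv_apply (hf : ContDiff ℝ ∞ f) (x v w : E) :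
    fderiv ℝ (fun y => fderiv ℝ f y v) x w = fderiv ℝ (fderiv ℝ f) x w v := by
  have h : DifferentiableAt ℝ (fderiv ℝ f) x :=
    (hf.fderiv_right (m := ∞) (by simp)).contDiffAt.differentiableAt (by simp)
  rw [fderiv_clm_apply h (differentiableAt_const _)]
  simp

lemma fderiv2_symm (hf : ContDiff ℝ ∞ f) (x v w : E) :
    fderiv ℝ (fderiv ℝ f) x w v = fderiv ℝ (fderiv ℝ f) x v w := by
  have := (hf.contDiffAt (x := x)).isSymmSndFDerivAt (by simp; exact ENat.LEInfty.out)
  exact this w v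

lemma fderiv_dz (hf : ContDiff ℝ ∞ f) (x v w : E) :
    fderiv ℝ (dz v f) x w =
      (fderiv ℝ (fderiv ℝ f) x w v - I * fderiv ℝ (fderiv ℝ f) x w (I • v)) / 2 := by
  have h1 := (contDiff_fderiv_apply hf v)
  have h2 := (contDiff_fderiv_apply hf (I • v))
  have : dz v f = fun x => (2:ℂ)⁻¹ * (fderiv ℝ f x v - I * fderiv ℝ f x (I • v)) := by
    ext x; simp only [dz]; ring
  rw [this, fderiv_const_mul (DifferentiableAt.fun_sub (contDiff_diff h1 x) ((contDiff_diff h2 x).const_mul I)),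
    fderiv_fun_sub (contDiff_diff h1 x) ((contDiff_diff h2 x).const_mul I),
    fderiv_const_mul (contDiff_diff h2 x)]
  simp only [ContinuousLinearMap.smul_apply, ContinuousLinearMap.sub_apply, smul_eq_mul,
    fderiv_fderiv_apply hf]
  ring

lemma fderiv_dzb (hf : ContDiff ℝ ∞ f) (x v w : E) :
    fderiv ℝ (dzb v f) x w =
      (fderiv ℝ (fderiv ℝ f) x w v + I * fderiv ℝ (fderiv ℝ f) x w (I • v)) / 2 := by
  have h1 := (contDiff_fderiv_apply hf v)
  have h2 := (contDiff_fderiv_apply hf (I • v))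
  have : dzb v f = fun x => (2:ℂ)⁻¹ * (fderiv ℝ f x v + I * fderiv ℝ f x (I • v)) := by
    ext x; simp only [dzb]; ring
  rw [this, fderiv_const_mul (DifferentiableAt.fun_add (contDiff_diff h1 x) ((contDiff_diff h2 x).const_mul I)),
    fderiv_fun_add (contDiff_diff h1 x) ((contDiff_diff h2 x).const_mul I),
    fderiv_const_mul (contDiff_diff h2 x)]
  simp only [ContinuousLinearMap.smul_apply, ContinuousLinearMap.add_apply, smul_eq_mul,
    fderiv_fderiv_apply hf]
  ring

lemma dzb_dz_comm (hf : ContDiff ℝ ∞ f) (x v w : E) : dzb w (dz v f) x = dz v (dzb w f) x := by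
  simp only [dzb.eq_1 w (dz v f), dz.eq_1 v (dzb w f), fderiv_dz hf, fderiv_dzb hf]
  rw [fderiv2_symm hf x v w, fderiv2_symm hf x v (I • w), fderiv2_symm hf x (I • v) w,
    fderiv2_symm hf x (I • v) (I • w)]
  ring

lemma dzb_dzb_comm (hf : ContDiff ℝ ∞ f) (x v w : E) : dzb w (dzb v f) x = dzb v (dzb w f) x := by
  simp only [dzb.eq_1 w (dzb v f), dzb.eq_1 v (dzb w f), fderiv_dzb hf]
  rw [fderiv2_symm hf x v w, fderiv2_symm hf x v (I • w), fderiv2_symm hf x (I • v) w,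
    fderiv2_symm hf x (I • v) (I • w)]
  ring

end Wirtinger
end SteinAux

namespace SteinAux
open MeasureTheory Complex Filter
open scoped ContDiff ComplexConjugate

section Basic
variable {E : Type*} [NormedAddCommGroup E] [NormedSpace ℂ E] [NormedSpace ℝ E]
variable [FiniteDimensional ℝ E] [MeasurableSpace E] [BorelSpace E] {μ : Measure E}
  [μ.IsAddHaarMeasure] {D : Set E}

/-- complexification of a real function -/
def cx (φ : E → ℝ) : E → ℂ := fun x => (φ x : ℂ)

/-- the weight -/
def wt (φ : E → ℝ) : E → ℂ := fun x => (Real.exp (-φ x) : ℂ)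

/-- twisted derivative -/
def dlt (φ : E → ℝ) (v : E) (a : E → ℂ) : E → ℂ := fun x => dz v a x - dz v (cx φ) x * a x

lemma cx_smooth {φ : E → ℝ} (hφ : ContDiff ℝ ∞ φ) : ContDiff ℝ ∞ (cx φ) :=
  Complex.ofRealCLM.contDiff.comp hφ

lemma wt_smooth {φ : E → ℝ} (hφ : ContDiff ℝ ∞ φ) : ContDiff ℝ ∞ (wt φ) :=
  Complex.ofRealCLM.contDiff.comp (Real.contDiff_exp.comp hφ.neg)

lemma fderiv_cx {φ : E → ℝ} {x : E} (hφ : DifferentiableAt ℝ φ x) (v : E) :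
    fderiv ℝ (cx φ) x v = (fderiv ℝ φ x v : ℂ) := by
  have := (Complex.ofRealCLM.hasFDerivAt (x := φ x)).comp x hφ.hasFDerivAt
  have h2 : HasFDerivAt (cx φ) (Complex.ofRealCLM.comp (fderiv ℝ φ x)) x := this
  rw [h2.fderiv]; simp

lemma fderiv_wt {φ : E → ℝ} {x : E} (hφ : DifferentiableAt ℝ φ x) (v : E) :
    fderiv ℝ (wt φ) x v = - fderiv ℝ (cx φ) x v * wt φ x := by
  have h1 : HasFDerivAt (fun x => Real.exp (-φ x)) _ x := (hφ.hasFDerivAt.neg).exp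
  have : wt φ = cx (fun x => Real.exp (-φ x)) := rfl
  rw [this, fderiv_cx h1.differentiableAt, h1.fderiv, fderiv_cx hφ]
  simp [cx]; ring

lemma conj_dz_cx {φ : E → ℝ} {x : E} (v : E) :
    conj (dz v (cx φ) x) = dzb v (cx φ) x := by
  rw [← dzb_conj]
  congr 1; ext y; simp [cx]

lemma dzb_wt {φ : E → ℝ} {x : E} (hφ : DifferentiableAt ℝ φ x) (v : E) :
    dzb v (wt φ) x = - dzb v (cx φ) x * wt φ x := by
  simp only [dzb, fderiv_wt hφ]; ring

lemma dlt_tst {φ : E → ℝ} (hφ : ContDiff ℝ ∞ φ) {a : E → ℂ} (ha : Tst D a) (v : E) :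
    Tst D (dlt φ v a) :=
  (ha.dz v).sub' (ha.mul_smooth (contDiff_dz (cx_smooth hφ) v))

/-- weighted inner product -/
def ip (μ : Measure E) (φ : E → ℝ) (a b : E → ℂ) : ℂ := ∫ x, a x * conj (b x) * wt φ x ∂μ

lemma ip_conj (φ : E → ℝ) (a b : E → ℂ) : conj (ip μ φ a b) = ip μ φ b a := by
  unfold ip
  rw [← integral_conj]
  congr 1; ext x; simp only [wt, map_mul, Complex.conj_ofReal, Complex.conj_conj]; ring

lemma ip_tst {φ : E → ℝ} (hφ : ContDiff ℝ ∞ φ) {a b : E → ℂ} (ha : Tst D a) (hb : Tst D b) :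
    Tst D (fun x => a x * conj (b x) * wt φ x) := by
  have := (hb.conj'.mul_smooth ha.smooth).mul_smooth (wt_smooth hφ)
  simpa [mul_comm, mul_assoc, mul_left_comm] using this

lemma ip_adj {φ : E → ℝ} (hφ : ContDiff ℝ ∞ φ) {a b : E → ℂ} (ha : Tst D a) (hb : Tst D b) (v : E) :
    ip μ φ a (dlt φ v b) = - ip μ φ (dzb v a) b := by
  have h0 : ContDiff ℝ ∞ (fun x => conj (b x) * wt φ x) := hb.conj'.smooth.mul (wt_smooth hφ)
  have h1 := ibp_dzb (μ := μ) h0 ha v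
  unfold ip
  have e1 : ∀ x, dzb v a x * conj (b x) * wt φ x = conj (b x) * wt φ x * dzb v a x := by
    intro x; ring
  have e2 : ∀ x, dzb v (fun x => conj (b x) * wt φ x) x * a x
      = a x * conj (dlt φ v b x) * wt φ x := by
    intro x
    rw [dzb_mul (hb.conj'.diff x) (contDiff_diff (wt_smooth hφ) x), dzb_conj,
      dzb_wt (contDiff_diff' hφ x)]
    simp only [dlt, map_sub, map_mul, conj_dz_cx]
    ring
  simp_rw [e1, h1, e2, neg_neg]
where
  contDiff_diff' {φ : E → ℝ} (hφ : ContDiff ℝ ∞ φ) (x : E) : DifferentiableAt ℝ φ x :=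
    hφ.contDiffAt.differentiableAt (by simp)

lemma ip_adj' {φ : E → ℝ} (hφ : ContDiff ℝ ∞ φ) {a b : E → ℂ} (ha : Tst D a) (hb : Tst D b) (v : E) :
    ip μ φ (dlt φ v b) a = - ip μ φ b (dzb v a) := by
  rw [← ip_conj, ip_adj hφ ha hb, map_neg, ip_conj]

lemma dzb_dlt {φ : E → ℝ} (hφ : ContDiff ℝ ∞ φ) {a : E → ℂ} (ha : Tst D a) (v w : E) (x : E) :
    dzb w (dlt φ v a) x = dlt φ v (dzb w a) x - dzb w (dz v (cx φ)) x * a x := by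
  have h1 := contDiff_dz (cx_smooth hφ) v
  unfold dlt
  rw [dzb_sub ((ha.dz v).diff x) ((ha.mul_smooth h1).diff x),
    dzb_mul (contDiff_diff h1 x) (ha.diff x), dzb_dz_comm ha.smooth]
  ring

lemma ip_main {φ : E → ℝ} (hφ : ContDiff ℝ ∞ φ) {a b : E → ℂ} (ha : Tst D a) (hb : Tst D b)
    (v w : E) :
    ip μ φ (dlt φ v a) (dlt φ w b) = ip μ φ (dzb w a) (dzb v b)
      + ip μ φ (fun x => dzb w (dz v (cx φ)) x * a x) b := by
  have hc : Tst D (fun x => dzb w (dz v (cx φ)) x * a x) :=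
    ha.mul_smooth (contDiff_dzb (contDiff_dz (cx_smooth hφ) v) w)
  rw [ip_adj hφ (dlt_tst hφ ha v) hb]
  have e : ip μ φ (dzb w (dlt φ v a)) b = ip μ φ (dlt φ v (dzb w a)) b
      - ip μ φ (fun x => dzb w (dz v (cx φ)) x * a x) b := by
    unfold ip
    rw [← integral_sub (ip_tst hφ (dlt_tst hφ (ha.dzb w) v) hb).integrable
      (ip_tst hφ hc hb).integrable]
    congr 1; ext x; rw [dzb_dlt hφ ha]; ring
  rw [e, ip_adj' hφ hb (ha.dzb w)]
  ring

variable {ι : Type*} [Fintype ι]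

theorem basic_ineq {φ : E → ℝ} (hφ : ContDiff ℝ ∞ φ) (e : ι → E) {h : ι → E → ℂ}
    (hh : ∀ j, Tst D (h j)) :
    ∫ x, (∑ j, ∑ k, dzb (e k) (dz (e j) (cx φ)) x * h j x * conj (h k x)).re * Real.exp (-φ x) ∂μ
    ≤ ∫ x, ‖∑ j, dlt φ (e j) (h j) x‖ ^ 2 * Real.exp (-φ x) ∂μ
      + 1 / 2 * ∑ j, ∑ k, ∫ x, ‖dzb (e k) (h j) x - dzb (e j) (h k) x‖ ^ 2 * Real.exp (-φ x) ∂μ := by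
  have hre : ∀ {f : E → ℂ}, Tst D f → ∫ x, (f x).re ∂μ = (∫ x, f x ∂μ).re := fun hf => by
    have := integral_re (𝕜 := ℂ) hf.integrable (μ := μ)
    simpa using this
  have t1 : ∀ j k, Tst D (fun x => dzb (e k) (dz (e j) (cx φ)) x * h j x) := fun j k =>
    (hh j).mul_smooth (contDiff_dzb (contDiff_dz (cx_smooth hφ) _) _)
  have td : ∀ j, Tst D (dlt φ (e j) (h j)) := fun j => dlt_tst hφ (hh j) _
  -- first integral
  have A1 : ∫ x, (∑ j, ∑ k, dzb (e k) (dz (e j) (cx φ)) x * h j x * conj (h k x)).re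
      * Real.exp (-φ x) ∂μ
      = (∑ j, ∑ k, ip μ φ (fun x => dzb (e k) (dz (e j) (cx φ)) x * h j x) (h k)).re := by
    have : ∀ x, (∑ j, ∑ k, dzb (e k) (dz (e j) (cx φ)) x * h j x * conj (h k x)).re
      * Real.exp (-φ x) = (∑ j, ∑ k, dzb (e k) (dz (e j) (cx φ)) x * h j x * conj (h k x)
        * wt φ x).re := by
      intro x; simp only [← Finset.sum_mul, wt, Complex.re_mul_ofReal]
    simp_rw [this]
    rw [hre (Tst.sum _ fun j => Tst.sum _ fun k => ip_tst hφ (t1 j k) (hh k))]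
    rw [integral_finset_sum _ fun j _ => (Tst.sum _ fun k => ip_tst hφ (t1 j k) (hh k)).integrable]
    congr 2; ext j
    rw [integral_finset_sum _ fun k _ => (ip_tst hφ (t1 j k) (hh k)).integrable]
    rfl
  have A2 : ∫ x, ‖∑ j, dlt φ (e j) (h j) x‖ ^ 2 * Real.exp (-φ x) ∂μ
      = (∑ j, ∑ k, ip μ φ (dlt φ (e j) (h j)) (dlt φ (e k) (h k))).re := by
    have : ∀ x, ‖∑ j, dlt φ (e j) (h j) x‖ ^ 2 * Real.exp (-φ x)
      = (∑ j, ∑ k, dlt φ (e j) (h j) x * conj (dlt φ (e k) (h k) x) * wt φ x).re := by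
      intro x
      have e1 : ((‖∑ j, dlt φ (e j) (h j) x‖ ^ 2 : ℝ) : ℂ)
        = ∑ j, ∑ k, dlt φ (e j) (h j) x * conj (dlt φ (e k) (h k) x) := by
        rw [← Finset.sum_mul_sum, ← map_sum, Complex.mul_conj, Complex.normSq_eq_norm_sq]
      simp only [← Finset.sum_mul, wt, Complex.re_mul_ofReal, ← e1, Complex.ofReal_re]
    simp_rw [this]
    rw [hre (Tst.sum _ fun j => Tst.sum _ fun k => ip_tst hφ (td j) (td k))]
    rw [integral_finset_sum _ fun j _ => (Tst.sum _ fun k => ip_tst hφ (td j) (td k)).integrable]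
    congr 2; ext j
    rw [integral_finset_sum _ fun k _ => (ip_tst hφ (td j) (td k)).integrable]
    rfl
  have A3 : ∀ j k, ∫ x, ‖dzb (e k) (h j) x - dzb (e j) (h k) x‖ ^ 2 * Real.exp (-φ x) ∂μ
      = (ip μ φ (dzb (e k) (h j)) (dzb (e k) (h j))).re
        + (ip μ φ (dzb (e j) (h k)) (dzb (e j) (h k))).re
        - (ip μ φ (dzb (e k) (h j)) (dzb (e j) (h k))).re
        - (ip μ φ (dzb (e j) (h k)) (dzb (e k) (h j))).re := by
    intro j k
    have i1 := ip_tst hφ ((hh j).dzb (e k)) ((hh j).dzb (e k))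
    have i2 := ip_tst hφ ((hh k).dzb (e j)) ((hh k).dzb (e j))
    have i3 := ip_tst hφ ((hh j).dzb (e k)) ((hh k).dzb (e j))
    have i4 := ip_tst hφ ((hh k).dzb (e j)) ((hh j).dzb (e k))
    unfold ip
    rw [← Complex.add_re, ← Complex.sub_re, ← Complex.sub_re,
      ← integral_add i1.integrable i2.integrable,
      ← integral_sub (i1.add i2).integrable i3.integrable,
      ← integral_sub ((i1.add i2).sub' i3).integrable i4.integrable,
      ← hre (((i1.add i2).sub' i3).sub' i4)]
    congr 1; ext x
    set p := dzb (e k) (h j) x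
    set q := dzb (e j) (h k) x
    have e1 : ((‖p - q‖ ^ 2 : ℝ) : ℂ) = (p - q) * conj (p - q) := by
      rw [Complex.mul_conj, Complex.normSq_eq_norm_sq]
    have e2 : p * conj p * wt φ x + q * conj q * wt φ x - p * conj q * wt φ x
        - q * conj p * wt φ x = ((‖p - q‖ ^ 2 : ℝ) : ℂ) * wt φ x := by
      rw [e1, map_sub]; ring
    rw [e2, wt, Complex.re_mul_ofReal, Complex.ofReal_re]
  have A4 : ∀ j k, 0 ≤ (ip μ φ (dzb (e k) (h j)) (dzb (e k) (h j))).re := by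
    intro j k
    unfold ip
    rw [← hre (ip_tst hφ ((hh j).dzb (e k)) ((hh j).dzb (e k)))]
    apply integral_nonneg
    intro x
    simp only [wt, Complex.mul_conj, Complex.re_mul_ofReal, Complex.ofReal_re, Pi.zero_apply]
    exact mul_nonneg (Complex.normSq_nonneg _) (Real.exp_pos _).le
  rw [A1, A2]
  simp_rw [A3]
  have A5 : ∑ j, ∑ k, ip μ φ (dlt φ (e j) (h j)) (dlt φ (e k) (h k))
      = ∑ j, ∑ k, ip μ φ (dzb (e k) (h j)) (dzb (e j) (h k))
        + ∑ j, ∑ k, ip μ φ (fun x => dzb (e k) (dz (e j) (cx φ)) x * h j x) (h k) := by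
    simp_rw [ip_main hφ (hh _) (hh _), Finset.sum_add_distrib]
  rw [A5, Complex.add_re]
  simp only [Finset.sum_sub_distrib, Finset.sum_add_distrib]
  rw [Finset.sum_comm (f := fun j k => (ip μ φ (dzb (e j) (h k)) (dzb (e j) (h k))).re),
    Finset.sum_comm (f := fun j k => (ip μ φ (dzb (e j) (h k)) (dzb (e k) (h j))).re)]
  have : 0 ≤ ∑ j, ∑ k, (ip μ φ (dzb (e k) (h j)) (dzb (e k) (h j))).re :=
    Finset.sum_nonneg fun j _ => Finset.sum_nonneg fun k _ => A4 j k
  simp only [Complex.re_sum]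
  linarith

end Basic
end SteinAux

namespace SteinAux
open MeasureTheory Complex Filter
open scoped ContDiff ComplexConjugate

section Levi
variable {E : Type*} [NormedAddCommGroup E] [NormedSpace ℂ E] [NormedSpace ℝ E] [IsScalarTower ℝ ℂ E]
variable [FiniteDimensional ℝ E] [MeasurableSpace E] [BorelSpace E]

/-- Levi form (unnormalized). -/
def levi (φ : E → ℝ) (x v : E) : ℝ :=
  fderiv ℝ (fderiv ℝ φ) x v v + fderiv ℝ (fderiv ℝ φ) x (I • v) (I • v)

lemma levi_congr {φ ψ : E → ℝ} {x : E} (h : φ =ᶠ[𝓝 x] ψ) (v : E) : levi φ x v = levi ψ x v := by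
  simp only [levi, h.fderiv.fderiv_eq]

/-- sesquilinear form attached to a real bilinear form -/
def HH (Q : E → E → ℂ) (v w : E) : ℂ :=
  (Q w v - I * Q w (I • v) + I * Q (I • w) v + Q (I • w) (I • v)) / 4

lemma complex_smul (c : ℂ) (v : E) : c • v = c.re • v + c.im • (I • v) := by
  conv_lhs => rw [← Complex.re_add_im c]
  rw [add_smul, mul_smul]
  congr 1
  · exact algebraMap_smul ℂ c.re v
  · exact algebraMap_smul ℂ c.im (I • v)

lemma real_smul_comm (r : ℝ) (v : E) : I • (r • v) = r • (I • v) := by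
  rw [← algebraMap_smul ℂ r v, ← algebraMap_smul ℂ r (I • v), smul_comm]

lemma II_smul (v : E) : I • (I • v) = -v := by
  rw [smul_smul, I_mul_I, neg_one_smul]

variable {Q : E → E → ℂ}
structure Bilin (Q : E → E → ℂ) : Prop where
  add_left : ∀ a b c, Q (a + b) c = Q a c + Q b c
  add_right : ∀ a b c, Q c (a + b) = Q c a + Q c b
  smul_left : ∀ (r : ℝ) a c, Q (r • a) c = r * Q a c
  smul_right : ∀ (r : ℝ) a c, Q c (r • a) = r * Q c a

lemma Bilin.neg_left (h : Bilin Q) (a c : E) : Q (-a) c = - Q a c := by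
  have := h.smul_left (-1) a c
  simpa using this
lemma Bilin.neg_right (h : Bilin Q) (a c : E) : Q c (-a) = - Q c a := by
  have := h.smul_right (-1) a c
  simpa using this
lemma Bilin.zero_left (h : Bilin Q) (c : E) : Q 0 c = 0 := by
  have := h.smul_left 0 0 c
  simpa using this
lemma Bilin.zero_right (h : Bilin Q) (c : E) : Q c 0 = 0 := by
  have := h.smul_right 0 0 c
  simpa using this

lemma HH_smul_left (h : Bilin Q) (c : ℂ) (v w : E) : HH Q (c • v) w = c * HH Q v w := by
  rw [complex_smul c v]
  simp only [HH, h.add_right, h.smul_right, smul_add, real_smul_comm, II_smul, smul_neg, h.neg_right]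
  have e := Complex.re_add_im c
  generalize hr : ((c.re : ℝ) : ℂ) = r at *
  generalize hi : ((c.im : ℝ) : ℂ) = s at *
  rw [← e]
  linear_combination ((s * Q w (I • v) - s * Q (I • w) v)/4 - s * Q w (I • v)/4 + s * Q (I • w) v / 4
    + (s * Q w (I • v) - s * Q (I • w) v)/4) * Complex.I_sq

lemma HH_smul_right (h : Bilin Q) (c : ℂ) (v w : E) : HH Q v (c • w) = conj c * HH Q v w := by
  rw [complex_smul c w]
  simp only [HH, h.add_left, h.smul_left, smul_add, real_smul_comm, II_smul, smul_neg, h.neg_left]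
  have e : conj c = c.re - c.im * I := by
    apply Complex.ext <;> simp
  rw [e]
  linear_combination (( - (c.im:ℂ) * Q w (I • v) + c.im * Q (I • w) v)/4) * Complex.I_sq

lemma HH_sum (h : Bilin Q) {ι : Type*} [Fintype ι] (e : ι → E) (t : ι → ℂ) :
    ∑ j, ∑ k, HH Q (e j) (e k) * t j * conj (t k) = HH Q (∑ j, t j • e j) (∑ j, t j • e j) := by
  have aL : ∀ a b c, HH Q (a + b) c = HH Q a c + HH Q b c := by
    intro a b c; simp only [HH, h.add_right, smul_add]; ring
  have aR : ∀ a b c, HH Q c (a + b) = HH Q c a + HH Q c b := by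
    intro a b c; simp only [HH, h.add_left, smul_add]; ring
  have sL : ∀ (s : Finset ι) w, HH Q (∑ j ∈ s, t j • e j) w = ∑ j ∈ s, t j * HH Q (e j) w := by
    classical
    intro s w
    induction s using Finset.induction_on with
    | empty => simp [HH, h.zero_right]
    | insert a s ha ih => rw [Finset.sum_insert ha, Finset.sum_insert ha, aL, ih, HH_smul_left h]
  have sR : ∀ (s : Finset ι) v, HH Q v (∑ j ∈ s, t j • e j) = ∑ j ∈ s, conj (t j) * HH Q v (e j) := by
    classical
    intro s w
    induction s using Finset.induction_on with
    | empty => simp [HH, h.zero_left]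
    | insert a s ha ih => rw [Finset.sum_insert ha, Finset.sum_insert ha, aR, ih, HH_smul_right h]
  rw [sL]
  simp_rw [sR, Finset.mul_sum]
  refine Finset.sum_congr rfl fun j _ => Finset.sum_congr rfl fun k _ => ?_
  ring

lemma levi_sum {φ : E → ℝ} (hφ : ContDiff ℝ ∞ φ) {ι : Type*} [Fintype ι] (e : ι → E)
    (t : ι → ℂ) (x : E) :
    ∑ j, ∑ k, dzb (e k) (dz (e j) (cx φ)) x * t j * conj (t k)
      = ((levi φ x (∑ j, t j • e j) / 4 : ℝ) : ℂ) := by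
  set Q : E → E → ℂ := fun a b => fderiv ℝ (fderiv ℝ (cx φ)) x a b with hQ
  have hb : Bilin Q := by
    constructor <;> intros <;> simp [hQ]
  have h1 : ∀ v w, dzb w (dz v (cx φ)) x = HH Q v w := by
    intro v w
    simp only [dzb.eq_1 w, fderiv_dz (cx_smooth hφ), HH, hQ]
    linear_combination (-(fderiv ℝ (fderiv ℝ (cx φ)) x (I • w)) (I • v) / 4) * Complex.I_sq
  simp_rw [h1]
  rw [HH_sum hb]
  set τ := ∑ j, t j • e j
  have hs : ∀ a b, Q a b = Q b a := fun a b => fderiv2_symm (cx_smooth hφ) x b a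
  have hr : ∀ a b, Q a b = ((fderiv ℝ (fderiv ℝ φ) x a b : ℝ) : ℂ) := by
    intro a b
    have hd : DifferentiableAt ℝ (fderiv ℝ φ) x :=
      (hφ.fderiv_right (m := ∞) (by simp)).contDiffAt.differentiableAt (by simp)
    have e1 : fderiv ℝ (cx φ) = fun y => Complex.ofRealCLM.comp (fderiv ℝ φ y) := by
      ext y v
      rw [fderiv_cx (hφ.contDiffAt.differentiableAt (by simp))]; simp
    have e2 : HasFDerivAt (fun y => Complex.ofRealCLM.comp (fderiv ℝ φ y)) _ x :=
      (ContinuousLinearMap.compL ℝ E ℝ ℂ Complex.ofRealCLM).hasFDerivAt.comp x hd.hasFDerivAt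
    simp only [hQ, e1]
    rw [e2.fderiv]; simp
  simp only [HH, levi]
  rw [hs (I • τ) τ]
  push_cast
  rw [← hr, ← hr]; ring

end Levi
end SteinAux

namespace SteinAux
open MeasureTheory Complex Filter
open scoped ContDiff ComplexConjugate

section Moll
variable {E : Type*} [NormedAddCommGroup E] [NormedSpace ℂ E] [NormedSpace ℝ E] [IsScalarTower ℝ ℂ E]
variable [FiniteDimensional ℝ E] [MeasurableSpace E] [BorelSpace E]
variable {ι : Type*} [Fintype ι] (b : Module.Basis ι ℂ E)

/-- squared coordinate norm -/
def N2 (x : E) : ℝ := ∑ j, Complex.normSq (b.repr x j)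

lemma coord_contDiff (j : ι) : ContDiff ℝ ∞ (fun x => b.repr x j) := by
  have : FiniteDimensional ℂ E := b.finiteDimensional_of_finite
  let l : E →ₗ[ℝ] ℂ := (b.coord j).restrictScalars ℝ
  exact (LinearMap.toContinuousLinearMap l).contDiff

lemma normSq_contDiff : ContDiff ℝ ∞ (fun z : ℂ => Complex.normSq z) := by
  simp only [Complex.normSq_apply]
  exact (Complex.reCLM.contDiff.mul Complex.reCLM.contDiff).add
    (Complex.imCLM.contDiff.mul Complex.imCLM.contDiff)

lemma N2_contDiff : ContDiff ℝ ∞ (N2 b) := by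
  unfold N2
  exact ContDiff.sum fun j _ => normSq_contDiff.comp (coord_contDiff b j)

lemma N2_rot (c : ℂ) (hc : ‖c‖ = 1) (x : E) : N2 b (c • x) = N2 b x := by
  simp [N2, Complex.normSq_eq_norm_sq, hc]

lemma N2_bound (r : ℝ) (hr : 0 ≤ r) (x : E) (hx : N2 b x ≤ r ^ 2) : ‖x‖ ≤ r * ∑ j, ‖b j‖ := by
  have h : ∀ j, ‖b.repr x j‖ ≤ r := by
    intro j
    have h1 : Complex.normSq (b.repr x j) ≤ N2 b x :=
      Finset.single_le_sum (f := fun j => Complex.normSq (b.repr x j))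
        (fun i _ => Complex.normSq_nonneg _) (Finset.mem_univ j)
    rw [Complex.normSq_eq_norm_sq] at h1
    exact (sq_le_sq₀ (norm_nonneg _) hr).1 (h1.trans hx)
  conv_lhs => rw [← b.sum_repr x]
  refine (norm_sum_le _ _).trans ?_
  rw [Finset.mul_sum]
  refine Finset.sum_le_sum fun j _ => ?_
  rw [norm_smul]
  exact mul_le_mul_of_nonneg_right (h j) (norm_nonneg _)

/-- mollifiers -/
structure Moll (μ : Measure E) (ε : ℝ) (η : E → ℝ) : Prop where
  smooth : ContDiff ℝ ∞ η
  nonneg : ∀ x, 0 ≤ η x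
  int : ∫ x, η x ∂μ = 1
  supp : ∀ x, ε ≤ ‖x‖ → η x = 0
  rot : ∀ (c : ℂ) x, ‖c‖ = 1 → η (c • x) = η x

variable {μ : Measure E} [μ.IsAddHaarMeasure]

lemma exists_moll {ι : Type*} [Fintype ι] (b : Module.Basis ι ℂ E) {ε : ℝ} (hε : 0 < ε) : ∃ η : E → ℝ, Moll μ ε η := by
  set C := ∑ j, ‖b j‖ + 1 with hC
  have hC0 : 0 < C := by
    have : 0 ≤ ∑ j, ‖b j‖ := Finset.sum_nonneg fun j _ => norm_nonneg _
    linarith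
  set r := ε / C with hr
  have hr0 : 0 < r := div_pos hε hC0
  have hp : ∀ x, N2 b x ≤ r ^ 2 → ‖x‖ < ε := by
    intro x hx
    refine (N2_bound b r hr0.le x hx).trans_lt ?_
    have : r * C = ε := div_mul_cancel₀ _ hC0.ne'
    nlinarith
  set η0 : E → ℝ := fun x => Real.smoothTransition (1 - N2 b x / r ^ 2) with hη0
  have h1 : ContDiff ℝ ∞ η0 :=
    Real.smoothTransition.contDiff.comp (contDiff_const.sub ((N2_contDiff b).div_const _))
  have h2 : ∀ x, 0 ≤ η0 x := fun x => Real.smoothTransition.nonneg _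
  have h3 : ∀ x, ε ≤ ‖x‖ → η0 x = 0 := by
    intro x hx
    apply Real.smoothTransition.zero_of_nonpos
    have : r ^ 2 ≤ N2 b x := by
      by_contra h
      exact absurd (hp x (not_le.1 h).le) (not_lt.2 hx)
    have : 1 ≤ N2 b x / r ^ 2 := (one_le_div (by positivity)).2 this
    linarith
  have h4 : HasCompactSupport η0 := by
    have : FiniteDimensional ℝ E := inferInstance
    have : ProperSpace E := FiniteDimensional.proper_real E
    exact HasCompactSupport.intro (isCompact_closedBall (0:E) ε) fun x hx => h3 x (by
      simp at hx; exact hx.le)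
  have h5 : 0 < ∫ x, η0 x ∂μ := by
    refine h1.continuous.integral_pos_of_hasCompactSupport_nonneg_nonzero h4 h2 (x := 0) ?_
    simp only [hη0, N2]
    simp
  refine ⟨fun x => (∫ x, η0 x ∂μ)⁻¹ * η0 x, contDiff_const.mul h1,
    fun x => mul_nonneg (inv_nonneg.2 h5.le) (h2 x), ?_, fun x hx => by simp [h3 x hx], ?_⟩
  · rw [integral_const_mul, inv_mul_cancel₀ h5.ne']
  · intro c x hc
    simp only [hη0, N2_rot b c hc]

variable {η : E → ℝ} {ε : ℝ}

lemma Moll.cpt (h : Moll μ ε η) : HasCompactSupport η := by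
  have : ProperSpace E := FiniteDimensional.proper_real E
  exact HasCompactSupport.intro (isCompact_closedBall (0:E) ε) fun x hx => h.supp x (by
      simp at hx; exact hx.le)

lemma Moll.neg (h : Moll μ ε η) (x : E) : η (-x) = η x := by
  have := h.rot (-1) x (by simp)
  simpa using this

/-- the function `t ↦ η (x - t)` is a test function -/
lemma Moll.tst (h : Moll μ ε η) (x : E) {D : Set E} (hD : Metric.closedBall x ε ⊆ D) :
    Tst D (fun t => (η (x - t) : ℂ)) := by
  have : ProperSpace E := FiniteDimensional.proper_real E
  have hs : ∀ t, t ∉ Metric.closedBall x ε → (η (x - t) : ℂ) = 0 := by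
    intro t ht
    rw [h.supp, Complex.ofReal_zero]
    rw [Metric.mem_closedBall, dist_comm, dist_eq_norm] at ht
    exact (not_le.1 ht).le
  refine ⟨Complex.ofRealCLM.contDiff.comp (h.smooth.comp (contDiff_const.sub contDiff_id)),
    HasCompactSupport.intro (isCompact_closedBall x ε) hs, ?_⟩
  refine (closure_minimal (fun t ht => ?_) Metric.isClosed_closedBall).trans hD
  by_contra hcon; exact ht (hs t hcon)

/-- mollification -/
def sm (μ : Measure E) (η : E → ℝ) (f : E → ℂ) (x : E) : ℂ := ∫ t, f t * (η (x - t) : ℂ) ∂μ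

lemma sm_eq (η : E → ℝ) (f : E → ℂ) :
    sm μ η f = MeasureTheory.convolution f (cx η) (ContinuousLinearMap.mul ℝ ℂ) μ := rfl

lemma cx_cpt (h : HasCompactSupport η) : HasCompactSupport (cx η) :=
  h.mono' (fun x hx => subset_tsupport _ (fun h0 => hx (by simp [cx, h0])))

lemma Moll.sm_smooth (h : Moll μ ε η) {f : E → ℂ} (hf : LocallyIntegrable f μ) :
    ContDiff ℝ ∞ (sm μ η f) := by
  rw [sm_eq]
  exact (cx_cpt h.cpt).contDiff_convolution_right _ hf (cx_smooth h.smooth)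

lemma Moll.integrable_mul (h : Moll μ ε η) {f : E → ℂ} (hf : LocallyIntegrable f μ) {g : E → ℂ}
    (hg : Continuous g) (hgc : HasCompactSupport g) : Integrable (fun t => f t * g t) μ := by
  have := hf.integrable_smul_left_of_hasCompactSupport hg hgc
  simpa [mul_comm] using this

lemma Moll.fderiv_sm (h : Moll μ ε η) {f : E → ℂ} (hf : LocallyIntegrable f μ) (x v : E) :
    fderiv ℝ (sm μ η f) x v = - ∫ t, f t * fderiv ℝ (fun t => (η (x - t) : ℂ)) t v ∂μ := by
  have h1 := (cx_cpt h.cpt).hasFDerivAt_convolution_right (ContinuousLinearMap.mul ℝ ℂ) hf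
    ((cx_smooth h.smooth).of_le (by simp)) x
  rw [sm_eq, h1.fderiv, convolution_def]
  rw [ContinuousLinearMap.integral_apply]
  · rw [← integral_neg]
    congr 1; ext t
    have e : fderiv ℝ (fun t => (η (x - t) : ℂ)) t v = - fderiv ℝ (cx η) (x - t) v := by
      have h2 : HasFDerivAt (fun t => x - t) (-(ContinuousLinearMap.id ℝ E)) t := by
        simpa using (hasFDerivAt_id (𝕜 := ℝ) t).const_sub x
      have h3 := ((contDiff_diff (cx_smooth h.smooth) (x - t)).hasFDerivAt).comp t h2
      have h4 : HasFDerivAt (fun t => (η (x - t) : ℂ)) _ t := h3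
      rw [h4.fderiv]; simp
    rw [e]; simp [ContinuousLinearMap.precompR]
  · have h5 : HasCompactSupport (fderiv ℝ (cx η)) := (cx_cpt h.cpt).fderiv ℝ
    have h6 : Continuous (fderiv ℝ (cx η)) := (cx_smooth h.smooth).continuous_fderiv (by simp)
    exact (h5.convolutionExists_right ((ContinuousLinearMap.mul ℝ ℂ).precompR E) hf h6) x

lemma Moll.dz_sm (h : Moll μ ε η) {f : E → ℂ} (hf : LocallyIntegrable f μ) (x v : E) :
    dz v (sm μ η f) x = - ∫ t, f t * dz v (fun t => (η (x - t) : ℂ)) t ∂μ := by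
  have ht := h.tst x (subset_univ _)
  have hi : ∀ w, Integrable (fun t => f t * fderiv ℝ (fun t => (η (x - t) : ℂ)) t w) μ := fun w =>
    h.integrable_mul hf (contDiff_fderiv_apply ht.smooth w).continuous (ht.cpt.fderiv_apply ℝ w)
  have e1 : ∀ t, f t * dz v (fun t => (η (x - t) : ℂ)) t
      = (f t * fderiv ℝ (fun t => (η (x - t) : ℂ)) t v
        - I * (f t * fderiv ℝ (fun t => (η (x - t) : ℂ)) t (I • v))) / 2 := by
    intro t; simp only [dz]; ring
  simp_rw [e1, integral_div]
  rw [integral_sub (hi v) ((hi _).const_mul I), integral_const_mul, dz, h.fderiv_sm hf, h.fderiv_sm hf]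
  ring

lemma Moll.dzb_sm (h : Moll μ ε η) {f : E → ℂ} (hf : LocallyIntegrable f μ) (x v : E) :
    dzb v (sm μ η f) x = - ∫ t, f t * dzb v (fun t => (η (x - t) : ℂ)) t ∂μ := by
  have ht := h.tst x (subset_univ _)
  have hi : ∀ w, Integrable (fun t => f t * fderiv ℝ (fun t => (η (x - t) : ℂ)) t w) μ := fun w =>
    h.integrable_mul hf (contDiff_fderiv_apply ht.smooth w).continuous (ht.cpt.fderiv_apply ℝ w)
  have e1 : ∀ t, f t * dzb v (fun t => (η (x - t) : ℂ)) t
      = (f t * fderiv ℝ (fun t => (η (x - t) : ℂ)) t v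
        + I * (f t * fderiv ℝ (fun t => (η (x - t) : ℂ)) t (I • v))) / 2 := by
    intro t; simp only [dzb]; ring
  simp_rw [e1, integral_div]
  rw [integral_add (hi v) ((hi _).const_mul I), integral_const_mul, dzb, h.fderiv_sm hf, h.fderiv_sm hf]
  ring

lemma Moll.sm_zero (h : Moll μ ε η) {f : E → ℂ} {x : E}
    (hx : ∀ t, ‖x - t‖ < ε → f t = 0) : sm μ η f x = 0 := by
  unfold sm
  rw [integral_eq_zero_of_ae]
  refine Eventually.of_forall fun t => ?_
  by_cases ht : ‖x - t‖ < ε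
  · simp [hx t ht]
  · simp [h.supp _ (not_lt.1 ht)]

lemma Moll.sm_tst (h : Moll μ ε η) {f : E → ℂ} (hf : LocallyIntegrable f μ) {K : Set E}
    (hK : IsCompact K) (h0 : ∀ x, x ∉ K → f x = 0) : Tst univ (sm μ η f) := by
  have : ProperSpace E := FiniteDimensional.proper_real E
  refine ⟨h.sm_smooth hf, ?_, subset_univ _⟩
  refine HasCompactSupport.intro (hK.cthickening (r := ε)) fun x hx => ?_
  apply h.sm_zero
  intro t ht
  apply h0
  intro htK
  apply hx
  exact Metric.mem_cthickening_of_dist_le x t ε K htK (by rw [dist_eq_norm]; exact ht.le)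

end Moll
end SteinAux

namespace SteinAux
open MeasureTheory Complex Filter
open scoped ContDiff ComplexConjugate

section L2
variable {E : Type*} [NormedAddCommGroup E] [NormedSpace ℂ E] [NormedSpace ℝ E] [IsScalarTower ℝ ℂ E]
variable [FiniteDimensional ℝ E] [MeasurableSpace E] [BorelSpace E]
variable {μ : Measure E} [μ.IsAddHaarMeasure] {η : E → ℝ} {ε : ℝ}

lemma memLp_sq {f : E → ℂ} (hf : MemLp f 2 μ) : Integrable (fun x => ‖f x‖ ^ 2) μ :=
  (memLp_two_iff_integrable_sq_norm hf.1).1 hf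

lemma memLp_loc {f : E → ℂ} (hf : MemLp f 2 μ) : LocallyIntegrable f μ :=
  hf.locallyIntegrable (by norm_num)

lemma eLpNorm_eq {f : E → ℂ} (hf : MemLp f 2 μ) :
    eLpNorm f 2 μ = ENNReal.ofReal (Real.sqrt (∫ x, ‖f x‖ ^ 2 ∂μ)) := by
  rw [hf.eLpNorm_eq_integral_rpow_norm (by norm_num) (by norm_num), Real.sqrt_eq_rpow]
  simp

lemma Moll.jensen (h : Moll μ ε η) {f : E → ℂ} (hf : MemLp f 2 μ) (x : E) :
    ‖sm μ η f x‖ ^ 2 ≤ ∫ t, ‖f t‖ ^ 2 * η (x - t) ∂μ := by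
  have hc : Continuous (fun t => η (x - t)) := h.smooth.continuous.comp (continuous_const.sub continuous_id)
  have ht := h.tst x (subset_univ _)
  have hcc : HasCompactSupport (fun t => η (x - t)) := ht.cpt.mono' (fun t hx => by
    apply subset_tsupport; intro h0; apply hx; exact Complex.ofReal_eq_zero.1 h0)
  have i2 : Integrable (fun t => ‖f t‖ ^ 2 * η (x - t)) μ := by
    have := ((memLp_sq hf).locallyIntegrable).integrable_smul_left_of_hasCompactSupport hc hcc
    simpa [mul_comm] using this
  have i1 : Integrable (fun t => ‖f t‖ * η (x - t)) μ := by
    have := (hf.norm.locallyIntegrable (by norm_num)).integrable_smul_left_of_hasCompactSupport hc hcc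
    simpa [mul_comm] using this
  have i0 : Integrable (fun t => η (x - t)) μ := hc.integrable_of_hasCompactSupport hcc
  have e0 : ∫ t, η (x - t) ∂μ = 1 := by
    rw [integral_sub_left_eq_self (fun t => η t) μ x]; exact h.int
  set m := ∫ t, ‖f t‖ * η (x - t) ∂μ with hm
  have hm0 : ‖sm μ η f x‖ ≤ m := by
    unfold sm
    refine (norm_integral_le_integral_norm _).trans_eq ?_
    congr 1; ext t; rw [norm_mul, Complex.norm_real, Real.norm_of_nonneg (h.nonneg _)]
  have key : 0 ≤ ∫ t, (‖f t‖ - m) ^ 2 * η (x - t) ∂μ :=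
    integral_nonneg fun t => mul_nonneg (sq_nonneg _) (h.nonneg _)
  have e1 : ∀ t, (‖f t‖ - m) ^ 2 * η (x - t)
      = ‖f t‖ ^ 2 * η (x - t) - 2 * m * (‖f t‖ * η (x - t)) + m ^ 2 * η (x - t) := by
    intro t; ring
  simp_rw [e1] at key
  rw [integral_add (by exact i2.sub (i1.const_mul _)) (i0.const_mul _), integral_sub i2 (i1.const_mul _),
    integral_const_mul, integral_const_mul, e0, ← hm] at key
  have : ‖sm μ η f x‖ ^ 2 ≤ m ^ 2 := pow_le_pow_left₀ (norm_nonneg _) hm0 2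
  nlinarith

lemma Moll.conv_int (h : Moll μ ε η) {f : E → ℂ} (hf : MemLp f 2 μ) :
    Integrable (fun x => ∫ t, ‖f t‖ ^ 2 * η (x - t) ∂μ) μ ∧
    ∫ x, ∫ t, ‖f t‖ ^ 2 * η (x - t) ∂μ ∂μ = ∫ t, ‖f t‖ ^ 2 ∂μ := by
  have hη : Integrable η μ := h.smooth.continuous.integrable_of_hasCompactSupport h.cpt
  constructor
  · exact (memLp_sq hf).integrable_convolution (ContinuousLinearMap.mul ℝ ℝ) hη
  · have := integral_convolution (ContinuousLinearMap.mul ℝ ℝ) (memLp_sq hf) hη (μ := μ) (ν := μ)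
    rw [h.int] at this
    simpa [convolution_def] using this

lemma Moll.sm_memLp (h : Moll μ ε η) {f : E → ℂ} (hf : MemLp f 2 μ) : MemLp (sm μ η f) 2 μ := by
  have hc : Continuous (sm μ η f) := (h.sm_smooth (memLp_loc hf)).continuous
  rw [memLp_two_iff_integrable_sq_norm hc.aestronglyMeasurable]
  refine (h.conv_int hf).1.mono' (hc.norm.pow 2).aestronglyMeasurable ?_
  refine Eventually.of_forall fun x => ?_
  rw [Real.norm_of_nonneg (by positivity)]
  exact h.jensen hf x

lemma Moll.young (h : Moll μ ε η) {f : E → ℂ} (hf : MemLp f 2 μ) :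
    eLpNorm (sm μ η f) 2 μ ≤ eLpNorm f 2 μ := by
  rw [eLpNorm_eq (h.sm_memLp hf), eLpNorm_eq hf]
  apply ENNReal.ofReal_le_ofReal
  apply Real.sqrt_le_sqrt
  rw [← (h.conv_int hf).2]
  exact integral_mono (memLp_sq (h.sm_memLp hf)) (h.conv_int hf).1 fun x => h.jensen hf x

lemma Moll.sm_sub (h : Moll μ ε η) {f g : E → ℂ} (hf : MemLp f 2 μ) (hg : MemLp g 2 μ) :
    sm μ η (f - g) = sm μ η f - sm μ η g := by
  ext x
  have ht := h.tst x (subset_univ _)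
  simp only [sm, Pi.sub_apply]
  rw [← integral_sub (h.integrable_mul (memLp_loc hf) ht.cont ht.cpt)
    (h.integrable_mul (memLp_loc hg) ht.cont ht.cpt)]
  congr 1; ext t; ring

lemma Moll.sm_close (h : Moll μ ε η) {g : E → ℂ} (hg : Continuous g) {x : E} {δ : ℝ}
    (hx : ∀ t, ‖x - t‖ < ε → ‖g t - g x‖ ≤ δ) : ‖sm μ η g x - g x‖ ≤ δ := by
  have ht := h.tst x (subset_univ _)
  have e0 : ∫ t, (η (x - t) : ℂ) ∂μ = 1 := by
    rw [integral_complex_ofReal, integral_sub_left_eq_self (fun t => η t) μ x, h.int]; simp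
  have e1 : g x = ∫ t, g x * (η (x - t) : ℂ) ∂μ := by rw [integral_const_mul, e0, mul_one]
  have e2 : sm μ η g x - g x = ∫ t, (g t - g x) * (η (x - t) : ℂ) ∂μ := by
    conv_lhs => rw [e1]
    unfold sm
    rw [← integral_sub (h.integrable_mul hg.locallyIntegrable ht.cont ht.cpt)
      (ht.integrable.const_mul _)]
    congr 1; ext t; ring
  rw [e2]
  have e3 : δ = ∫ t, δ * η (x - t) ∂μ := by
    rw [integral_const_mul, integral_sub_left_eq_self (fun t => η t) μ x, h.int, mul_one]
  rw [e3]
  refine norm_integral_le_of_norm_le ?_ (Eventually.of_forall fun t => ?_)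
  · have := ht.integrable (μ := μ)
    exact (this.re).const_mul δ
  · rw [norm_mul, Complex.norm_real, Real.norm_of_nonneg (h.nonneg _)]
    by_cases ht : ‖x - t‖ < ε
    · exact mul_le_mul_of_nonneg_right (hx t ht) (h.nonneg _)
    · simp [h.supp _ (not_lt.1 ht)]

lemma tendsto_sm {f : E → ℂ} (hf : MemLp f 2 μ) {η : ℕ → E → ℝ} {ε : ℕ → ℝ}
    (h : ∀ n, Moll μ (ε n) (η n)) (hε : Tendsto ε atTop (𝓝 0)) :
    Tendsto (fun n => eLpNorm (sm μ (η n) f - f) 2 μ) atTop (𝓝 0) := by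
  have : ProperSpace E := FiniteDimensional.proper_real E
  rw [ENNReal.tendsto_atTop_zero]
  intro δ hδ
  have hδ3 : δ / 3 ≠ 0 := by
    simp [hδ.ne']
  obtain ⟨g, hgc, hfg, hg, hgL⟩ := hf.exists_hasCompactSupport_eLpNorm_sub_le (by norm_num) hδ3
  -- uniform smallness
  set K := Metric.cthickening 1 (tsupport g) with hK
  have hKc : IsCompact K := hgc.isCompact.cthickening
  have hKm : μ K ^ (1 / (2:ENNReal).toReal) ≠ ⊤ :=
    ENNReal.rpow_ne_top_of_nonneg (by norm_num) hKc.measure_lt_top.ne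
  obtain ⟨δ', hδ'0, hδ'⟩ : ∃ δ' : ℝ, 0 < δ' ∧ ENNReal.ofReal δ' * μ K ^ (1 / (2:ENNReal).toReal) ≤ δ / 3 := by
    by_cases hd : δ = ⊤
    · refine ⟨1, one_pos, ?_⟩
      rw [hd, ENNReal.top_div_of_ne_top (by norm_num)]; exact le_top
    · set c := (μ K ^ (1 / (2:ENNReal).toReal)).toReal
      have hc : 0 ≤ c := ENNReal.toReal_nonneg
      have hd3 : δ / 3 ≠ ⊤ := ENNReal.div_ne_top hd (by norm_num)
      have hpos : 0 < (δ / 3).toReal := ENNReal.toReal_pos hδ3 hd3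
      refine ⟨(δ / 3).toReal / (c + 1), by positivity, ?_⟩
      rw [← ENNReal.ofReal_toReal hKm, ← ENNReal.ofReal_mul (by positivity)]
      refine ENNReal.ofReal_le_of_le_toReal ?_
      rw [div_mul_eq_mul_div, div_le_iff₀ (by positivity)]
      nlinarith
  have hu := (hg.uniformContinuous_of_tendsto_cocompact (hgc.is_zero_at_infty))
  rw [Metric.uniformContinuous_iff] at hu
  obtain ⟨r, hr, hur⟩ := hu δ' hδ'0
  have hev : ∀ᶠ n in atTop, ε n < min r 1 := hε.eventually (gt_mem_nhds (lt_min hr one_pos))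
  obtain ⟨N, hN⟩ := eventually_atTop.1 hev
  refine ⟨N, fun n hn => ?_⟩
  have hn1 := hN n hn
  have hsg : eLpNorm (sm μ (η n) g - g) 2 μ ≤ δ / 3 := by
    have hb : ∀ x, ‖(sm μ (η n) g - g) x‖ ≤ ‖K.indicator (fun _ => (δ' : ℝ)) x‖ := by
      intro x
      by_cases hx : x ∈ K
      · rw [indicator_of_mem hx, Real.norm_of_nonneg hδ'0.le]
        refine (h n).sm_close hg fun t ht => ?_
        rw [← dist_eq_norm]
        refine (hur ?_).le
        rw [dist_comm, dist_eq_norm]; exact ht.trans (hn1.trans_le (min_le_left _ _))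
      · have hz : ∀ t, ‖x - t‖ ≤ 1 → g t = 0 := by
          intro t ht
          apply image_eq_zero_of_notMem_tsupport
          intro htt
          exact hx (Metric.mem_cthickening_of_dist_le x t 1 _ htt (by rw [dist_eq_norm]; exact ht))
        rw [indicator_of_notMem hx, Pi.sub_apply,
          (h n).sm_zero (fun t ht => hz t (ht.le.trans (hn1.le.trans (min_le_right _ _)))),
          hz x (by simp)]
        simp
    refine (eLpNorm_mono hb).trans ((eLpNorm_indicator_const_le _ _).trans ?_)
    rwa [Real.enorm_of_nonneg hδ'0.le]
  have e : sm μ (η n) f - f = sm μ (η n) (f - g) + ((sm μ (η n) g - g) + (g - f)) := by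
    rw [(h n).sm_sub hf hgL]; abel
  rw [e]
  have m1 := ((h n).sm_memLp (hf.sub hgL)).1
  have m2 := (((h n).sm_memLp hgL).sub hgL).1
  have m3 := (hgL.sub hf).1
  refine (eLpNorm_add_le m1 (m2.add m3) (by norm_num)).trans ?_
  have h2 := eLpNorm_add_le m2 m3 (p := 2) (by norm_num)
  have h3 := (h n).young (hf.sub hgL)
  have h4 : eLpNorm (g - f) 2 μ ≤ δ / 3 := by rw [eLpNorm_sub_comm]; exact hfg
  calc _ ≤ δ / 3 + (δ / 3 + δ / 3) := by
        gcongr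
        · exact h3.trans hfg
        · exact h2.trans (by gcongr)
    _ = δ := by rw [← add_assoc, ENNReal.add_thirds]

lemma tendsto_int_mul {f g : E → ℂ} {F G : ℕ → E → ℂ} (hf : MemLp f 2 μ) (hg : MemLp g 2 μ)
    (hF : ∀ n, MemLp (F n) 2 μ) (hG : ∀ n, MemLp (G n) 2 μ)
    (tF : Tendsto (fun n => eLpNorm (F n - f) 2 μ) atTop (𝓝 0))
    (tG : Tendsto (fun n => eLpNorm (G n - g) 2 μ) atTop (𝓝 0)) :
    Tendsto (fun n => ∫ x, F n x * conj (G n x) ∂μ) atTop (𝓝 (∫ x, f x * conj (g x) ∂μ)) := by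
  have h1 := (Lp.tendsto_Lp_iff_tendsto_eLpNorm'' F hF f hf).2 tF
  have h2 := (Lp.tendsto_Lp_iff_tendsto_eLpNorm'' G hG g hg).2 tG
  have h3 := h2.inner (𝕜 := ℂ) h1
  have e : ∀ {a b : E → ℂ} (ha : MemLp a 2 μ) (hb : MemLp b 2 μ),
      inner ℂ (hb.toLp b) (ha.toLp a) = ∫ x, a x * conj (b x) ∂μ := by
    intro a b ha hb
    rw [L2.inner_def]
    refine integral_congr_ae ?_
    filter_upwards [ha.coeFn_toLp, hb.coeFn_toLp] with x h1 h2
    rw [h1, h2, RCLike.inner_apply]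
  simpa only [e] using h3

/-- bounded multipliers preserve L2 convergence -/
lemma tendsto_mul_bdd {f : E → ℂ} {F : ℕ → E → ℂ} {c : E → ℂ} {C : ℝ} (hC : ∀ x, ‖c x‖ ≤ C)
    (tF : Tendsto (fun n => eLpNorm (F n - f) 2 μ) atTop (𝓝 0)) :
    Tendsto (fun n => eLpNorm ((fun x => c x * F n x) - fun x => c x * f x) 2 μ) atTop (𝓝 0) := by
  have h0 : Tendsto (fun n => ENNReal.ofReal C * eLpNorm (F n - f) 2 μ) atTop (𝓝 0) := by
    have := ENNReal.Tendsto.const_mul tF (a := ENNReal.ofReal C) (Or.inr ENNReal.ofReal_ne_top)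
    simpa using this
  refine tendsto_of_tendsto_of_tendsto_of_le_of_le tendsto_const_nhds h0 (fun _ => zero_le) ?_
  intro n
  refine eLpNorm_le_mul_eLpNorm_of_ae_le_mul (Eventually.of_forall fun x => ?_) _
  simp only [Pi.sub_apply, ← mul_sub, norm_mul]
  exact mul_le_mul_of_nonneg_right (hC x) (norm_nonneg _)

lemma memLp_mul_bdd {f c : E → ℂ} {C : ℝ} (hc : Continuous c) (hC : ∀ x, ‖c x‖ ≤ C)
    (hf : MemLp f 2 μ) : MemLp (fun x => c x * f x) 2 μ := by
  refine MemLp.of_le_mul (c := C) hf (hc.aestronglyMeasurable.mul hf.1) (Eventually.of_forall fun x => ?_)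
  rw [norm_mul]
  exact mul_le_mul_of_nonneg_right (hC x) (norm_nonneg _)

lemma tendsto_add_L2 {f g : E → ℂ} {F G : ℕ → E → ℂ} (hf : MemLp f 2 μ) (hg : MemLp g 2 μ)
    (hF : ∀ n, MemLp (F n) 2 μ) (hG : ∀ n, MemLp (G n) 2 μ)
    (tF : Tendsto (fun n => eLpNorm (F n - f) 2 μ) atTop (𝓝 0))
    (tG : Tendsto (fun n => eLpNorm (G n - g) 2 μ) atTop (𝓝 0)) :
    Tendsto (fun n => eLpNorm ((F n - G n) - (f - g)) 2 μ) atTop (𝓝 0) := by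
  have h0 := tF.add tG
  rw [add_zero] at h0
  refine tendsto_of_tendsto_of_tendsto_of_le_of_le tendsto_const_nhds h0 (fun _ => zero_le) ?_
  intro n
  have e : (F n - G n) - (f - g) = (F n - f) - (G n - g) := by abel
  simp only [e]
  exact eLpNorm_sub_le ((hF n).sub hf).1 ((hG n).sub hg).1 (by norm_num)

lemma tendsto_sum_L2 {ι : Type*} (s : Finset ι) {f : ι → E → ℂ} {F : ℕ → ι → E → ℂ}
    (hf : ∀ j, MemLp (f j) 2 μ) (hF : ∀ n j, MemLp (F n j) 2 μ)
    (tF : ∀ j, Tendsto (fun n => eLpNorm (F n j - f j) 2 μ) atTop (𝓝 0)) :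
    Tendsto (fun n => eLpNorm ((fun x => ∑ j ∈ s, F n j x) - fun x => ∑ j ∈ s, f j x) 2 μ) atTop (𝓝 0) := by
  have h0 : Tendsto (fun n => ∑ j ∈ s, eLpNorm (F n j - f j) 2 μ) atTop (𝓝 0) := by
    simpa using tendsto_finsetSum s fun j _ => tF j
  refine tendsto_of_tendsto_of_tendsto_of_le_of_le tendsto_const_nhds h0 (fun _ => zero_le) ?_
  intro n
  have e : ((fun x => ∑ j ∈ s, F n j x) - fun x => ∑ j ∈ s, f j x) = ∑ j ∈ s, (F n j - f j) := by
    ext x; simp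
  simp only [e]
  exact eLpNorm_sum_le (fun j _ => ((hF n j).sub (hf j)).1) (by norm_num)

end L2
end SteinAux

namespace SteinAux
open MeasureTheory Complex Filter
open scoped ContDiff ComplexConjugate

section Key
variable {E : Type*} [NormedAddCommGroup E] [NormedSpace ℂ E] [NormedSpace ℝ E] [IsScalarTower ℝ ℂ E]
variable [FiniteDimensional ℝ E] [MeasurableSpace E] [BorelSpace E]
variable {μ : Measure E} [μ.IsAddHaarMeasure]
variable {ι : Type*} [Fintype ι]

lemma int_mul_L2 {f g : E → ℂ} (hf : MemLp f 2 μ) (hg : MemLp g 2 μ) :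
    Integrable (fun x => f x * conj (g x)) μ := by
  have h2 : MemLp (fun x => conj (g x)) 2 μ := hg.star
  exact hf.integrable_mul h2

lemma int_sq_wt {φ : E → ℝ} (hφ : ContDiff ℝ ∞ φ) {C : ℝ} (hC : ∀ x, ‖wt φ x‖ ≤ C)
    {p : E → ℂ} (hp : MemLp p 2 μ) :
    ∫ x, ‖p x‖ ^ 2 * Real.exp (-φ x) ∂μ = (∫ x, (wt φ x * p x) * conj (p x) ∂μ).re := by
  have hi := int_mul_L2 (memLp_mul_bdd (wt_smooth hφ).continuous hC hp) hp
  have := integral_re (𝕜 := ℂ) hi (μ := μ)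
  simp only [RCLike.re_to_complex] at this
  rw [← this]
  congr 1; ext x
  rw [mul_assoc, Complex.mul_conj, Complex.normSq_eq_norm_sq, wt, ← Complex.ofReal_mul,
    Complex.ofReal_re, mul_comm]

lemma int_quad_wt {φ : E → ℝ} (hφ : ContDiff ℝ ∞ φ) {C : ℝ}
    {c : ι → ι → E → ℂ} (hc : ∀ j k, Continuous (c j k)) (hC : ∀ j k x, ‖wt φ x * c j k x‖ ≤ C)
    {h : ι → E → ℂ} (hh : ∀ j, MemLp (h j) 2 μ) :
    ∫ x, (∑ j, ∑ k, c j k x * h j x * conj (h k x)).re * Real.exp (-φ x) ∂μ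
      = (∑ j, ∑ k, ∫ x, ((wt φ x * c j k x) * h j x) * conj (h k x) ∂μ).re := by
  have hi : ∀ j k, Integrable (fun x => ((wt φ x * c j k x) * h j x) * conj (h k x)) μ := fun j k =>
    int_mul_L2 (memLp_mul_bdd ((wt_smooth hφ).continuous.mul (hc j k)) (hC j k) (hh j)) (hh k)
  have e1 : ∑ j, ∑ k, ∫ x, ((wt φ x * c j k x) * h j x) * conj (h k x) ∂μ
      = ∫ x, ∑ j, ∑ k, ((wt φ x * c j k x) * h j x) * conj (h k x) ∂μ := by
    rw [integral_finset_sum _ fun j _ => integrable_finset_sum _ fun k _ => hi j k]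
    refine Finset.sum_congr rfl fun j _ => ?_
    rw [integral_finset_sum _ fun k _ => hi j k]
  have := integral_re (𝕜 := ℂ) (integrable_finset_sum Finset.univ fun j _ =>
    integrable_finset_sum Finset.univ fun k _ => hi j k) (μ := μ)
  simp only [RCLike.re_to_complex] at this
  rw [e1, ← this]
  congr 1; ext x
  rw [mul_comm, ← Complex.re_ofReal_mul, Finset.mul_sum]
  congr 1
  refine Finset.sum_congr rfl fun j _ => ?_
  rw [Finset.mul_sum]
  refine Finset.sum_congr rfl fun k _ => ?_
  simp only [wt]; ring

theorem key_lemma (b : Module.Basis ι ℂ E) (e : ι → E) {φ : E → ℝ} (hφ : ContDiff ℝ ∞ φ)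
    (hφc : HasCompactSupport φ)
    {h : ι → E → ℂ} {K : Set E} (hK : IsCompact K) (h0 : ∀ j x, x ∉ K → h j x = 0)
    (hh : ∀ j, MemLp (h j) 2 μ) {Q : E → ℂ} (hQ : MemLp Q 2 μ) {R : ι → ι → E → ℂ}
    (hR : ∀ j k, MemLp (R j k) 2 μ)
    (hdiv : ∀ v, Tst univ v → ∫ x, ∑ j, h j x * dz (e j) v x ∂μ = - ∫ x, Q x * v x ∂μ)
    (hcurl : ∀ j k v, Tst univ v →
      ∫ x, (h k x * dzb (e j) v x - h j x * dzb (e k) v x) ∂μ = - ∫ x, R j k x * v x ∂μ) :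
    ∫ x, (∑ j, ∑ k, dzb (e k) (dz (e j) (cx φ)) x * h j x * conj (h k x)).re * Real.exp (-φ x) ∂μ
    ≤ ∫ x, ‖Q x - ∑ j, dz (e j) (cx φ) x * h j x‖ ^ 2 * Real.exp (-φ x) ∂μ
      + 1 / 2 * ∑ j, ∑ k, ∫ x, ‖R j k x‖ ^ 2 * Real.exp (-φ x) ∂μ := by
  have hε0 : ∀ n : ℕ, 0 < 1 / ((n : ℝ) + 1) := fun n => by positivity
  choose η hη using fun n : ℕ => exists_moll (μ := μ) b (hε0 n)
  have hε := tendsto_one_div_add_atTop_nhds_zero_nat (𝕜 := ℝ)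
  set H : ℕ → ι → E → ℂ := fun n j => sm μ (η n) (h j) with hH
  set q : ℕ → E → ℂ := fun n => sm μ (η n) Q with hq
  set S : ℕ → ι → ι → E → ℂ := fun n j k => sm μ (η n) (R j k) with hS
  have tH : ∀ n j, Tst univ (H n j) := fun n j => (hη n).sm_tst (memLp_loc (hh j)) hK (h0 j)
  have mH : ∀ n j, MemLp (H n j) 2 μ := fun n j => (hη n).sm_memLp (hh j)
  have mq : ∀ n, MemLp (q n) 2 μ := fun n => (hη n).sm_memLp hQ
  have mS : ∀ n j k, MemLp (S n j k) 2 μ := fun n j k => (hη n).sm_memLp (hR j k)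
  have cH : ∀ j, Tendsto (fun n => eLpNorm (H n j - h j) 2 μ) atTop (𝓝 0) :=
    fun j => tendsto_sm (hh j) hη hε
  have cq : Tendsto (fun n => eLpNorm (q n - Q) 2 μ) atTop (𝓝 0) := tendsto_sm hQ hη hε
  have cS : ∀ j k, Tendsto (fun n => eLpNorm (S n j k - R j k) 2 μ) atTop (𝓝 0) :=
    fun j k => tendsto_sm (hR j k) hη hε
  have e1 : ∀ n x, ∑ j, dz (e j) (H n j) x = q n x := by
    intro n x
    have ht := (hη n).tst x (subset_univ _)
    simp only [hH, hq, (hη n).dz_sm (memLp_loc (hh _))]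
    rw [Finset.sum_neg_distrib, ← integral_finset_sum _ fun j _ =>
      (hη n).integrable_mul (memLp_loc (hh j)) (ht.dz (e j)).cont (ht.dz (e j)).cpt,
      hdiv _ ht, neg_neg]
    rfl
  have e2 : ∀ n j k x, dzb (e j) (H n k) x - dzb (e k) (H n j) x = S n j k x := by
    intro n j k x
    have ht := (hη n).tst x (subset_univ _)
    simp only [hH, hS, (hη n).dzb_sm (memLp_loc (hh _))]
    have hi : ∀ j k, Integrable (fun t => h k t * dzb (e j) (fun t => (η n (x - t) : ℂ)) t) μ :=
      fun j k => (hη n).integrable_mul (memLp_loc (hh k)) (ht.dzb (e j)).cont (ht.dzb (e j)).cpt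
    have := hcurl j k _ ht
    rw [integral_sub (hi j k) (hi k j)] at this
    have e3 : sm μ (η n) (R j k) x = ∫ t, R j k t * (η n (x - t) : ℂ) ∂μ := rfl
    rw [e3]; linear_combination -this
  -- bounds
  obtain ⟨C0, hC0⟩ : ∃ C, ∀ x, ‖wt φ x‖ ≤ C := by
    obtain ⟨C, hC⟩ := hφ.continuous.bounded_above_of_compact_support hφc
    refine ⟨Real.exp C, fun x => ?_⟩
    simp only [wt, Complex.norm_real, Real.norm_eq_abs, Real.abs_exp]
    apply Real.exp_le_exp.2
    exact (neg_le_abs _).trans (hC x)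
  have tφ : Tst univ (cx φ) := ⟨cx_smooth hφ, cx_cpt hφc, subset_univ _⟩
  have hC1 : ∀ j, ∃ C, ∀ x, ‖dz (e j) (cx φ) x‖ ≤ C := fun j =>
    (tφ.dz (e j)).cont.bounded_above_of_compact_support (tφ.dz (e j)).cpt
  choose C1 hC1 using hC1
  set c : ι → ι → E → ℂ := fun j k x => dzb (e k) (dz (e j) (cx φ)) x with hc
  have tc : ∀ j k, Tst univ (c j k) := fun j k => (tφ.dz (e j)).dzb (e k)
  have hC2 : ∀ j k, ∃ C, ∀ x, ‖wt φ x * c j k x‖ ≤ C := fun j k => by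
    have := (tc j k).mul_smooth (wt_smooth hφ)
    exact this.cont.bounded_above_of_compact_support this.cpt
  choose C2 hC2 using hC2
  have hC2' : ∀ j k x, ‖wt φ x * c j k x‖ ≤ ∑ j, ∑ k, |C2 j k| := by
    intro j k x
    refine (hC2 j k x).trans ((le_abs_self _).trans ?_)
    refine le_trans ?_ (Finset.single_le_sum (f := fun j => ∑ k, |C2 j k|)
      (fun i _ => Finset.sum_nonneg fun k _ => abs_nonneg _) (Finset.mem_univ j))
    exact Finset.single_le_sum (f := fun k => |C2 j k|) (fun k _ => abs_nonneg _) (Finset.mem_univ k)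
  -- inequalities for mollified
  have ineq : ∀ n, ∫ x, (∑ j, ∑ k, c j k x * H n j x * conj (H n k x)).re * Real.exp (-φ x) ∂μ
      ≤ ∫ x, ‖q n x - ∑ j, dz (e j) (cx φ) x * H n j x‖ ^ 2 * Real.exp (-φ x) ∂μ
      + 1 / 2 * ∑ j, ∑ k, ∫ x, ‖S n j k x‖ ^ 2 * Real.exp (-φ x) ∂μ := by
    intro n
    have := basic_ineq (μ := μ) hφ e (tH n)
    refine this.trans_eq ?_
    congr 1
    · congr 1; ext x
      simp only [dlt, Finset.sum_sub_distrib, e1]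
    · congr 1
      refine Finset.sum_congr rfl fun j _ => Finset.sum_congr rfl fun k _ => ?_
      congr 1; ext x
      rw [norm_sub_rev, e2]
  -- limits
  have m1 : ∀ j, MemLp (fun x => dz (e j) (cx φ) x * h j x) 2 μ := fun j =>
    memLp_mul_bdd (tφ.dz (e j)).cont (hC1 j) (hh j)
  have m1n : ∀ n j, MemLp (fun x => dz (e j) (cx φ) x * H n j x) 2 μ := fun n j =>
    memLp_mul_bdd (tφ.dz (e j)).cont (hC1 j) (mH n j)
  have m2 : MemLp (fun x => ∑ j, dz (e j) (cx φ) x * h j x) 2 μ := memLp_finset_sum _ fun j _ => m1 j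
  have m2n : ∀ n, MemLp (fun x => ∑ j, dz (e j) (cx φ) x * H n j x) 2 μ :=
    fun n => memLp_finset_sum _ fun j _ => m1n n j
  have m3 : MemLp (fun x => Q x - ∑ j, dz (e j) (cx φ) x * h j x) 2 μ := hQ.sub m2
  have m3n : ∀ n, MemLp (fun x => q n x - ∑ j, dz (e j) (cx φ) x * H n j x) 2 μ :=
    fun n => (mq n).sub (m2n n)
  have c3 : Tendsto (fun n => eLpNorm ((fun x => q n x - ∑ j, dz (e j) (cx φ) x * H n j x)
      - (fun x => Q x - ∑ j, dz (e j) (cx φ) x * h j x)) 2 μ) atTop (𝓝 0) :=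
    tendsto_add_L2 hQ m2 mq m2n cq (tendsto_sum_L2 _ m1 m1n fun j => tendsto_mul_bdd (hC1 j) (cH j))
  have lsq : ∀ {p : E → ℂ} {P : ℕ → E → ℂ}, MemLp p 2 μ → (∀ n, MemLp (P n) 2 μ) →
      Tendsto (fun n => eLpNorm (P n - p) 2 μ) atTop (𝓝 0) →
      Tendsto (fun n => ∫ x, ‖P n x‖ ^ 2 * Real.exp (-φ x) ∂μ) atTop
        (𝓝 (∫ x, ‖p x‖ ^ 2 * Real.exp (-φ x) ∂μ)) := by
    intro p P hp hP ht
    rw [int_sq_wt hφ hC0 hp]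
    simp_rw [int_sq_wt hφ hC0 (hP _)]
    exact (Complex.continuous_re.tendsto _).comp (tendsto_int_mul
      (memLp_mul_bdd (wt_smooth hφ).continuous hC0 hp) hp
      (fun n => memLp_mul_bdd (wt_smooth hφ).continuous hC0 (hP n)) hP (tendsto_mul_bdd hC0 ht) ht)
  refine le_of_tendsto_of_tendsto' (b := atTop (α := ℕ)) ?_ ?_ ineq
  · rw [int_quad_wt hφ (fun j k => (tc j k).cont) hC2' hh]
    simp_rw [int_quad_wt hφ (fun j k => (tc j k).cont) hC2' (mH _)]
    refine (Complex.continuous_re.tendsto _).comp (tendsto_finsetSum _ fun j _ =>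
      tendsto_finsetSum _ fun k _ => ?_)
    have hcc := (wt_smooth hφ).continuous.mul (tc j k).cont
    exact tendsto_int_mul (memLp_mul_bdd hcc (hC2 j k) (hh j)) (hh k)
      (fun n => memLp_mul_bdd hcc (hC2 j k) (mH n j)) (fun n => mH n k)
      (tendsto_mul_bdd (hC2 j k) (cH j)) (cH k)
  · refine (lsq m3 m3n c3).add (Tendsto.const_mul _ (tendsto_finsetSum _ fun j _ =>
      tendsto_finsetSum _ fun k _ => lsq (hR j k) (fun n => mS n j k) (cS j k)))

end Key
end SteinAux

namespace SteinAux
open MeasureTheory Complex Filter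
open scoped ContDiff ComplexConjugate

section Apriori
variable {E : Type*} [NormedAddCommGroup E] [NormedSpace ℂ E] [NormedSpace ℝ E] [IsScalarTower ℝ ℂ E]
variable [FiniteDimensional ℝ E] [MeasurableSpace E] [BorelSpace E]
variable {μ : Measure E} [μ.IsAddHaarMeasure]
variable {ι : Type*} [Fintype ι] {D : Set E}

lemma cs_sum (X a : ι → ℂ) : ‖∑ j, X j * a j‖ ^ 2 ≤ (∑ j, ‖X j‖ ^ 2) * ∑ j, ‖a j‖ ^ 2 := by
  refine le_trans ?_ (Finset.sum_mul_sq_le_sq_mul_sq Finset.univ (fun j => ‖X j‖) (fun j => ‖a j‖))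
  refine pow_le_pow_left₀ (norm_nonneg _) ((norm_sum_le _ _).trans_eq ?_) 2
  simp

lemma three_sq (A B C : ℂ) : ‖A + B + C‖ ^ 2 ≤ 3 * ‖A‖ ^ 2 + 3 * ‖B‖ ^ 2 + 3 * ‖C‖ ^ 2 := by
  have h : ‖A + B + C‖ ≤ ‖A‖ + ‖B‖ + ‖C‖ := norm_add₃_le
  have := pow_le_pow_left₀ (norm_nonneg _) h 2
  nlinarith [sq_nonneg (‖A‖ - ‖B‖), sq_nonneg (‖A‖ - ‖C‖), sq_nonneg (‖B‖ - ‖C‖)]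

lemma two_sq (A B : ℂ) : ‖A - B‖ ^ 2 ≤ 2 * ‖A‖ ^ 2 + 2 * ‖B‖ ^ 2 := by
  have h : ‖A - B‖ ≤ ‖A‖ + ‖B‖ := norm_sub_le _ _
  have := pow_le_pow_left₀ (norm_nonneg _) h 2
  nlinarith [sq_nonneg (‖A‖ - ‖B‖)]

lemma curl_sum (Y a : ι → ℂ) :
    ∑ j, ∑ k, ‖Y j * a k - Y k * a j‖ ^ 2 ≤ 4 * ((∑ j, ‖Y j‖ ^ 2) * ∑ j, ‖a j‖ ^ 2) := by
  have h : ∀ j k, ‖Y j * a k - Y k * a j‖ ^ 2 ≤ 2 * (‖Y j‖ ^ 2 * ‖a k‖ ^ 2) + 2 * (‖a j‖ ^ 2 * ‖Y k‖ ^ 2) := by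
    intro j k
    refine (two_sq _ _).trans_eq ?_
    rw [norm_mul, norm_mul]; ring
  refine (Finset.sum_le_sum fun j _ => Finset.sum_le_sum fun k _ => h j k).trans_eq ?_
  simp only [Finset.sum_add_distrib, ← Finset.mul_sum, ← Finset.sum_mul]
  ring

lemma Tst.bdd {t : E → ℂ} (ht : Tst D t) : ∃ C, ∀ x, ‖t x‖ ≤ C :=
  ht.cont.bounded_above_of_compact_support ht.cpt

lemma Tst.mul_memLp {t f : E → ℂ} (ht : Tst D t) (hf : MemLp f 2 μ) :
    MemLp (fun x => t x * f x) 2 μ := by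
  obtain ⟨C, hC⟩ := ht.bdd
  exact memLp_mul_bdd ht.cont hC hf

lemma Tst.mul_int {t f : E → ℂ} (ht : Tst D t) (hf : MemLp f 2 μ) :
    Integrable (fun x => f x * t x) μ := by
  have := int_mul_L2 hf (ht.conj'.memLp (μ := μ) 2)
  simpa using this

/-- `1/σ₁`, `1/σ₂`, `σ₁`, `σ₂`, `1/w₂` -/
def i1 (s φ : E → ℝ) (x : E) : ℂ := ((s x ^ 2 * Real.exp (φ x / 2) : ℝ) : ℂ)
def i2 (s φ : E → ℝ) (x : E) : ℂ := ((s x * Real.exp (φ x / 2) : ℝ) : ℂ)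
def sg1 (s φ : E → ℝ) (x : E) : ℂ := (((s x)⁻¹ ^ 2 * Real.exp (-(φ x / 2)) : ℝ) : ℂ)
def sg2 (s φ : E → ℝ) (x : E) : ℂ := (((s x)⁻¹ * Real.exp (-(φ x / 2)) : ℝ) : ℂ)
def kp (s φ : E → ℝ) (x : E) : ℂ := ((s x ^ 2 * Real.exp (φ x) : ℝ) : ℂ)

structure WD (D : Set E) (s φ : E → ℝ) : Prop where
  op : IsOpen D
  hs : ContDiffOn ℝ ∞ s D
  hφ : ContDiffOn ℝ ∞ φ D
  pos : ∀ x ∈ D, 0 < s x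

variable {s φ : E → ℝ}

lemma cxOn {f : E → ℝ} (hf : ContDiffOn ℝ ∞ f D) : ContDiffOn ℝ ∞ (fun x => (f x : ℂ)) D :=
  Complex.ofRealCLM.contDiff.comp_contDiffOn hf

namespace WD
variable (h : WD D s φ)
include h

lemma i1s : ContDiffOn ℝ ∞ (i1 s φ) D :=
  cxOn ((h.hs.pow 2).mul (Real.contDiff_exp.comp_contDiffOn (h.hφ.div_const 2)))
lemma i2s : ContDiffOn ℝ ∞ (i2 s φ) D :=
  cxOn (h.hs.mul (Real.contDiff_exp.comp_contDiffOn (h.hφ.div_const 2)))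
lemma kps : ContDiffOn ℝ ∞ (kp s φ) D :=
  cxOn ((h.hs.pow 2).mul (Real.contDiff_exp.comp_contDiffOn h.hφ))
lemma sg1s : ContDiffOn ℝ ∞ (sg1 s φ) D :=
  cxOn (((h.hs.inv fun x hx => (h.pos x hx).ne').pow 2).mul
    (Real.contDiff_exp.comp_contDiffOn (h.hφ.div_const 2).neg))
lemma sg2s : ContDiffOn ℝ ∞ (sg2 s φ) D :=
  cxOn ((h.hs.inv fun x hx => (h.pos x hx).ne').mul
    (Real.contDiff_exp.comp_contDiffOn (h.hφ.div_const 2).neg))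

lemma sg2_kp {x : E} (hx : x ∈ D) : sg2 s φ x * kp s φ x = i2 s φ x := by
  have := (h.pos x hx).ne'
  simp only [sg2, kp, i2, ← Complex.ofReal_mul]
  congr 1
  have e : Real.exp (φ x) = Real.exp (φ x / 2) * Real.exp (φ x / 2) := by
    rw [← Real.exp_add]; ring_nf
  rw [e, Real.exp_neg]
  have := (Real.exp_pos (φ x / 2)).ne'
  field_simp

lemma sg2_i2 {x : E} (hx : x ∈ D) : sg2 s φ x * i2 s φ x = 1 := by
  have := (h.pos x hx).ne'
  simp only [sg2, kp, i2, ← Complex.ofReal_mul]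
  rw [Real.exp_neg]
  have := (Real.exp_pos (φ x / 2)).ne'
  norm_cast
  field_simp

lemma sg1_i1 {x : E} (hx : x ∈ D) : sg1 s φ x * i1 s φ x = 1 := by
  have := (h.pos x hx).ne'
  simp only [sg1, kp, i1, ← Complex.ofReal_mul]
  rw [Real.exp_neg]
  have := (Real.exp_pos (φ x / 2)).ne'
  norm_cast
  field_simp

lemma ds {x : E} (hx : x ∈ D) : DifferentiableAt ℝ s x :=
  (h.hs.contDiffAt (h.op.mem_nhds hx)).differentiableAt (by simp)
lemma dφ {x : E} (hx : x ∈ D) : DifferentiableAt ℝ φ x :=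
  (h.hφ.contDiffAt (h.op.mem_nhds hx)).differentiableAt (by simp)

lemma dz_kp {x : E} (hx : x ∈ D) (v : E) :
    dz v (kp s φ) x = (2 * dz v (cx s) x / s x + dz v (cx φ) x) * kp s φ x := by
  have hp : (s x : ℂ) ≠ 0 := by exact_mod_cast (h.pos x hx).ne'
  have h1 : HasFDerivAt (fun x => s x ^ 2 * Real.exp (φ x)) _ x :=
    ((h.ds hx).hasFDerivAt.pow 2).mul (h.dφ hx).hasFDerivAt.exp
  have e : kp s φ = cx (fun x => s x ^ 2 * Real.exp (φ x)) := rfl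
  have key : ∀ w, fderiv ℝ (kp s φ) x w =
      (2 * fderiv ℝ (cx s) x w / s x + fderiv ℝ (cx φ) x w) * kp s φ x := by
    intro w
    rw [e, fderiv_cx h1.differentiableAt, h1.fderiv, fderiv_cx (h.ds hx), fderiv_cx (h.dφ hx)]
    simp [cx]
    field_simp
    ring
  simp only [dz, key]
  ring
end WD

lemma point_alg {s t c : ℝ} (hs : 0 < s) (ht : 0 < t) (hc : c ^ 2 ≤ 1) (X σ ψ Y a : ι → ℂ)
    (hY : ∀ j, ‖Y j‖ = ‖X j‖) (G : ℂ) (Lv : ℝ)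
    (hL : (12 * (∑ j, ‖σ j‖ ^ 2) / s ^ 2 + 1 / s ^ 2) * ∑ j, ‖((s * t : ℝ) : ℂ) * (c : ℂ) * a j‖ ^ 2 ≤ Lv) :
    c ^ 2 * ∑ j, ‖a j‖ ^ 2 ≤ (3 * ‖((s ^ 2 * t : ℝ) : ℂ) * G‖ ^ 2
      + 5 * ((∑ j, ‖X j‖ ^ 2) * s ^ 2 * ∑ j, ‖a j‖ ^ 2))
      + (Lv * (t ^ 2)⁻¹ - (‖((∑ j, ((s * t : ℝ) : ℂ) * X j * a j)
          + ∑ j, ((s * t : ℝ) : ℂ) * c * (2 * σ j / s) * a j)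
          + ((s ^ 2 * t ^ 2 : ℝ) : ℂ) * c * G‖ ^ 2 * (t ^ 2)⁻¹
        + 1 / 2 * ∑ j, ∑ k, ‖((s * t : ℝ) : ℂ) * Y j * a k - ((s * t : ℝ) : ℂ) * Y k * a j‖ ^ 2
            * (t ^ 2)⁻¹)) := by
  have e1 : ∑ j, ‖((s * t : ℝ) : ℂ) * (c : ℂ) * a j‖ ^ 2 = s ^ 2 * t ^ 2 * c ^ 2 * ∑ j, ‖a j‖ ^ 2 := by
    rw [Finset.mul_sum]; refine Finset.sum_congr rfl fun j _ => ?_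
    simp only [norm_mul, Complex.norm_real, Real.norm_eq_abs, mul_pow, sq_abs]
  rw [e1] at hL
  have e2 : ∑ j, ∑ k, ‖((s * t : ℝ) : ℂ) * Y j * a k - ((s * t : ℝ) : ℂ) * Y k * a j‖ ^ 2 * (t ^ 2)⁻¹
      = s ^ 2 * ∑ j, ∑ k, ‖Y j * a k - Y k * a j‖ ^ 2 := by
    rw [Finset.mul_sum]; refine Finset.sum_congr rfl fun j _ => ?_
    rw [Finset.mul_sum]; refine Finset.sum_congr rfl fun k _ => ?_
    rw [mul_assoc, mul_assoc, ← mul_sub, norm_mul, mul_pow, Complex.norm_real, Real.norm_eq_abs, sq_abs]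
    field_simp
  have c2 := curl_sum Y a
  have e3 : ∑ j, ((s * t : ℝ) : ℂ) * X j * a j = ((s * t : ℝ) : ℂ) * ∑ j, X j * a j := by
    rw [Finset.mul_sum]; refine Finset.sum_congr rfl fun j _ => ?_
    ring
  have hs0 : (s : ℂ) ≠ 0 := by exact_mod_cast hs.ne'
  have e4 : ∑ j, ((s * t : ℝ) : ℂ) * c * (2 * σ j / s) * a j = ((2 * t * c : ℝ) : ℂ) * ∑ j, σ j * a j := by
    rw [Finset.mul_sum]; refine Finset.sum_congr rfl fun j _ => ?_
    push_cast; field_simp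
  rw [e2, e3, e4]
  simp only [hY] at c2
  have t3 := three_sq (((s * t : ℝ) : ℂ) * ∑ j, X j * a j) (((2 * t * c : ℝ) : ℂ) * ∑ j, σ j * a j)
    (((s ^ 2 * t ^ 2 : ℝ) : ℂ) * c * G)
  have n1 : ∀ (r : ℝ) (z : ℂ), ‖(r : ℂ) * z‖ ^ 2 = r ^ 2 * ‖z‖ ^ 2 := by
    intro r z; rw [norm_mul, mul_pow, Complex.norm_real, Real.norm_eq_abs, sq_abs]
  rw [mul_assoc _ (c : ℂ) G, n1, n1, n1, n1] at t3
  rw [mul_assoc _ (c : ℂ) G, n1]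
  set A := ∑ j, ‖a j‖ ^ 2
  set SX := ∑ j, ‖X j‖ ^ 2
  set SS := ∑ j, ‖σ j‖ ^ 2
  have cX : ‖∑ j, X j * a j‖ ^ 2 ≤ SX * A := cs_sum X a
  have cS : ‖∑ j, σ j * a j‖ ^ 2 ≤ SS * A := cs_sum σ a
  have hA : 0 ≤ A := Finset.sum_nonneg fun j _ => by positivity
  set N := ‖((s * t : ℝ) : ℂ) * ∑ j, X j * a j + ((2 * t * c : ℝ) : ℂ) * ∑ j, σ j * a j
    + ((s ^ 2 * t ^ 2 : ℝ) : ℂ) * (c * G)‖ ^ 2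
  have f1 : N * (t ^ 2)⁻¹ ≤ 3 * s ^ 2 * (SX * A) + 12 * c ^ 2 * (SS * A) + 3 * ((s ^ 2 * t) ^ 2 * ‖G‖ ^ 2) := by
    rw [← div_eq_mul_inv, div_le_iff₀ (by positivity)]
    refine t3.trans ?_
    have h1 : (s * t) ^ 2 * ‖∑ j, X j * a j‖ ^ 2 ≤ (s * t) ^ 2 * (SX * A) := by gcongr
    have h2 : (2 * t * c) ^ 2 * ‖∑ j, σ j * a j‖ ^ 2 ≤ (2 * t * c) ^ 2 * (SS * A) := by gcongr
    have h3 : (s ^ 2 * t ^ 2) ^ 2 * (c ^ 2 * ‖G‖ ^ 2) ≤ (s ^ 2 * t ^ 2) ^ 2 * (1 * ‖G‖ ^ 2) := by gcongr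
    nlinarith
  have f2 : (12 * SS + 1) * c ^ 2 * A ≤ Lv * (t ^ 2)⁻¹ := by
    rw [← div_eq_mul_inv, le_div_iff₀ (by positivity)]
    refine le_trans (le_of_eq ?_) hL
    field_simp
  nlinarith [mul_le_mul_of_nonneg_left c2 (sq_nonneg s)]

theorem cutoff_est (b : Module.Basis ι ℂ E) (e : ι → E) (h : WD D s φ)
    (hcurv : ∀ x ∈ D, ∀ τ : ι → ℂ,
      (12 * (∑ j, ‖dz (e j) (cx s) x‖ ^ 2) / s x ^ 2 + 1 / s x ^ 2) * ∑ j, ‖τ j‖ ^ 2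
        ≤ levi φ x (∑ j, τ j • e j) / 4)
    {a : ι → E → ℂ} (ha : ∀ j, MemLp (a j) 2 μ) {G : E → ℂ} (hG : Tst D G)
    (hdiv : ∀ v, Tst D v → ∫ x, ∑ j, sg2 s φ x * a j x * dz (e j) v x ∂μ = - ∫ x, v x * G x ∂μ)
    (hcurl : ∀ v, Tst D v → ∀ j k,
      ∫ x, (i2 s φ x * a k x * dzb (e j) v x - i2 s φ x * a j x * dzb (e k) v x) ∂μ = 0)
    {χ : E → ℝ} (hχ : Tst D (cx χ)) (hχ1 : ∀ x, χ x ^ 2 ≤ 1) {φt : E → ℝ} (hφt : ContDiff ℝ ∞ φt)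
    (hφtc : HasCompactSupport φt) (heq : ∀ x ∈ tsupport (cx χ), φt =ᶠ[𝓝 x] φ) :
    ∫ x, χ x ^ 2 * ∑ j, ‖a j x‖ ^ 2 ∂μ ≤ 3 * ∫ x, ‖i1 s φ x * G x‖ ^ 2 ∂μ
      + 5 * ∫ x, (∑ j, ‖dz (e j) (cx χ) x‖ ^ 2) * s x ^ 2 * ∑ j, ‖a j x‖ ^ 2 ∂μ := by
  -- the auxiliary test coefficients
  have T0 : Tst D (fun x => i2 s φ x * cx χ x) := hχ.smul_on h.op h.i2s
  have T1 : Tst D (fun x => kp s φ x * cx χ x) := hχ.smul_on h.op h.kps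
  have T2 : ∀ j, Tst D (fun x => sg2 s φ x * dz (e j) (fun x => kp s φ x * cx χ x) x) := fun j =>
    (T1.dz (e j)).smul_on h.op h.sg2s
  have T3 : Tst D (fun x => kp s φ x * cx χ x * G x) := hG.mul_smooth T1.smooth
  have T4 : ∀ j, Tst D (fun x => i2 s φ x * dzb (e j) (cx χ) x) := fun j =>
    (hχ.dzb (e j)).smul_on h.op h.i2s
  set H : ι → E → ℂ := fun j x => i2 s φ x * cx χ x * a j x with hH
  set Q : E → ℂ := fun x => ∑ j, sg2 s φ x * dz (e j) (fun x => kp s φ x * cx χ x) x * a j x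
    + kp s φ x * cx χ x * G x with hQ
  set R : ι → ι → E → ℂ := fun j k x => i2 s φ x * dzb (e j) (cx χ) x * a k x
    - i2 s φ x * dzb (e k) (cx χ) x * a j x with hR
  have mH : ∀ j, MemLp (H j) 2 μ := fun j => T0.mul_memLp (ha j)
  have mQ1 : MemLp (fun x => ∑ j, sg2 s φ x * dz (e j) (fun x => kp s φ x * cx χ x) x * a j x) 2 μ :=
    memLp_finset_sum _ fun j _ => (T2 j).mul_memLp (ha j)
  have mQ : MemLp Q 2 μ := mQ1.add (T3.memLp 2)
  have mR : ∀ j k, MemLp (R j k) 2 μ := fun j k =>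
    ((T4 j).mul_memLp (ha k)).sub ((T4 k).mul_memLp (ha j))
  have zH : ∀ j x, x ∉ tsupport (cx χ) → H j x = 0 := by
    intro j x hx; simp [hH, hχ.eq_zero hx]
  have key := key_lemma b e hφt hφtc hχ.cpt.isCompact zH mH mQ mR ?_ ?_
  rotate_left
  · -- divergence
    intro v hv
    have tV : Tst D (fun x => kp s φ x * cx χ x * v x) := by
      have := T1.mul_smooth hv.smooth
      simpa [mul_comm] using this
    have h1 := hdiv _ tV
    have p1 : ∀ x, ∑ j, sg2 s φ x * a j x * dz (e j) (fun x => kp s φ x * cx χ x * v x) x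
        = (∑ j, H j x * dz (e j) v x)
          + (∑ j, sg2 s φ x * dz (e j) (fun x => kp s φ x * cx χ x) x * a j x) * v x := by
      intro x
      rw [Finset.sum_mul, ← Finset.sum_add_distrib]
      refine Finset.sum_congr rfl fun j _ => ?_
      rw [dz_mul (T1.diff x) (hv.diff x)]
      have : sg2 s φ x * (kp s φ x * cx χ x) = i2 s φ x * cx χ x := by
        by_cases hx : x ∈ D
        · rw [← mul_assoc, h.sg2_kp hx]
        · have : cx χ x = 0 := hχ.eq_zero (fun hh => hx (hχ.sub hh))
          simp [this]
      simp only [hH]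
      linear_combination (a j x * dz (e j) v x) * this
    simp_rw [p1] at h1
    have I1 : Integrable (fun x => ∑ j, H j x * dz (e j) v x) μ :=
      integrable_finset_sum _ fun j _ => (hv.dz (e j)).mul_int (mH j)
    have I2 : Integrable (fun x => (∑ j, sg2 s φ x * dz (e j) (fun x => kp s φ x * cx χ x) x * a j x)
      * v x) μ := hv.mul_int mQ1
    have I3 : Integrable (fun x => kp s φ x * cx χ x * G x * v x) μ := hv.mul_int (T3.memLp 2)
    rw [integral_add I1 I2] at h1
    have e2 : ∫ x, Q x * v x ∂μ = ∫ x, (∑ j, sg2 s φ x * dz (e j) (fun x => kp s φ x * cx χ x) x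
        * a j x) * v x ∂μ + ∫ x, kp s φ x * cx χ x * G x * v x ∂μ := by
      rw [← integral_add I2 I3]; congr 1; ext x; simp only [hQ]; ring
    have e3 : ∫ x, kp s φ x * cx χ x * v x * G x ∂μ = ∫ x, kp s φ x * cx χ x * G x * v x ∂μ := by
      congr 1; ext x; ring
    rw [e3] at h1
    rw [e2]; linear_combination h1
  · intro j k v hv
    have tV : Tst D (fun x => cx χ x * v x) := by
      have := hχ.mul_smooth hv.smooth
      simpa [mul_comm] using this
    have h1 := hcurl _ tV j k
    have p1 : ∀ x, i2 s φ x * a k x * dzb (e j) (fun x => cx χ x * v x) x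
        - i2 s φ x * a j x * dzb (e k) (fun x => cx χ x * v x) x
        = (H k x * dzb (e j) v x - H j x * dzb (e k) v x) + R j k x * v x := by
      intro x
      rw [dzb_mul (hχ.diff x) (hv.diff x), dzb_mul (hχ.diff x) (hv.diff x)]
      simp only [hH, hR]; ring
    simp_rw [p1] at h1
    rw [integral_add (by exact ((hv.dzb (e j)).mul_int (mH k)).sub ((hv.dzb (e k)).mul_int (mH j)))
      (hv.mul_int (mR j k))] at h1
    exact eq_neg_of_add_eq_zero_left h1
  -- pointwise inequality
  have tφ : Tst univ (cx φt) := ⟨cx_smooth hφt, cx_cpt hφtc, subset_univ _⟩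
  obtain ⟨C0, hC0⟩ : ∃ C, ∀ x, ‖wt φt x‖ ≤ C := by
    obtain ⟨C, hC⟩ := hφt.continuous.bounded_above_of_compact_support hφtc
    refine ⟨Real.exp C, fun x => ?_⟩
    simp only [wt, Complex.norm_real, Real.norm_eq_abs, Real.abs_exp]
    apply Real.exp_le_exp.2
    exact (neg_le_abs _).trans (hC x)
  have Isq : ∀ {p : E → ℂ}, MemLp p 2 μ → Integrable (fun x => ‖p x‖ ^ 2 * Real.exp (-φt x)) μ := by
    intro p hp
    have hi := (int_mul_L2 (memLp_mul_bdd (wt_smooth hφt).continuous hC0 hp) hp).re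
    refine hi.congr (Eventually.of_forall fun x => ?_)
    simp only [RCLike.re_to_complex]
    rw [mul_assoc, Complex.mul_conj, Complex.normSq_eq_norm_sq, wt, ← Complex.ofReal_mul,
      Complex.ofReal_re, mul_comm]
  set Lf : E → ℝ := fun x => (∑ j, ∑ k, dzb (e k) (dz (e j) (cx φt)) x * H j x * conj (H k x)).re
    * Real.exp (-φt x) with hLf
  have IL : Integrable Lf μ := by
    have i0 : ∀ j k, Integrable (fun x => (wt φt x * dzb (e k) (dz (e j) (cx φt)) x * H j x)
        * conj (H k x)) μ := fun j k =>
      int_mul_L2 ((((tφ.dz (e j)).dzb (e k)).mul_smooth (wt_smooth hφt)).mul_memLp (mH j)) (mH k)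
    have i3 := (integrable_finset_sum Finset.univ fun j _ =>
      integrable_finset_sum Finset.univ fun k _ => i0 j k).re
    refine i3.congr (Eventually.of_forall fun x => ?_)
    simp only [hLf, RCLike.re_to_complex]
    rw [mul_comm, ← Complex.re_ofReal_mul, Finset.mul_sum]
    congr 1
    refine Finset.sum_congr rfl fun j _ => ?_
    rw [Finset.mul_sum]
    refine Finset.sum_congr rfl fun k _ => ?_
    simp only [wt]; ring
  set Pf : E → ℂ := fun x => Q x - ∑ j, dz (e j) (cx φt) x * H j x with hPf
  have mP : MemLp Pf 2 μ := mQ.sub (memLp_finset_sum _ fun j _ => (tφ.dz (e j)).mul_memLp (mH j))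
  have IG : Integrable (fun x => ‖i1 s φ x * G x‖ ^ 2) μ := memLp_sq ((hG.smul_on h.op h.i1s).memLp 2)
  have IA : Integrable (fun x => χ x ^ 2 * ∑ j, ‖a j x‖ ^ 2) μ := by
    have := integrable_finset_sum (μ := μ) Finset.univ fun j _ => memLp_sq (hχ.mul_memLp (ha j))
    refine this.congr (Eventually.of_forall fun x => ?_)
    simp [cx, mul_pow, Finset.mul_sum]
  have T5 : ∀ j, Tst D (fun x => (s x : ℂ) * dz (e j) (cx χ) x) := fun j =>
    (hχ.dz (e j)).smul_on h.op (cxOn h.hs)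
  have IB : Integrable (fun x => (∑ j, ‖dz (e j) (cx χ) x‖ ^ 2) * s x ^ 2 * ∑ j, ‖a j x‖ ^ 2) μ := by
    have := integrable_finset_sum (μ := μ) Finset.univ fun j _ =>
      integrable_finset_sum (μ := μ) Finset.univ fun k _ => memLp_sq ((T5 j).mul_memLp (ha k))
    refine this.congr (Eventually.of_forall fun x => ?_)
    simp only [norm_mul, Complex.norm_real, Real.norm_eq_abs, mul_pow, sq_abs, Finset.sum_mul,
      Finset.mul_sum]
    rw [Finset.sum_comm]
    refine Finset.sum_congr rfl fun j _ => Finset.sum_congr rfl fun k _ => ?_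
    ring
  have point : ∀ x, χ x ^ 2 * ∑ j, ‖a j x‖ ^ 2 ≤ (3 * ‖i1 s φ x * G x‖ ^ 2
      + 5 * ((∑ j, ‖dz (e j) (cx χ) x‖ ^ 2) * s x ^ 2 * ∑ j, ‖a j x‖ ^ 2))
      + (Lf x - (‖Pf x‖ ^ 2 * Real.exp (-φt x)
        + 1 / 2 * ∑ j, ∑ k, ‖R j k x‖ ^ 2 * Real.exp (-φt x))) := by
    intro x
    by_cases hx : x ∈ tsupport (cx χ)
    · have hxD : x ∈ D := hχ.sub hx
      have hev := heq x hx
      have hcxe : cx φt =ᶠ[𝓝 x] cx φ := hev.mono fun y hy => by simp [cx, hy]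
      have hdzφ : ∀ j, dz (e j) (cx φt) x = dz (e j) (cx φ) x := fun j => dz_congr hcxe
      have hφx : φt x = φ x := hev.self_of_nhds
      have ex : Real.exp (-φt x) = (Real.exp (φ x / 2) ^ 2)⁻¹ := by
        rw [hφx, Real.exp_neg, ← Real.exp_nat_mul]; congr 2; push_cast; ring
      have ex2 : Real.exp (φ x) = Real.exp (φ x / 2) ^ 2 := by
        rw [← Real.exp_nat_mul]; congr 1; push_cast; ring
      have hcv := hcurv x hxD (fun j => H j x)
      have hlv := levi_sum hφt e (fun j => H j x) x
      rw [levi_congr hev] at hlv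
      have pa := point_alg (h.pos x hxD) (Real.exp_pos (φ x / 2)) (hχ1 x)
        (fun j => dz (e j) (cx χ) x) (fun j => dz (e j) (cx s) x) (fun j => dz (e j) (cx φ) x)
        (fun j => dzb (e j) (cx χ) x) (fun j => a j x)
        (fun j => by rw [← conj_dz_cx, RCLike.norm_conj]) (G x) _ hcv
      have hP : Pf x = ((∑ j, i2 s φ x * dz (e j) (cx χ) x * a j x)
          + ∑ j, i2 s φ x * (χ x : ℂ) * (2 * dz (e j) (cx s) x / s x) * a j x)
          + kp s φ x * χ x * G x := by
        simp only [hPf, hQ]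
        rw [add_sub_right_comm, ← Finset.sum_sub_distrib, ← Finset.sum_add_distrib]
        congr 1
        refine Finset.sum_congr rfl fun j _ => ?_
        rw [hdzφ, dz_mul ((h.kps.contDiffAt (h.op.mem_nhds hxD)).differentiableAt (by simp)) (hχ.diff x),
          h.dz_kp hxD]
        have := h.sg2_kp hxD
        simp only [hH]
        have hc : cx χ x = (χ x : ℂ) := rfl
        rw [hc]
        linear_combination (dz (e j) (cx χ) x * a j x
          + (2 * dz (e j) (cx s) x / s x + dz (e j) (cx φ) x) * χ x * a j x) * this
      simp only [hLf, ex, hlv, Complex.ofReal_re, hP, hR]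
      simp only [i1, i2, kp, ex2]
      exact pa
    · have z0 := hχ.eq_zero hx
      have z0' : χ x = 0 := by simpa [cx] using z0
      have z1 : ∀ j, dz (e j) (cx χ) x = 0 := fun j =>
        image_eq_zero_of_notMem_tsupport fun hh => hx (support_dz _ _ hh)
      have z2 : ∀ j, dzb (e j) (cx χ) x = 0 := fun j =>
        image_eq_zero_of_notMem_tsupport fun hh => hx (support_dzb _ _ hh)
      have z3 : ∀ j, dz (e j) (fun x => kp s φ x * cx χ x) x = 0 := fun j =>
        image_eq_zero_of_notMem_tsupport fun hh => hx (tsupport_mul_subset_right (support_dz _ _ hh))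
      simp [hLf, hPf, hQ, hR, hH, z0, z0', z1, z2, z3]
      positivity
  have I0 : Integrable (fun x => ∑ j, ∑ k, ‖R j k x‖ ^ 2 * Real.exp (-φt x)) μ :=
    integrable_finset_sum _ fun j _ => integrable_finset_sum _ fun k _ => Isq (mR j k)
  have fin := integral_mono IA (((IG.const_mul 3).add (IB.const_mul 5)).add
    (IL.sub ((Isq mP).add (I0.const_mul (1/2))))) point
  simp only [Pi.add_apply, Pi.sub_apply] at fin
  rw [integral_add (by exact (IG.const_mul 3).add (IB.const_mul 5))
      (by exact IL.sub ((Isq mP).add (I0.const_mul (1/2)))),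
    integral_add (IG.const_mul 3) (IB.const_mul 5),
    integral_sub IL (by exact (Isq mP).add (I0.const_mul (1/2))),
    integral_add (Isq mP) (I0.const_mul (1/2)), integral_const_mul, integral_const_mul,
    integral_const_mul,
    integral_finset_sum _ fun j _ => integrable_finset_sum _ fun k _ => Isq (mR j k)] at fin
  simp_rw [integral_finset_sum _ fun k _ => Isq (mR _ k)] at fin
  linarith

end Apriori
end SteinAux

namespace SteinAux
open MeasureTheory Complex Filter
open scoped ContDiff ComplexConjugate

section Limit
variable {E : Type*} [NormedAddCommGroup E] [NormedSpace ℂ E] [NormedSpace ℝ E] [IsScalarTower ℝ ℂ E]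
variable [FiniteDimensional ℝ E] [MeasurableSpace E] [BorelSpace E]
variable {μ : Measure E} [μ.IsAddHaarMeasure]
variable {ι : Type*} [Fintype ι] {D : Set E} {s φ : E → ℝ}

lemma smoothTransition_deriv_bdd : ∃ C, 0 ≤ C ∧ ∀ t, |deriv Real.smoothTransition t| ≤ C ∧
    (1 < t → deriv Real.smoothTransition t = 0) := by
  have hc : Continuous (deriv Real.smoothTransition) :=
    (Real.smoothTransition.contDiff (n := 1)).continuous_deriv le_rfl
  obtain ⟨C, hC⟩ := (isCompact_Icc (a := (0:ℝ)) (b := 1)).exists_bound_of_continuousOn hc.continuousOn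
  have h1 : ∀ t, 1 < t → deriv Real.smoothTransition t = 0 := by
    intro t ht
    have : Real.smoothTransition =ᶠ[𝓝 t] fun _ => 1 := by
      filter_upwards [lt_mem_nhds ht] with y hy using Real.smoothTransition.one_of_one_le hy.le
    rw [this.deriv_eq]; simp
  have h0 : ∀ t, t < 0 → deriv Real.smoothTransition t = 0 := by
    intro t ht
    have : Real.smoothTransition =ᶠ[𝓝 t] fun _ => 0 := by
      filter_upwards [gt_mem_nhds ht] with y hy using Real.smoothTransition.zero_of_nonpos (le_of_lt hy)
    rw [this.deriv_eq]; simp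
  refine ⟨max C 0, le_max_right _ _, fun t => ⟨?_, h1 t⟩⟩
  rcases lt_or_ge t 0 with h | h
  · rw [h0 t h]; simp
  rcases lt_or_ge 1 t with h' | h'
  · rw [h1 t h']; simp
  · exact (hC t ⟨h, h'⟩).trans (le_max_left _ _)

open Classical in
def chi (D : Set E) (s : E → ℝ) (ν : ℝ) (x : E) : ℝ :=
  if x ∈ D then Real.smoothTransition (ν * s x - 1) else 0

/-- exhaustion data -/
structure EX (D : Set E) (s φ : E → ℝ) (C1 : ℝ) : Prop extends WD D s φ where
  ex : ∀ t, 0 < t → IsCompact {x | x ∈ D ∧ t ≤ s x}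
  grad : ∀ x ∈ D, ‖fderiv ℝ s x‖ ≤ C1

variable {C1 : ℝ} (h : EX D s φ C1)

lemma chi_sq (ν : ℝ) (x : E) : chi D s ν x ^ 2 ≤ 1 := by
  unfold chi
  split_ifs
  · have h1 := Real.smoothTransition.nonneg (ν * s x - 1)
    have h2 := Real.smoothTransition.le_one (ν * s x - 1)
    nlinarith
  · norm_num

include h in
lemma chi_tst {ν : ℝ} (hν : 0 < ν) : Tst D (cx (chi D s ν)) := by
  refine Tst.of_support (h.ex (1/ν) (by positivity)) (fun x hx => hx.1) h.op ?_ ?_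
  · have : ContDiffOn ℝ ∞ (fun x => ((Real.smoothTransition (ν * s x - 1) : ℝ) : ℂ)) D :=
      cxOn ((Real.smoothTransition.contDiff).comp_contDiffOn
        ((contDiffOn_const.mul h.hs).sub contDiffOn_const))
    refine this.congr fun x hx => ?_
    simp [cx, chi, hx]
  · intro x hx
    simp only [cx, chi]
    split_ifs with hD
    · have : ¬ (1 / ν ≤ s x) := fun hh => hx ⟨hD, hh⟩
      rw [Real.smoothTransition.zero_of_nonpos]; · simp
      have h2 : s x < 1 / ν := not_le.1 this
      rw [lt_div_iff₀ hν] at h2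
      linarith
    · simp

include h in
lemma chi_tsupp {ν : ℝ} (hν : 0 < ν) {x : E} (hx : x ∈ tsupport (cx (chi D s ν))) :
    x ∈ D ∧ 1 / ν ≤ s x := by
  have : tsupport (cx (chi D s ν)) ⊆ {x | x ∈ D ∧ 1 / ν ≤ s x} := by
    refine closure_minimal ?_ (h.ex (1/ν) (by positivity)).isClosed
    intro x hx
    by_contra hh
    apply hx
    simp only [cx, chi]
    split_ifs with hD
    · have : ¬ (1 / ν ≤ s x) := fun h' => hh ⟨hD, h'⟩
      rw [Real.smoothTransition.zero_of_nonpos]; · simp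
      have h2 : s x < 1 / ν := not_le.1 this
      rw [lt_div_iff₀ hν] at h2
      linarith
    · simp
  exact this hx

lemma chi_one {ν : ℝ} (hν : 0 < ν) {x : E} (hD : x ∈ D) (hx : 2 / ν ≤ s x) : chi D s ν x = 1 := by
  simp only [chi, hD, if_true]
  apply Real.smoothTransition.one_of_one_le
  rw [div_le_iff₀ hν] at hx
  linarith

lemma dz_norm_le {f : E → ℂ} {x : E} {C : ℝ} (hC : ∀ w, ‖fderiv ℝ f x w‖ ≤ C * ‖w‖) (v : E) :
    ‖dz v f x‖ ≤ C * ‖v‖ := by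
  have h1 := hC v
  have h2 := hC (I • v)
  rw [norm_smul, norm_I, one_mul] at h2
  unfold dz
  rw [norm_div]
  have h3 : ‖fderiv ℝ f x v - I * fderiv ℝ f x (I • v)‖ ≤ ‖fderiv ℝ f x v‖ + ‖fderiv ℝ f x (I • v)‖ := by
    refine (norm_sub_le _ _).trans ?_
    rw [norm_mul, norm_I, one_mul]
  rw [div_le_iff₀ (by norm_num)]
  norm_num
  linarith

include h in
lemma chi_grad {Cθ : ℝ} (hθ : 0 ≤ Cθ ∧ ∀ t, |deriv Real.smoothTransition t| ≤ Cθ ∧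
    (1 < t → deriv Real.smoothTransition t = 0)) {ν : ℝ} (hν : 0 < ν) (v : E) (x : E) :
    ‖dz v (cx (chi D s ν)) x‖ ^ 2 * s x ^ 2 ≤ (2 * Cθ * C1 * ‖v‖) ^ 2 ∧
    (¬ (x ∈ D ∧ s x ≤ 2 / ν) → ‖dz v (cx (chi D s ν)) x‖ ^ 2 * s x ^ 2 = 0) := by
  by_cases hD : x ∈ D
  swap
  · have : dz v (cx (chi D s ν)) x = 0 :=
      image_eq_zero_of_notMem_tsupport fun hh => hD ((chi_tst h hν).sub (support_dz _ _ hh))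
    simp [this]; positivity
  have hev : chi D s ν =ᶠ[𝓝 x] fun x => Real.smoothTransition (ν * s x - 1) := by
    filter_upwards [h.op.mem_nhds hD] with y hy
    simp [chi, hy]
  have hT : HasDerivAt Real.smoothTransition (deriv Real.smoothTransition (ν * s x - 1)) (ν * s x - 1) :=
    ((Real.smoothTransition.contDiffAt (n := 1)).differentiableAt (by simp)).hasDerivAt
  have hd0 : HasFDerivAt (fun x => Real.smoothTransition (ν * s x - 1)) _ x :=
    HasDerivAt.comp_hasFDerivAt (f := fun x => ν * s x - 1) x hT
      (((h.ds hD).hasFDerivAt.const_mul ν).sub_const 1)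
  have hd : HasFDerivAt (chi D s ν) _ x := hd0.congr_of_eventuallyEq hev
  have hf : ∀ w, fderiv ℝ (cx (chi D s ν)) x w
      = ((deriv Real.smoothTransition (ν * s x - 1) * (ν * fderiv ℝ s x w) : ℝ) : ℂ) := by
    intro w
    rw [fderiv_cx hd.differentiableAt, hd.fderiv]
    simp
  have zero : 2 / ν < s x → ‖dz v (cx (chi D s ν)) x‖ = 0 := by
    intro hs
    have : deriv Real.smoothTransition (ν * s x - 1) = 0 := by
      apply (hθ.2 _).2
      rw [div_lt_iff₀ hν] at hs; linarith
    simp [dz, hf, this]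
  refine ⟨?_, fun hh => ?_⟩
  · rcases lt_or_ge (2 / ν) (s x) with hs | hs
    · rw [zero hs]; simp; positivity
    have hC1 : 0 ≤ C1 := (norm_nonneg _).trans (h.grad x hD)
    have b1 : ‖dz v (cx (chi D s ν)) x‖ ≤ (Cθ * ν * C1) * ‖v‖ := by
      apply dz_norm_le
      intro w
      rw [hf, Complex.norm_real, Real.norm_eq_abs, abs_mul, abs_mul, abs_of_pos hν]
      have := (fderiv ℝ s x).le_of_opNorm_le (h.grad x hD) w
      rw [Real.norm_eq_abs] at this
      calc _ ≤ Cθ * (ν * (C1 * ‖w‖)) := by gcongr; exacts [hθ.1, (hθ.2 _).1]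
        _ = _ := by ring
    rw [← mul_pow]
    have hp := h.pos x hD
    have := hθ.1
    rw [le_div_iff₀ hν] at hs
    refine pow_le_pow_left₀ (by positivity) ?_ 2
    calc _ ≤ (Cθ * ν * C1) * ‖v‖ * s x := by gcongr
      _ = (s x * ν) * (Cθ * C1 * ‖v‖) := by ring
      _ ≤ 2 * (Cθ * C1 * ‖v‖) := by gcongr
      _ = _ := by ring
  · have : 2 / ν < s x := by
      by_contra h'; exact hh ⟨hD, not_lt.1 h'⟩
    rw [zero this]; simp

theorem apriori (b : Module.Basis ι ℂ E) (e : ι → E) (h : EX D s φ C1)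
    (hcurv : ∀ x ∈ D, ∀ τ : ι → ℂ,
      (12 * (∑ j, ‖dz (e j) (cx s) x‖ ^ 2) / s x ^ 2 + 1 / s x ^ 2) * ∑ j, ‖τ j‖ ^ 2
        ≤ levi φ x (∑ j, τ j • e j) / 4)
    {a : ι → E → ℂ} (ha : ∀ j, MemLp (a j) 2 μ) {G : E → ℂ} (hG : Tst D G)
    (hdiv : ∀ v, Tst D v → ∫ x, ∑ j, sg2 s φ x * a j x * dz (e j) v x ∂μ = - ∫ x, v x * G x ∂μ)
    (hcurl : ∀ v, Tst D v → ∀ j k,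
      ∫ x, (i2 s φ x * a k x * dzb (e j) v x - i2 s φ x * a j x * dzb (e k) v x) ∂μ = 0)
    {K : Set E} (hK : IsCompact K) (hKD : K ⊆ D) :
    ∫ x in K, ∑ j, ‖a j x‖ ^ 2 ∂μ ≤ 3 * ∫ x, ‖i1 s φ x * G x‖ ^ 2 ∂μ := by
  obtain ⟨Cθ, hθ⟩ := smoothTransition_deriv_bdd
  set A : E → ℝ := fun x => ∑ j, ‖a j x‖ ^ 2 with hA
  have iA : Integrable A μ := integrable_finset_sum _ fun j _ => memLp_sq (ha j)
  have A0 : ∀ x, 0 ≤ A x := fun x => Finset.sum_nonneg fun j _ => by positivity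
  set C2 := ∑ j, (2 * Cθ * C1 * ‖e j‖) ^ 2 with hC2
  set S : ℕ → Set E := fun n => {x | x ∈ D ∧ s x ≤ 2 / (n + 1 : ℝ)} with hS
  have mS : ∀ n, MeasurableSet (S n) := by
    intro n
    have : S n = D \ (D ∩ s ⁻¹' Ioi (2 / (n + 1 : ℝ))) := by
      ext x; simp only [hS, mem_setOf_eq, mem_diff, mem_inter_iff, mem_preimage, mem_Ioi]
      constructor
      · rintro ⟨h1, h2⟩; exact ⟨h1, fun hh => absurd hh.2 (not_lt.2 h2)⟩
      · rintro ⟨h1, h2⟩; exact ⟨h1, by by_contra hh; exact h2 ⟨h1, not_le.1 hh⟩⟩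
    rw [this]
    exact h.op.measurableSet.diff
      (h.hs.continuousOn.isOpen_inter_preimage h.op isOpen_Ioi).measurableSet
  have anti : Antitone S := by
    intro m n hmn x hx
    refine ⟨hx.1, hx.2.trans ?_⟩
    have : (m : ℝ) ≤ n := by exact_mod_cast hmn
    gcongr
  have emp : ⋂ n, S n = ∅ := by
    rw [eq_empty_iff_forall_notMem]
    intro x hx
    rw [mem_iInter] at hx
    have hp := h.pos x (hx 0).1
    obtain ⟨n, hn⟩ := exists_nat_gt (2 / s x)
    have := (hx n).2
    rw [div_lt_iff₀ hp] at hn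
    rw [le_div_iff₀ (by positivity)] at this
    nlinarith
  have lim := tendsto_setIntegral_of_antitone mS anti ⟨0, iA.integrableOn⟩
  rw [emp] at lim
  simp only [Measure.restrict_empty, integral_zero_measure] at lim
  have lim2 : Tendsto (fun n => 3 * ∫ x, ‖i1 s φ x * G x‖ ^ 2 ∂μ + 5 * (C2 * ∫ x in S n, A x ∂μ)) atTop
      (𝓝 (3 * ∫ x, ‖i1 s φ x * G x‖ ^ 2 ∂μ + 5 * (C2 * 0))) :=
    ((lim.const_mul C2).const_mul 5).const_add _
  rw [mul_zero, mul_zero, add_zero] at lim2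
  refine ge_of_tendsto lim2 ?_
  -- lower bound of s on K
  obtain ⟨n0, hn0⟩ : ∃ n0 : ℕ, ∀ x ∈ K, 2 / (n0 + 1 : ℝ) ≤ s x := by
    rcases K.eq_empty_or_nonempty with hE | hne
    · exact ⟨0, by simp [hE]⟩
    obtain ⟨x0, hx0, hmin⟩ := hK.exists_isMinOn hne (h.hs.continuousOn.mono hKD)
    have hp := h.pos x0 (hKD hx0)
    obtain ⟨n, hn⟩ := exists_nat_gt (2 / s x0)
    refine ⟨n, fun x hx => le_trans ?_ (hmin hx)⟩
    rw [div_lt_iff₀ hp] at hn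
    rw [div_le_iff₀ (by positivity)]
    nlinarith
  filter_upwards [eventually_ge_atTop n0] with n hn
  set ν : ℝ := n + 1 with hν
  have hν0 : 0 < ν := by positivity
  have hnn : (n0 + 1 : ℝ) ≤ ν := by rw [hν]; gcongr
  have c4 := chi_tst h (ν := 4 * ν) (by positivity)
  have tφ : Tst D (cx (fun x => φ x * chi D s (4 * ν) x)) := by
    have := c4.smul_on h.op (cxOn h.hφ)
    convert this using 2
    simp [cx]
  have cφ : ContDiff ℝ ∞ (fun x => φ x * chi D s (4 * ν) x) := by
    have := Complex.reCLM.contDiff.comp tφ.smooth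
    convert this using 1
    ext x; simp [cx]
  have kφ : HasCompactSupport (fun x => φ x * chi D s (4 * ν) x) := by
    refine tφ.cpt.mono' (fun x hx => subset_tsupport _ ?_)
    simpa [cx] using hx
  have est := cutoff_est (μ := μ) b e h.toWD hcurv ha hG hdiv hcurl (chi_tst h hν0) (chi_sq ν) cφ kφ ?_
  swap
  · intro x hx
    obtain ⟨hxD, hxs⟩ := chi_tsupp h hν0 hx
    have hc : ContinuousAt s x := (h.ds hxD).continuousAt
    have : 2 / (4 * ν) < s x := by
      refine lt_of_lt_of_le ?_ hxs
      rw [div_lt_div_iff₀ (by positivity) (by positivity)]; nlinarith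
    filter_upwards [h.op.mem_nhds hxD, hc.eventually (lt_mem_nhds this)] with y hy hys
    rw [chi_one (by positivity) hy hys.le, mul_one]
  refine le_trans ?_ (est.trans ?_)
  · rw [← integral_indicator hK.measurableSet]
    refine integral_mono (iA.indicator hK.measurableSet) ?_ ?_
    · have := integrable_finset_sum (μ := μ) Finset.univ fun j _ =>
        memLp_sq ((chi_tst h hν0).mul_memLp (ha j))
      refine this.congr (Eventually.of_forall fun x => ?_)
      simp [cx, mul_pow, Finset.mul_sum]
    · intro x
      by_cases hx : x ∈ K
      · rw [indicator_of_mem hx]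
        beta_reduce
        rw [chi_one hν0 (hKD hx)]
        · simp [hA]
        · refine le_trans ?_ (hn0 x hx)
          gcongr
      · rw [indicator_of_notMem hx]
        exact mul_nonneg (sq_nonneg _) (A0 x)
  · gcongr
    rw [← integral_const_mul, ← integral_indicator (mS n)]
    refine integral_mono_of_nonneg ?_ ((iA.const_mul C2).indicator (mS n)) ?_
    · refine Eventually.of_forall fun x => ?_
      exact mul_nonneg (mul_nonneg (Finset.sum_nonneg fun j _ => by positivity) (sq_nonneg _)) (A0 x)
    · refine Eventually.of_forall fun x => ?_
      have hg := fun j => chi_grad h hθ hν0 (e j) x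
      simp only [Finset.sum_mul]
      by_cases hx : x ∈ S n
      · rw [indicator_of_mem hx]
        simp only [hC2, Finset.sum_mul]
        refine Finset.sum_le_sum fun j _ => ?_
        exact mul_le_mul_of_nonneg_right (hg j).1 (A0 x)
      · rw [indicator_of_notMem hx]
        refine le_of_eq (Finset.sum_eq_zero fun j _ => ?_)
        rw [(hg j).2 hx, zero_mul]

end Limit
end SteinAux

namespace SteinAux
open MeasureTheory Complex Filter
open scoped ContDiff ComplexConjugate

section Exist
variable {E : Type*} [NormedAddCommGroup E] [NormedSpace ℂ E] [NormedSpace ℝ E] [IsScalarTower ℝ ℂ E]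
variable [FiniteDimensional ℝ E] [MeasurableSpace E] [BorelSpace E]
variable {μ : Measure E} [μ.IsAddHaarMeasure]
variable {ι : Type*} [Fintype ι] {D : Set E} {s φ : E → ℝ} {C1 : ℝ}

lemma hilb {H : Type*} [NormedAddCommGroup H] [InnerProductSpace ℂ H] [CompleteSpace H]
    (R : Submodule ℂ H) (x : H) {M : ℝ} (hM : 0 ≤ M) (hR : ∀ r ∈ R, ‖inner ℂ r x‖ ≤ M * ‖r‖) :
    ∃ u : H, ‖u‖ ≤ M ∧ ∀ r ∈ R, inner ℂ r (x - u) = 0 := by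
  set T := R.topologicalClosure with hT
  haveI : CompleteSpace T := (Submodule.isClosed_topologicalClosure R).completeSpace_coe
  set u : H := T.starProjection x with hu
  have huT : u ∈ T := Submodule.starProjection_apply_mem _ _
  have horth : ∀ r ∈ T, inner ℂ r (x - u) = 0 := by
    intro r hr
    have := Submodule.sub_starProjection_mem_orthogonal (K := T) x
    exact (Submodule.mem_orthogonal _ _).1 this r hr
  have hbd : ∀ r ∈ T, ‖inner ℂ r x‖ ≤ M * ‖r‖ := by
    intro r hr
    have hcl : IsClosed {r : H | ‖inner ℂ r x‖ ≤ M * ‖r‖} :=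
      isClosed_le (by fun_prop) (by fun_prop)
    exact closure_minimal (fun y hy => hR y hy) hcl hr
  refine ⟨u, ?_, fun r hr => horth r (R.le_topologicalClosure hr)⟩
  have h1 : inner ℂ u x = inner ℂ u u := by
    have := horth u huT
    rw [inner_sub_right, sub_eq_zero] at this; exact this
  have h2 := hbd u huT
  rw [h1, inner_self_eq_norm_sq_to_K] at h2
  have h3 : ‖u‖ ^ 2 ≤ M * ‖u‖ := by
    simpa using h2
  by_contra hlt
  push Not at hlt
  nlinarith [norm_nonneg u]

lemma inner_toLp {f g : E → ℂ} (hf : MemLp f 2 μ) (hg : MemLp g 2 μ) :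
    inner ℂ (hf.toLp f) (hg.toLp g) = ∫ x, g x * conj (f x) ∂μ := by
  rw [MeasureTheory.L2.inner_def]
  refine integral_congr_ae ?_
  filter_upwards [hf.coeFn_toLp, hg.coeFn_toLp] with x h1 h2
  rw [h1, h2]; simp

lemma inner_toLp' {f : E → ℂ} (hf : MemLp f 2 μ) (g : Lp ℂ 2 μ) :
    inner ℂ (hf.toLp f) g = ∫ x, g x * conj (f x) ∂μ := by
  rw [MeasureTheory.L2.inner_def]
  refine integral_congr_ae ?_
  filter_upwards [hf.coeFn_toLp] with x h1
  rw [h1]; simp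

lemma norm_toLp_sq {f : E → ℂ} (hf : MemLp f 2 μ) : ‖hf.toLp f‖ ^ 2 = ∫ x, ‖f x‖ ^ 2 ∂μ := by
  have h1 : ((‖hf.toLp f‖ ^ 2 : ℝ) : ℂ) = inner ℂ (hf.toLp f) (hf.toLp f) := by
    rw [inner_self_eq_norm_sq_to_K]; simp
  rw [inner_toLp] at h1
  have h2 : ∀ x, f x * conj (f x) = ((‖f x‖ ^ 2 : ℝ) : ℂ) := by
    intro x; rw [Complex.mul_conj, Complex.normSq_eq_norm_sq]
  simp_rw [h2] at h1
  rw [integral_complex_ofReal] at h1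
  exact_mod_cast h1

lemma i2_conj (x : E) : conj (i2 s φ x) = i2 s φ x := Complex.conj_ofReal _
lemma i1_conj (x : E) : conj (i1 s φ x) = i1 s φ x := Complex.conj_ofReal _
lemma sg2_conj (x : E) : conj (sg2 s φ x) = sg2 s φ x := Complex.conj_ofReal _

lemma WD.sg2_i2_mul (h : WD D s φ) {t : E → ℂ} (ht : Tst D t) (x : E) :
    sg2 s φ x * i2 s φ x * t x = t x := by
  by_cases hx : x ∈ D
  · rw [h.sg2_i2 hx, one_mul]
  · rw [ht.eq_zero fun hh => hx (ht.sub hh)]; simp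

lemma WD.sg1_i1_mul (h : WD D s φ) {t : E → ℂ} (ht : Tst D t) (x : E) :
    sg1 s φ x * i1 s φ x * t x = t x := by
  by_cases hx : x ∈ D
  · rw [h.sg1_i1 hx, one_mul]
  · rw [ht.eq_zero fun hh => hx (ht.sub hh)]; simp

theorem exist_dbar (b : Module.Basis ι ℂ E) (e : ι → E) (h : EX D s φ C1)
    (hcurv : ∀ x ∈ D, ∀ τ : ι → ℂ,
      (12 * (∑ j, ‖dz (e j) (cx s) x‖ ^ 2) / s x ^ 2 + 1 / s x ^ 2) * ∑ j, ‖τ j‖ ^ 2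
        ≤ levi φ x (∑ j, τ j • e j) / 4)
    {g : E → ℂ} (hg : Tst D g) :
    ∃ u : E → ℂ, MemLp u 2 μ ∧
      ∫ x, ‖u x‖ ^ 2 ∂μ ≤ 3 * ∑ j, ∫ x, ‖sg2 s φ x * dzb (e j) g x‖ ^ 2 ∂μ ∧
      ∀ β, Tst D β → ∀ j, ∫ x, (sg1 s φ x * g x - u x) * (i1 s φ x * dzb (e j) β x) ∂μ = 0 := by
  classical
  have hW := h.toWD
  -- the test elements
  have tT : ∀ {β} (hβ : Tst D β) (j), MemLp (fun x => i2 s φ x * conj (dzb (e j) β x)) 2 μ :=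
    fun hβ j => ((hβ.dzb (e j)).conj'.smul_on h.op h.i2s).memLp 2
  have dT : ∀ {v} (hv : Tst D v) (j), MemLp (fun x => sg2 s φ x * dzb (e j) v x) 2 μ :=
    fun hv j => ((hv.dzb (e j)).smul_on h.op h.sg2s).memLp 2
  let Z : Submodule ℂ (PiLp 2 (fun _ : ι => Lp ℂ 2 μ)) :=
    { carrier := {w | ∀ β, ∀ hβ : Tst D β, ∀ j k,
        inner ℂ ((tT hβ j).toLp _) (w k) - inner ℂ ((tT hβ k).toLp _) (w j) = 0}
      add_mem' := by
        intro a c ha hc β hβ j k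
        have h1 := ha β hβ j k
        have h2 := hc β hβ j k
        simp only [PiLp.add_apply, inner_add_right]
        linear_combination h1 + h2
      zero_mem' := by intro β hβ j k; simp
      smul_mem' := by
        intro c a ha β hβ j k
        have h1 := ha β hβ j k
        simp only [PiLp.smul_apply, inner_smul_right]
        linear_combination c * h1 }
  have hZc : IsClosed (Z : Set (PiLp 2 (fun _ : ι => Lp ℂ 2 μ))) := by
    have : (Z : Set (PiLp 2 (fun _ : ι => Lp ℂ 2 μ))) = ⋂ β, ⋂ hβ : Tst D β, ⋂ j, ⋂ k,
        {w | inner ℂ ((tT hβ j).toLp _) (w k) - inner ℂ ((tT hβ k).toLp _) (w j) = 0} := by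
      ext w; simp only [mem_iInter]; rfl
    rw [this]
    refine isClosed_iInter fun β => isClosed_iInter fun hβ => isClosed_iInter fun j =>
      isClosed_iInter fun k => isClosed_eq ?_ continuous_const
    have cont : ∀ i : ι, Continuous fun w : PiLp 2 (fun _ : ι => Lp ℂ 2 μ) => w i :=
      fun i => PiLp.continuous_apply 2 _ i
    exact (continuous_const.inner (cont k)).sub (continuous_const.inner (cont j))
  haveI : CompleteSpace Z := hZc.completeSpace_coe
  let dv : ∀ {v}, Tst D v → PiLp 2 (fun _ : ι => Lp ℂ 2 μ) := fun hv =>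
    WithLp.toLp 2 (fun j => (dT hv j).toLp _)
  have dvZ : ∀ {v} (hv : Tst D v), dv hv ∈ Z := by
    intro v hv β hβ j k
    simp only [dv, inner_toLp]
    have e1 : ∀ j k x, sg2 s φ x * dzb (e k) v x * conj (i2 s φ x * conj (dzb (e j) β x))
        = dzb (e k) v x * dzb (e j) β x := by
      intro j k x
      have := hW.sg2_i2_mul (hβ.dzb (e j)) x
      simp only [map_mul, Complex.conj_conj, i2_conj]
      linear_combination (dzb (e k) v x) * this
    simp_rw [e1]
    rw [ibp_dzb (contDiff_dzb hv.smooth _) hβ, ibp_dzb (contDiff_dzb hv.smooth _) hβ]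
    simp_rw [dzb_dzb_comm hv.smooth _ (e k) (e j)]
    ring
  have rT : ∀ {δ : ι → E → ℂ} (hδ : ∀ j, Tst D (δ j)),
      Tst D (fun x => ∑ j, dz (e j) (δ j) x) := fun hδ => Tst.sum _ fun j => (hδ j).dz (e j)
  have rM : ∀ {δ : ι → E → ℂ} (hδ : ∀ j, Tst D (δ j)),
      MemLp (fun x => i1 s φ x * ∑ j, dz (e j) (δ j) x) 2 μ := fun hδ =>
    ((rT hδ).smul_on h.op h.i1s).memLp 2
  let R : Submodule ℂ (Lp ℂ 2 μ) :=
    { carrier := {r | ∃ δ : ι → E → ℂ, ∃ hδ : ∀ j, Tst D (δ j), r = (rM hδ).toLp _}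
      add_mem' := by
        rintro a c ⟨δ, hδ, rfl⟩ ⟨δ', hδ', rfl⟩
        refine ⟨fun j x => δ j x + δ' j x, fun j => (hδ j).add (hδ' j), ?_⟩
        rw [← MemLp.toLp_add]
        congr 1
        ext x
        simp only [Pi.add_apply, dz_add ((hδ _).diff x) ((hδ' _).diff x), Finset.sum_add_distrib]
        ring
      zero_mem' := by
        refine ⟨fun j x => 0, fun j => Tst.zero, ?_⟩
        symm
        rw [Lp.eq_zero_iff_ae_eq_zero]
        refine (MemLp.coeFn_toLp _).trans (Eventually.of_forall fun x => ?_)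
        simp [dz]
      smul_mem' := by
        rintro c a ⟨δ, hδ, rfl⟩
        refine ⟨fun j x => c * δ j x, fun j => (hδ j).mul_smooth contDiff_const, ?_⟩
        rw [← MemLp.toLp_const_smul]
        congr 1
        ext x
        have : ∀ j, dz (e j) (fun x => c * δ j x) x = c * dz (e j) (δ j) x := by
          intro j
          rw [dz_mul (differentiableAt_const _) ((hδ j).diff x)]
          simp [dz]
        simp only [Pi.smul_apply, smul_eq_mul, this, ← Finset.mul_sum]
        ring }
  have gM : MemLp (fun x => sg1 s φ x * g x) 2 μ := (hg.smul_on h.op h.sg1s).memLp 2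
  have aM : ∀ {δ : E → ℂ} (hδ : Tst D δ), MemLp (fun x => i2 s φ x * δ x) 2 μ :=
    fun hδ => (hδ.smul_on h.op h.i2s).memLp 2
  set o := dv hg with ho
  have oN : ‖o‖ ^ 2 = ∑ j, ∫ x, ‖sg2 s φ x * dzb (e j) g x‖ ^ 2 ∂μ := by
    rw [PiLp.norm_sq_eq_of_L2]
    refine Finset.sum_congr rfl fun j _ => ?_
    exact norm_toLp_sq (dT hg j)
  have main : ∀ r ∈ R, ‖inner ℂ r (gM.toLp _)‖ ≤ (√3 * ‖o‖) * ‖r‖ := by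
    rintro r ⟨δ, hδ, rfl⟩
    set aδ : PiLp 2 (fun _ : ι => Lp ℂ 2 μ) := WithLp.toLp 2 (fun j => (aM (hδ j)).toLp _) with haδ
    set a' := Z.starProjection aδ with ha'
    have ha'Z : a' ∈ Z := Submodule.starProjection_apply_mem _ _
    have hor : ∀ z ∈ Z, inner ℂ z a' = inner ℂ z aδ := by
      intro z hz
      have := Submodule.sub_starProjection_mem_orthogonal (K := Z) aδ
      have := (Submodule.mem_orthogonal _ _).1 this z hz
      rw [inner_sub_right, sub_eq_zero] at this; exact this.symm
    -- inner products of `d_v` with `a_δ`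
    have hda : ∀ {v} (hv : Tst D v), inner ℂ (dv hv) aδ
        = ∑ j, ∫ x, conj (dzb (e j) v x) * δ j x ∂μ := by
      intro v hv
      rw [PiLp.inner_apply]
      refine Finset.sum_congr rfl fun j _ => ?_
      simp only [dv, haδ, inner_toLp]
      congr 1; ext x
      have := hW.sg2_i2_mul (hδ j) x
      simp only [map_mul, sg2_conj]
      linear_combination (conj (dzb (e j) v x)) * this
    -- identification of the functional
    have hr : inner ℂ ((rM hδ).toLp _) (gM.toLp _) = - inner ℂ aδ o := by
      rw [← inner_conj_symm aδ o, hda hg, inner_toLp]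
      have e1 : ∀ x, sg1 s φ x * g x * conj (i1 s φ x * ∑ j, dz (e j) (δ j) x)
          = ∑ j, g x * dzb (e j) (fun x => conj (δ j x)) x := by
        intro x
        have := hW.sg1_i1_mul hg x
        simp only [map_mul, i1_conj, map_sum, dzb_conj, ← Finset.mul_sum]
        linear_combination (∑ j, conj (dz (e j) (δ j) x)) * this
      simp_rw [e1]
      rw [integral_finset_sum _ fun j _ => ((hδ j).conj'.dzb (e j)).mul_int (hg.memLp 2), map_sum,
        ← Finset.sum_neg_distrib]
      refine Finset.sum_congr rfl fun j _ => ?_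
      rw [ibp_dzb hg.smooth (hδ j).conj', ← integral_conj]
      congr 2; ext x; simp
    have hio : inner ℂ aδ o = inner ℂ a' o := by
      rw [← inner_conj_symm aδ, ← inner_conj_symm a', hor o (dvZ hg)]
    have hK := hg.cpt.isCompact
    have est := apriori (μ := μ) b e h hcurv (a := fun j x => a' j x) (fun j => Lp.memLp (a' j))
      (rT hδ) ?_ ?_ hK hg.sub
    rotate_left
    · intro v hv
      have h1 := hor _ (dvZ hv.conj')
      rw [hda hv.conj', PiLp.inner_apply] at h1
      simp only [dv, inner_toLp'] at h1
      rw [integral_finset_sum]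
      swap
      · intro j _
        have := ((hv.dz (e j)).smul_on h.op h.sg2s).mul_int (Lp.memLp (a' j))
        refine this.congr (Eventually.of_forall fun x => ?_)
        simp only; ring
      have e2 : ∀ j, ∫ x, sg2 s φ x * a' j x * dz (e j) v x ∂μ
          = ∫ x, a' j x * conj (sg2 s φ x * dzb (e j) (fun x => conj (v x)) x) ∂μ := by
        intro j; congr 1; ext x
        simp only [dzb_conj, map_mul, sg2_conj, Complex.conj_conj]; ring
      simp_rw [e2]
      rw [h1]
      simp_rw [Finset.mul_sum]
      rw [integral_finset_sum _ fun j _ => ((hδ j).dz (e j)).mul_int (hv.memLp 2),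
        ← Finset.sum_neg_distrib]
      refine Finset.sum_congr rfl fun j _ => ?_
      rw [ibp_dz hv.smooth (hδ j), neg_neg]
      congr 1; ext x; simp [dzb_conj]
    · intro v hv j k
      have h1 := ha'Z v hv j k
      simp only [inner_toLp'] at h1
      rw [integral_sub]
      · rw [← h1]
        congr 1 <;> congr 1 <;> ext x <;> simp only [map_mul, i2_conj, Complex.conj_conj] <;> ring
      · have := ((hv.dzb (e j)).smul_on h.op h.i2s).mul_int (Lp.memLp (a' k))
        refine this.congr (Eventually.of_forall fun x => ?_)
        simp only; ring
      · have := ((hv.dzb (e k)).smul_on h.op h.i2s).mul_int (Lp.memLp (a' j))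
        refine this.congr (Eventually.of_forall fun x => ?_)
        simp only; ring
    set K := tsupport g with hKdef
    have iM : ∀ j, MemLp (K.indicator (fun x => a' j x)) 2 μ := fun j =>
      (Lp.memLp (a' j)).indicator hK.measurableSet
    set a2 : PiLp 2 (fun _ : ι => Lp ℂ 2 μ) := WithLp.toLp 2 (fun j => (iM j).toLp _) with ha2
    have hi2 : inner ℂ a' o = inner ℂ a2 o := by
      rw [PiLp.inner_apply, PiLp.inner_apply]
      refine Finset.sum_congr rfl fun j _ => ?_
      rw [← inner_conj_symm (a' j), ← inner_conj_symm (a2 j)]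
      congr 1
      simp only [ha2, ho, dv]
      rw [inner_toLp', inner_toLp]
      congr 1; ext x
      by_cases hx : x ∈ K
      · rw [indicator_of_mem hx]
      · have : dzb (e j) g x = 0 :=
          image_eq_zero_of_notMem_tsupport fun hh => hx (support_dzb _ _ hh)
        simp [this]
    have n2 : ‖a2‖ ^ 2 = ∫ x in K, ∑ j, ‖a' j x‖ ^ 2 ∂μ := by
      rw [PiLp.norm_sq_eq_of_L2, integral_finset_sum _ fun j _ =>
        (memLp_sq (Lp.memLp (a' j))).integrableOn]
      refine Finset.sum_congr rfl fun j _ => ?_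
      rw [← integral_indicator hK.measurableSet]
      simp only [ha2]
      rw [norm_toLp_sq]
      congr 1; ext x
      by_cases hx : x ∈ K <;> simp [hx]
    rw [← n2, ← norm_toLp_sq (rM hδ)] at est
    rw [hr, norm_neg, hio, hi2]
    have a2le : ‖a2‖ ≤ √3 * ‖(rM hδ).toLp _‖ := by
      refine abs_le_of_sq_le_sq' ?_ (by positivity) |>.2
      rw [mul_pow, Real.sq_sqrt (by norm_num)]; exact est
    calc ‖inner ℂ a2 o‖ ≤ ‖a2‖ * ‖o‖ := norm_inner_le_norm _ _
      _ ≤ √3 * ‖(rM hδ).toLp _‖ * ‖o‖ := by gcongr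
      _ = _ := by ring
  obtain ⟨u, hu, hur⟩ := hilb R (gM.toLp _) (by positivity) main
  refine ⟨u, Lp.memLp u, ?_, ?_⟩
  · have h1 := norm_toLp_sq (Lp.memLp u)
    rw [Lp.toLp_coeFn] at h1
    rw [← h1, ← oN]
    calc ‖u‖ ^ 2 ≤ (√3 * ‖o‖) ^ 2 := by gcongr
      _ = _ := by rw [mul_pow, Real.sq_sqrt (by norm_num)]
  · intro β hβ j
    set δ : ι → E → ℂ := fun k => if k = j then (fun x => conj (β x)) else fun _ => 0 with hδ
    have tδ : ∀ k, Tst D (δ k) := by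
      intro k; simp only [hδ]; split_ifs
      · exact hβ.conj'
      · exact Tst.zero
    have h1 := hur _ ⟨δ, tδ, rfl⟩
    rw [inner_toLp'] at h1
    rw [← h1]
    refine integral_congr_ae ?_
    filter_upwards [Lp.coeFn_sub (gM.toLp _) u, gM.coeFn_toLp] with x hx1 hx2
    rw [hx1, Pi.sub_apply, hx2]
    congr 1
    have : ∑ k, dz (e k) (δ k) x = conj (dzb (e j) β x) := by
      rw [Finset.sum_eq_single j]
      · simp [hδ, dz_conj]
      · intro k _ hk; simp [hδ, hk, dz]
      · simp
    rw [this]; simp [i1_conj]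

end Exist
end SteinAux

namespace SteinAux
open MeasureTheory Complex Filter
open scoped ContDiff ComplexConjugate

section Weyl
variable {E : Type*} [NormedAddCommGroup E] [NormedSpace ℂ E] [NormedSpace ℝ E] [IsScalarTower ℝ ℂ E]
variable [FiniteDimensional ℝ E] [MeasurableSpace E] [BorelSpace E]
variable {μ : Measure E} [μ.IsAddHaarMeasure]
variable {ι : Type*} [Fintype ι] {D : Set E} {η : E → ℝ} {ε : ℝ}

lemma rot_map (c : ℂ) (hc : ‖c‖ = 1) : MeasurePreserving (fun v : E => c • v) μ μ := by
  let l : E →ₗ[ℝ] E :=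
    { toFun := fun v => c • v
      map_add' := fun x y => smul_add c x y
      map_smul' := fun r x => by simp only [RingHom.id_apply]; rw [← algebraMap_smul ℂ r x, ← algebraMap_smul ℂ r (c • x), smul_comm] }
  have hc0 : c ≠ 0 := by intro h; simp [h] at hc
  have hm : Measurable (fun v : E => c • v) := (continuous_const_smul c).measurable
  let lE : E ≃ₗ[ℝ] E := LinearEquiv.ofBijective l ⟨fun a b h => by
      have : c • a = c • b := h
      exact smul_right_injective E hc0 this, fun y => ⟨c⁻¹ • y, by
        show c • c⁻¹ • y = y
        rw [smul_smul, mul_inv_cancel₀ hc0, one_smul]⟩⟩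
  have hdet : LinearMap.det l ≠ 0 := (LinearEquiv.isUnit_det' lE).ne_zero
  have h1 := Measure.map_linearMap_addHaar_eq_smul_addHaar μ hdet
  refine ⟨hm, ?_⟩
  have h2 : Measure.map (fun v : E => c • v) μ = ENNReal.ofReal |(LinearMap.det l)⁻¹| • μ := h1
  have h3 : Measure.map (fun v : E => c • v) μ (Metric.ball 0 1) = μ (Metric.ball 0 1) := by
    rw [Measure.map_apply hm Metric.isOpen_ball.measurableSet]
    congr 1; ext v; simp [norm_smul, hc]
  have : ProperSpace E := FiniteDimensional.proper_real E
  have h4 : ENNReal.ofReal |(LinearMap.det l)⁻¹| = 1 := by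
    rw [h2, Measure.smul_apply, smul_eq_mul] at h3
    have p1 : μ (Metric.ball 0 1) ≠ 0 := (Metric.measure_ball_pos μ 0 one_pos).ne'
    have p2 : μ (Metric.ball 0 1) ≠ ⊤ := measure_ball_lt_top.ne
    exact (ENNReal.mul_eq_right p1 p2).1 h3
  rw [h2, h4, one_smul]

lemma Moll.mean (h : Moll μ ε η) {G : E → ℂ} {U : Set E} (hU : IsOpen U) (hG : DifferentiableOn ℂ G U)
    {x : E} (hx : Metric.closedBall x ε ⊆ U) : sm μ η G x = G x := by
  have : ProperSpace E := FiniteDimensional.proper_real E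
  have hGc : ∀ {y}, y ∈ U → ContinuousAt G y := fun hy => hG.continuousOn.continuousAt (hU.mem_nhds hy)
  set Ψ : ℝ → E → ℂ := fun θ v => G (x - circleMap 0 1 θ • v) * (η v : ℂ) with hΨ
  have nc : ∀ θ, ‖circleMap 0 1 θ‖ = 1 := fun θ => by simp
  have hmem : ∀ {c : ℂ} {v : E}, ‖c‖ ≤ 1 → ‖v‖ ≤ ε → x - c • v ∈ U := by
    intro c v hc hv
    apply hx
    rw [Metric.mem_closedBall, dist_eq_norm, sub_sub_cancel_left, norm_neg, norm_smul]
    nlinarith [norm_nonneg v, norm_nonneg c]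
  have hcont : Continuous (Function.uncurry Ψ) := by
    rw [continuous_iff_continuousAt]
    rintro ⟨θ, v⟩
    rcases le_or_gt ‖v‖ ε with hv | hv
    · have h1 : ContinuousAt (fun p : ℝ × E => x - circleMap 0 1 p.1 • p.2) (θ, v) := by
        have : Continuous (fun p : ℝ × E => x - circleMap 0 1 p.1 • p.2) := by
          have := continuous_circleMap 0 1
          fun_prop
        exact this.continuousAt
      have h2 : ContinuousAt (fun p : ℝ × E => G (x - circleMap 0 1 p.1 • p.2)) (θ, v) :=
        ContinuousAt.comp (g := G) (hGc (hmem (nc θ).le hv)) h1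
      have h3 : ContinuousAt (fun p : ℝ × E => (η p.2 : ℂ)) (θ, v) :=
        (Complex.continuous_ofReal.comp (h.smooth.continuous.comp continuous_snd)).continuousAt
      exact h2.mul h3
    · have : Function.uncurry Ψ =ᶠ[𝓝 (θ, v)] fun _ => 0 := by
        have ho : IsOpen {p : ℝ × E | ε < ‖p.2‖} := isOpen_lt continuous_const (by fun_prop)
        filter_upwards [ho.mem_nhds hv] with p hp
        simp [Function.uncurry, hΨ, h.supp p.2 (le_of_lt hp)]
      exact (continuousAt_const).congr this.symm
  have z0 : ∀ θ v, ε < ‖v‖ → Ψ θ v = 0 := fun θ v hv => by simp [hΨ, h.supp v hv.le]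
  have stepA : sm μ η G x = ∫ v, G (x - v) * (η v : ℂ) ∂μ := by
    unfold sm
    rw [← integral_sub_left_eq_self (fun t => G t * (η (x - t) : ℂ)) μ x]
    simp
  have stepB : ∀ θ, ∫ v, Ψ θ v ∂μ = sm μ η G x := by
    intro θ
    rw [stepA]
    have hc := nc θ
    have hc0 : circleMap 0 1 θ ≠ 0 := by intro h0; rw [h0] at hc; simp at hc
    have := (rot_map (μ := μ) (E := E) _ hc).integral_comp
      ((Homeomorph.smulOfNeZero (circleMap 0 1 θ) hc0).measurableEmbedding)
      (fun v => G (x - v) * (η v : ℂ))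
    rw [← this]
    congr 1; ext v
    simp only [hΨ, h.rot _ v hc]
  have hintg : Integrable (Function.uncurry Ψ) ((volume.restrict (Ioc 0 (2 * Real.pi))).prod μ) := by
    have e1 : (volume.restrict (Ioc 0 (2 * Real.pi))).prod μ
        = ((volume : Measure ℝ).prod μ).restrict (Ioc 0 (2 * Real.pi) ×ˢ univ) := by
      rw [← Measure.prod_restrict, Measure.restrict_univ]
    rw [e1]
    have hk : IntegrableOn (Function.uncurry Ψ) (Icc 0 (2 * Real.pi) ×ˢ Metric.closedBall 0 ε)
        ((volume : Measure ℝ).prod μ) :=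
      hcont.continuousOn.integrableOn_compact (isCompact_Icc.prod (isCompact_closedBall _ _))
    have hk2 : IntegrableOn (Function.uncurry Ψ) (Ioc 0 (2 * Real.pi) ×ˢ Metric.closedBall 0 ε)
        ((volume : Measure ℝ).prod μ) := hk.mono_set (prod_mono Ioc_subset_Icc_self subset_rfl)
    refine hk2.of_forall_diff_eq_zero (measurableSet_Ioc.prod MeasurableSet.univ) ?_
    rintro ⟨θ, v⟩ ⟨⟨h1, -⟩, h2⟩
    apply z0
    by_contra hv
    exact h2 ⟨h1, by simpa using not_lt.1 hv⟩
  have swap := integral_integral_swap hintg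
  have lhs : ∫ θ in Ioc 0 (2 * Real.pi), ∫ v, Ψ θ v ∂μ = (2 * Real.pi) * sm μ η G x := by
    simp_rw [stepB]
    rw [setIntegral_const]
    simp [Real.pi_pos.le]
  have rhs : ∀ v, ∫ θ in Ioc 0 (2 * Real.pi), Ψ θ v = (2 * Real.pi) * (G x * η v) := by
    intro v
    rcases le_or_gt ‖v‖ ε with hv | hv
    · simp only [hΨ]
      rw [integral_mul_const, ← intervalIntegral.integral_of_le (by positivity)]
      have hd : DiffContOnCl ℂ (fun c : ℂ => G (x - c • v)) (Metric.ball 0 |1|) := by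
        have : DifferentiableOn ℂ (fun c : ℂ => G (x - c • v)) (closure (Metric.ball 0 |1|)) := by
          intro c hc
          have hc' : ‖c‖ ≤ 1 := by
            have := Metric.closure_ball_subset_closedBall hc
            simpa using this
          have h1 := (hG _ (hmem hc' hv)).differentiableAt (hU.mem_nhds (hmem hc' hv))
          have h2 : DifferentiableAt ℂ (fun c : ℂ => x - c • v) c := by fun_prop
          exact (DifferentiableAt.comp c h1 h2).differentiableWithinAt
        exact this.diffContOnCl
      have := hd.circleAverage
      rw [Real.circleAverage_def] at this
      simp only [zero_smul, sub_zero] at this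
      rw [← this, Complex.real_smul]
      have : (Real.pi : ℂ) ≠ 0 := by exact_mod_cast Real.pi_pos.ne'
      push_cast
      field_simp
    · simp [z0 _ v hv, h.supp v hv.le]
  rw [lhs] at swap
  simp_rw [rhs] at swap
  rw [integral_const_mul, integral_const_mul, integral_complex_ofReal, h.int] at swap
  have hpi : (Real.pi : ℂ) ≠ 0 := by exact_mod_cast Real.pi_pos.ne'
  have h2pi : (2 * (Real.pi : ℂ)) ≠ 0 := by simp [hpi]
  have := mul_left_cancel₀ h2pi swap
  simpa using this

/-- vanishing of all `∂bar` derivatives gives holomorphy -/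
lemma holo_of_dzb (b : Module.Basis ι ℂ E) {f : E → ℂ} {x : E} (hf : DifferentiableAt ℝ f x)
    (h0 : ∀ j, dzb (b j) f x = 0) : DifferentiableAt ℂ f x := by
  have hI : ∀ j, fderiv ℝ f x (I • b j) = I * fderiv ℝ f x (b j) := by
    intro j
    have := h0 j
    simp only [dzb] at this
    have h2 : fderiv ℝ f x (b j) + I * fderiv ℝ f x (I • b j) = 0 := by simpa using this
    linear_combination (-I) * h2 + (fderiv ℝ f x (I • b j)) * I_mul_I
  have hc : ∀ (j) (c : ℂ), fderiv ℝ f x (c • b j) = c * fderiv ℝ f x (b j) := by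
    intro j c
    have : c • b j = c.re • b j + c.im • (I • b j) := complex_smul c (b j)
    rw [this, map_add, map_smul, map_smul, hI, Complex.real_smul, Complex.real_smul]
    conv_rhs => rw [← Complex.re_add_im c]
    ring
  have : FiniteDimensional ℂ E := b.finiteDimensional_of_finite
  let l : E →ₗ[ℂ] ℂ := b.constr ℂ (fun j => fderiv ℝ f x (b j))
  have hl : ∀ v, l v = fderiv ℝ f x v := by
    intro v
    simp only [l, Module.Basis.constr_apply_fintype]
    conv_rhs => rw [← b.sum_repr v, map_sum]
    refine Finset.sum_congr rfl fun j _ => ?_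
    rw [hc]; simp
  have hd : HasFDerivAt f (LinearMap.toContinuousLinearMap l) x := by
    have h1 := hf.hasFDerivAt
    rw [hasFDerivAt_iff_isLittleO] at h1 ⊢
    refine h1.congr_left fun y => ?_
    simp [hl]
  exact hd.differentiableAt

lemma weyl_local (b : Module.Basis ι ℂ E) {f : E → ℂ} (hf : MemLp f 2 μ) {p : E} {r : ℝ} (hr : 0 < r)
    (hw : ∀ β, Tst (Metric.ball p (3 * r)) β → ∀ j, ∫ x, f x * dzb (b j) β x ∂μ = 0) :
    ∃ F : E → ℂ, DifferentiableOn ℂ F (Metric.ball p r) ∧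
      ∀ᵐ x ∂μ, x ∈ Metric.ball p r → f x = F x := by
  have sub : ∀ {x : E} {ε t : ℝ}, x ∈ Metric.ball p t → ε ≤ r → t ≤ 2 * r →
      Metric.closedBall x ε ⊆ Metric.ball p (3 * r) := by
    intro x ε t hx hε ht y hy
    rw [Metric.mem_ball] at hx ⊢
    rw [Metric.mem_closedBall] at hy
    calc dist y p ≤ dist y x + dist x p := dist_triangle _ _ _
      _ < 3 * r := by linarith
  have hol : ∀ {ε : ℝ} {η : E → ℝ}, Moll μ ε η → ε ≤ r →
      DifferentiableOn ℂ (sm μ η f) (Metric.ball p (2 * r)) := by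
    intro ε η h hε x hx
    refine (holo_of_dzb b (contDiff_diff (h.sm_smooth (memLp_loc hf)) x) fun j => ?_).differentiableWithinAt
    rw [h.dzb_sm (memLp_loc hf), hw _ (h.tst x (sub hx hε le_rfl)) j, neg_zero]
  obtain ⟨η0, hη0⟩ := exists_moll (μ := μ) b (half_pos hr)
  have hex : ∀ n : ℕ, ∃ η : E → ℝ, Moll μ (r / (n + 1)) η := fun n => exists_moll b (by positivity)
  choose η hη using hex
  have hle : ∀ n : ℕ, r / (n + 1) ≤ r := fun n => by
    apply div_le_self hr.le; linarith [(Nat.cast_nonneg n : (0:ℝ) ≤ n)]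
  have hlim : Tendsto (fun n : ℕ => r / (n + 1)) atTop (𝓝 0) := by
    have := tendsto_one_div_add_atTop_nhds_zero_nat (𝕜 := ℝ)
    have := this.const_mul r
    simpa [div_eq_mul_inv] using this
  have t2 := tendsto_sm hf hη hlim
  have mem : ∀ n, MemLp (sm μ (η n) f) 2 μ := fun n => (hη n).sm_memLp hf
  have tm := tendstoInMeasure_of_tendsto_eLpNorm (by norm_num) (fun n => (mem n).1) hf.1 t2
  obtain ⟨ns, hns, hae⟩ := tm.exists_seq_tendsto_ae
  refine ⟨sm μ η0 f, (hol hη0 (by linarith)).mono (Metric.ball_subset_ball (by linarith)), ?_⟩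
  filter_upwards [hae] with x hx hxb
  -- pointwise limit
  have ht := hη0.tst x (subset_univ _)
  have hlim2 := tendsto_int_mul hf (ht.conj'.memLp (μ := μ) 2) mem (fun n => ht.conj'.memLp 2) t2
    (by simp)
  simp only [Complex.conj_conj] at hlim2
  have e1 : ∀ n, ∫ t, sm μ (η n) f t * (η0 (x - t) : ℂ) ∂μ = sm μ (η n) f x := by
    intro n
    refine hη0.mean Metric.isOpen_ball (hol (hη n) (hle n)) ?_
    intro y hy
    rw [Metric.mem_ball] at hxb ⊢
    rw [Metric.mem_closedBall] at hy
    calc dist y p ≤ dist y x + dist x p := dist_triangle _ _ _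
      _ < 2 * r := by linarith
  simp_rw [e1] at hlim2
  exact tendsto_nhds_unique hx (hlim2.comp hns.tendsto_atTop)

end Weyl
end SteinAux

namespace SteinAux
open MeasureTheory Complex Filter
open scoped ContDiff ComplexConjugate

section WeylGlobal
variable {E : Type*} [NormedAddCommGroup E] [NormedSpace ℂ E] [NormedSpace ℝ E] [IsScalarTower ℝ ℂ E]
  [FiniteDimensional ℝ E] [MeasurableSpace E] [BorelSpace E] {μ : Measure E} [μ.IsAddHaarMeasure]
  {ι : Type*} [Fintype ι] {D : Set E}

lemma exists_bump (p : E) {r R : ℝ} (hr : 0 < r) (hR : r < R) :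
    ∃ θ : E → ℝ, ContDiff ℝ ∞ θ ∧ (∀ x ∈ Metric.closedBall p r, θ x = 1) ∧
      (∀ x, θ x ∈ Icc (0:ℝ) 1) ∧ tsupport θ ⊆ Metric.closedBall p R := by
  let f : ContDiffBump p := ⟨r, R, hr, hR⟩
  refine ⟨f, f.contDiff, fun x hx => f.one_of_mem_closedBall hx, fun x => ⟨f.nonneg, f.le_one⟩, ?_⟩
  rw [f.tsupport_eq]

lemma weyl (b : Module.Basis ι ℂ E) (hD : IsOpen D) {a f : E → ℂ} (ha : ContDiffOn ℝ ∞ a D)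
    (hf : MemLp f 2 μ)
    (hw : ∀ β, Tst D β → ∀ j, ∫ x, f x * (a x * dzb (b j) β x) ∂μ = 0) :
    ∃ h : E → ℂ, DifferentiableOn ℂ h D ∧ ∀ᵐ x ∂μ, x ∈ D → a x * f x = h x := by
  have : ProperSpace E := FiniteDimensional.proper_real E
  have loc : ∀ p : E, ∃ (r : ℝ) (F : E → ℂ), p ∈ D → 0 < r ∧ Metric.ball p r ⊆ D ∧
      DifferentiableOn ℂ F (Metric.ball p r) ∧
      ∀ᵐ x ∂μ, x ∈ Metric.ball p r → a x * f x = F x := by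
    intro p
    by_cases hp : p ∈ D
    swap
    · exact ⟨0, 0, fun h => absurd h hp⟩
    obtain ⟨R, hR, hRD⟩ := Metric.nhds_basis_closedBall.mem_iff.1 (hD.mem_nhds hp)
    set r := R / 4 with hr
    have hr0 : 0 < r := by positivity
    obtain ⟨θ, θs, θ1, -, θt⟩ := exists_bump p (r := 3 * r) (R := R) (by linarith) (by linarith)
    have hT0 : Tst D (fun x => (θ x : ℂ)) := by
      refine Tst.of_support (isCompact_closedBall p R) hRD hD (cx_smooth θs).contDiffOn ?_
      intro x hx
      have : θ x = 0 := by
        by_contra h0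
        exact hx (θt (subset_tsupport _ h0))
      simp [this]
    have hT := hT0.smul_on hD ha
    have hT2 := hT.mul_memLp hf
    have hb3 : Metric.ball p (3 * r) ⊆ D :=
      (Metric.ball_subset_closedBall.trans (Metric.closedBall_subset_closedBall (by linarith))).trans hRD
    obtain ⟨F, hF, hae⟩ := weyl_local b hT2 (p := p) hr0 (by
      intro β hβ j
      rw [← hw β (hβ.mono hb3) j]
      congr 1; ext x
      by_cases hx : x ∈ Metric.ball p (3 * r)
      · rw [θ1 x (Metric.ball_subset_closedBall hx)]; simp; ring
      · have : dzb (b j) β x = 0 := by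
          apply (hβ.dzb (b j)).eq_zero
          intro h
          exact hx ((hβ.dzb (b j)).sub h)
        simp [this])
    refine ⟨r, F, fun _ => ⟨hr0, (Metric.ball_subset_ball (by linarith)).trans hb3, hF, ?_⟩⟩
    filter_upwards [hae] with x hx hxr
    rw [← hx hxr, θ1 x (Metric.ball_subset_closedBall (Metric.ball_subset_ball (by linarith) hxr))]
    simp
  choose r F hrF using loc
  have cons : ∀ p ∈ D, ∀ y ∈ Metric.ball p (r p), F y y = F p y := by
    intro p hp y hy
    have hyD := (hrF p hp).2.1 hy
    have hy' : y ∈ Metric.ball y (r y) := Metric.mem_ball_self (hrF y hyD).1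
    have hO : IsOpen (Metric.ball y (r y) ∩ Metric.ball p (r p)) :=
      Metric.isOpen_ball.inter Metric.isOpen_ball
    refine Measure.eqOn_open_of_ae_eq (μ := μ) ?_ hO
      ((hrF y hyD).2.2.1.continuousOn.mono inter_subset_left)
      ((hrF p hp).2.2.1.continuousOn.mono inter_subset_right) ⟨hy', hy⟩
    rw [Filter.EventuallyEq, ae_restrict_iff' hO.measurableSet]
    filter_upwards [(hrF y hyD).2.2.2, (hrF p hp).2.2.2] with x h1 h2 hx
    rw [← h1 hx.1, ← h2 hx.2]
  refine ⟨fun y => F y y, ?_, ?_⟩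
  · intro p hp
    have hpb := Metric.isOpen_ball.mem_nhds (Metric.mem_ball_self (x := p) (hrF p hp).1)
    have h1 := ((hrF p hp).2.2.1 p (Metric.mem_ball_self (hrF p hp).1)).differentiableAt hpb
    refine (h1.congr_of_eventuallyEq ?_).differentiableWithinAt
    filter_upwards [hpb] with y hy using cons p hp y hy
  · rw [ae_iff]
    refine measure_null_of_locally_null _ fun p hp => ?_
    simp only [mem_setOf_eq, Classical.not_imp] at hp
    refine ⟨_, mem_nhdsWithin_of_mem_nhds
      (Metric.isOpen_ball.mem_nhds (Metric.mem_ball_self (x := p) (hrF p hp.1).1)) |>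
        inter_mem self_mem_nhdsWithin, ?_⟩
    refine measure_mono_null ?_ (ae_iff.1 (hrF p hp.1).2.2.2)
    rintro x ⟨h1, h2⟩
    simp only [mem_setOf_eq, Classical.not_imp] at h1 ⊢
    refine ⟨h2, ?_⟩
    rw [← cons p hp.1 x h2]; exact h1.2

/-- local mean value estimate -/
lemma mean_est (b : Module.Basis ι ℂ E) {ε : ℝ} (hε : 0 < ε) : ∃ C : ℝ, 0 ≤ C ∧
    ∀ (U : Set E) (G : E → ℂ) (x : E), IsOpen U → DifferentiableOn ℂ G U → Metric.closedBall x ε ⊆ U →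
      ‖G x‖ ^ 2 ≤ C * ∫ t in Metric.closedBall x ε, ‖G t‖ ^ 2 ∂μ := by
  have : ProperSpace E := FiniteDimensional.proper_real E
  obtain ⟨η, h⟩ := exists_moll (μ := μ) b hε
  obtain ⟨C, hC⟩ := (h.smooth.continuous).bounded_above_of_compact_support h.cpt
  have hC0 : 0 ≤ C := (norm_nonneg _).trans (hC 0)
  refine ⟨C, hC0, fun U G x hU hG hx => ?_⟩
  have hcont : ContinuousOn G (Metric.closedBall x ε) := hG.continuousOn.mono hx
  have hms : MeasurableSet (Metric.closedBall x ε) := measurableSet_closedBall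
  have hmem : MemLp ((Metric.closedBall x ε).indicator G) 2 μ := by
    rw [memLp_indicator_iff_restrict hms]
    rw [memLp_two_iff_integrable_sq_norm
      (hcont.aestronglyMeasurable_of_isCompact (isCompact_closedBall _ _) hms)]
    exact ContinuousOn.integrableOn_compact (isCompact_closedBall _ _) (by fun_prop)
  have e1 : sm μ η ((Metric.closedBall x ε).indicator G) x = G x := by
    rw [← h.mean hU hG hx]
    unfold sm
    congr 1; ext t
    by_cases ht : t ∈ Metric.closedBall x ε
    · rw [indicator_of_mem ht]
    · have : η (x - t) = 0 := h.supp _ (by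
        rw [Metric.mem_closedBall, dist_comm, dist_eq_norm] at ht; linarith)
      simp [this]
  rw [← e1]
  refine (h.jensen hmem x).trans ?_
  rw [← integral_const_mul, ← integral_indicator hms]
  refine integral_mono_of_nonneg (Eventually.of_forall fun t => ?_) ?_ (Eventually.of_forall fun t => ?_)
  · exact mul_nonneg (by positivity) (h.nonneg _)
  · rw [integrable_indicator_iff hms]
    apply ContinuousOn.integrableOn_compact (isCompact_closedBall _ _)
    fun_prop
  · by_cases ht : t ∈ Metric.closedBall x ε
    · simp only [indicator_of_mem ht]
      rw [mul_comm]
      exact mul_le_mul_of_nonneg_right ((le_abs_self _).trans (hC _)) (by positivity)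
    · simp [indicator_of_notMem ht]

end WeylGlobal
end SteinAux

namespace SteinAux
open MeasureTheory Complex Filter
open scoped ContDiff ComplexConjugate

section LeviPoly
variable {E : Type*} [NormedAddCommGroup E] [NormedSpace ℂ E] [NormedSpace ℝ E] [IsScalarTower ℝ ℂ E]
  [FiniteDimensional ℝ E] [MeasurableSpace E] [BorelSpace E] {D : Set E}

lemma I_complex_smul (c : ℂ) (v : E) : I • (c • v) = c.re • (I • v) - c.im • v := by
  rw [complex_smul c v, smul_add, real_smul_comm, real_smul_comm, II_smul]
  simp [sub_eq_add_neg]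

/-- complex linear form with prescribed real part -/
lemma exists_lin (A : E →L[ℝ] ℝ) : ∃ l : E → ℂ, ContDiff ℂ ∞ l ∧ ∀ w, (l w).re = A w := by
  have : FiniteDimensional ℂ E := FiniteDimensional.right ℝ ℂ E
  let l : E →ₗ[ℂ] ℂ :=
    { toFun := fun w => (A w : ℂ) - I * A (I • w)
      map_add' := fun v w => by simp only [smul_add, map_add]; push_cast; ring
      map_smul' := fun c w => by
        simp only [I_complex_smul]
        rw [complex_smul c w]
        simp only [map_add, map_sub, map_smul, smul_eq_mul, RingHom.id_apply]
        push_cast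
        conv_rhs => rw [← Complex.re_add_im c]
        linear_combination ((c.im : ℂ) * A (I • w)) * I_mul_I }
  refine ⟨LinearMap.toContinuousLinearMap l, (LinearMap.toContinuousLinearMap l).contDiff, ?_⟩
  intro w
  simp [l]

lemma exists_quad (B : E →L[ℝ] E →L[ℝ] ℝ) : ∃ q : E → ℂ, ContDiff ℂ ∞ q ∧
    ∀ w, (q w).re = B w w - B (I • w) (I • w) := by
  have : FiniteDimensional ℂ E := FiniteDimensional.right ℝ ℂ E
  let T : E →ₗ[ℂ] E →ₗ[ℂ] ℂ := LinearMap.mk₂ ℂ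
    (fun v w => ((B v w : ℝ) : ℂ) - B (I • v) (I • w) - I * (B (I • v) w + B v (I • w)))
    (fun v v' w => by simp only [smul_add, map_add, ContinuousLinearMap.add_apply]; push_cast; ring)
    (fun c v w => by
        simp only [I_complex_smul]
        rw [complex_smul c v]
        simp only [map_add, map_sub, map_smul, smul_eq_mul, ContinuousLinearMap.add_apply,
          ContinuousLinearMap.sub_apply, ContinuousLinearMap.smul_apply]
        push_cast
        conv_rhs => rw [← Complex.re_add_im c]
        linear_combination ((c.im : ℂ) * (B (I • v) w + B v (I • w))) * I_mul_I)
    (fun v w w' => by simp only [smul_add, map_add]; push_cast; ring)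
    (fun c v w => by
        simp only [I_complex_smul]
        rw [complex_smul c w]
        simp only [map_add, map_sub, map_smul, smul_eq_mul]
        push_cast
        conv_rhs => rw [← Complex.re_add_im c]
        linear_combination ((c.im : ℂ) * (B (I • v) w + B v (I • w))) * I_mul_I)
  let T' : E →L[ℂ] E →L[ℂ] ℂ :=
    LinearMap.toContinuousLinearMap (LinearMap.toContinuousLinearMap.toLinearMap ∘ₗ T)
  refine ⟨fun w => T' w w, ?_, ?_⟩
  · fun_prop
  · intro w
    simp [T', T]

lemma taylor2 {ρ : E → ℝ} (hD : IsOpen D) (hρ : ContDiffOn ℝ ∞ ρ D) {p : E} (hp : p ∈ D) {ε : ℝ}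
    (hε : 0 < ε) : ∃ r > 0, Metric.closedBall p r ⊆ D ∧ ∀ q ∈ Metric.closedBall p r,
      |ρ q - ρ p - fderiv ℝ ρ p (q - p) - 1/2 * fderiv ℝ (fderiv ℝ ρ) p (q - p) (q - p)|
        ≤ ε * ‖q - p‖ ^ 2 := by
  have hat : ∀ x ∈ D, ContDiffAt ℝ ∞ ρ x := fun x hx => hρ.contDiffAt (hD.mem_nhds hx)
  have hd : DifferentiableAt ℝ (fderiv ℝ ρ) p :=
    ((hat p hp).fderiv_right (m := 1) (by norm_cast)).differentiableAt (by norm_num)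
  have hsym : ∀ v w, fderiv ℝ (fderiv ℝ ρ) p v w = fderiv ℝ (fderiv ℝ ρ) p w v := by
    have := (hat p hp).isSymmSndFDerivAt (by simp; exact ENat.LEInfty.out)
    exact fun v w => this v w
  set B := fderiv ℝ (fderiv ℝ ρ) p with hB
  have ho := (hasFDerivAt_iff_isLittleO.1 hd.hasFDerivAt).def hε
  obtain ⟨r, hr, hr2⟩ := Metric.nhds_basis_closedBall.mem_iff.1 (inter_mem ho (hD.mem_nhds hp))
  refine ⟨r, hr, fun x hx => (hr2 hx).2, fun q hq => ?_⟩
  let R : E → ℝ := fun x => ρ x - fderiv ℝ ρ p (x - p) - 1/2 * B (x - p) (x - p)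
  have hsub : Metric.closedBall p ‖q - p‖ ⊆ Metric.closedBall p r :=
    Metric.closedBall_subset_closedBall (by simpa [dist_eq_norm] using hq)
  have hder : ∀ x ∈ Metric.closedBall p ‖q - p‖, HasFDerivWithinAt R
      (fderiv ℝ ρ x - fderiv ℝ ρ p - B (x - p)) (Metric.closedBall p ‖q - p‖) x := by
    intro x hx
    have h1 := ((hat x (hr2 (hsub hx)).2).differentiableAt (by simp)).hasFDerivAt
    have hx1 : HasFDerivAt (fun x : E => x - p) (ContinuousLinearMap.id ℝ E) x :=
      (hasFDerivAt_id x).sub_const p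
    have h2 := (fderiv ℝ ρ p).hasFDerivAt.comp x hx1
    have h3 := ((B.hasFDerivAt.comp x hx1).clm_apply hx1).const_mul (1/2 : ℝ)
    refine HasFDerivAt.hasFDerivWithinAt ?_
    refine ((h1.sub h2).sub h3).congr_fderiv ?_
    refine ContinuousLinearMap.ext fun v => ?_
    simp [hsym v x, hsym v p]
    ring
  have hbd : ∀ x ∈ Metric.closedBall p ‖q - p‖,
      ‖fderiv ℝ ρ x - fderiv ℝ ρ p - B (x - p)‖ ≤ ε * ‖q - p‖ := by
    intro x hx
    refine (hr2 (hsub hx)).1.trans ?_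
    gcongr
    simpa [dist_eq_norm] using hx
  have := (convex_closedBall p ‖q - p‖).norm_image_sub_le_of_norm_hasFDerivWithin_le hder hbd
    (Metric.mem_closedBall_self (norm_nonneg _)) (y := q) (by simp [dist_eq_norm])
  simp only [R, Real.norm_eq_abs, sub_self, map_zero] at this
  convert this using 1
  · congr 1; ring
  · ring

lemma levi_poly {ρ : E → ℝ} (hD : IsOpen D) (hρ : ContDiffOn ℝ ∞ ρ D) {p : E} (hp : p ∈ D) {c : ℝ}
    (hc : 0 < c) (hl : ∀ v, c * ‖v‖ ^ 2 ≤ levi ρ p v) :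
    ∃ r > 0, Metric.closedBall p r ⊆ D ∧ ∃ h : E → ℂ, ContDiff ℂ ∞ h ∧ h p = 0 ∧
      ∀ q ∈ Metric.closedBall p r, 2 * (h q).re ≤ ρ q - ρ p - c / 8 * ‖q - p‖ ^ 2 := by
  obtain ⟨r, hr, hrD, ht⟩ := taylor2 hD hρ hp (ε := c / 8) (by positivity)
  obtain ⟨l, hl1, hl2⟩ := exists_lin (fderiv ℝ ρ p)
  obtain ⟨q, hq1, hq2⟩ := exists_quad (fderiv ℝ (fderiv ℝ ρ) p)
  let k : E → ℂ := fun w => (1/2 : ℝ) * l w + (1/8 : ℝ) * q w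
  have hk : ContDiff ℂ ∞ k := by fun_prop
  refine ⟨r, hr, hrD, fun x => k (x - p) - k 0, by fun_prop, by simp, fun x hx => ?_⟩
  have h1 := (abs_le.1 (ht x hx)).1
  have h2 := hl (x - p)
  unfold levi at h2
  have h3 : (k (x - p) - k 0).re = 1/2 * fderiv ℝ ρ p (x - p) + 1/8 *
     (fderiv ℝ (fderiv ℝ ρ) p (x - p) (x - p) - fderiv ℝ (fderiv ℝ ρ) p (I • (x - p)) (I • (x - p))) := by
    simp only [k, sub_re, add_re, re_ofReal_mul, hl2, hq2]
    simp
  rw [h3]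
  linarith

/-- Levi form of a composition `F ∘ ρ`. -/
lemma levi_comp {ρ : E → ℝ} (hD : IsOpen D) (hρ : ContDiffOn ℝ ∞ ρ D) {F F' : ℝ → ℝ} {F2 : ℝ} {x : E}
    (hx : x ∈ D) (hF : ∀ y ∈ D, HasDerivAt F (F' (ρ y)) (ρ y)) (hF' : HasDerivAt F' F2 (ρ x)) (v : E) :
    levi (fun y => F (ρ y)) x v =
      F2 * ((fderiv ℝ ρ x v) ^ 2 + (fderiv ℝ ρ x (I • v)) ^ 2) + F' (ρ x) * levi ρ x v := by
  have hat : ∀ x ∈ D, ContDiffAt ℝ ∞ ρ x := fun x hx => hρ.contDiffAt (hD.mem_nhds hx)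
  have hd : ∀ y ∈ D, HasFDerivAt ρ (fderiv ℝ ρ y) y := fun y hy =>
    ((hat y hy).differentiableAt (by simp)).hasFDerivAt
  have hd2 : HasFDerivAt (fderiv ℝ ρ) (fderiv ℝ (fderiv ℝ ρ) x) x :=
    (((hat x hx).fderiv_right (m := 1) (by norm_cast)).differentiableAt (by norm_num)).hasFDerivAt
  have e1 : fderiv ℝ (fun y => F (ρ y)) =ᶠ[𝓝 x] fun y => F' (ρ y) • fderiv ℝ ρ y := by
    filter_upwards [hD.mem_nhds hx] with y hy
    exact ((hF y hy).comp_hasFDerivAt y (hd y hy)).fderiv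
  have e2 := (hF'.comp_hasFDerivAt x (hd x hx)).smul hd2
  unfold levi
  rw [e1.fderiv_eq]
  have e3 : fderiv ℝ (fun y => F' (ρ y) • fderiv ℝ ρ y) x = _ := e2.fderiv
  rw [e3]
  simp
  ring

end LeviPoly
end SteinAux

namespace SteinAux
open MeasureTheory Complex Filter
open scoped ContDiff ComplexConjugate

section Peak
variable {E : Type*} [NormedAddCommGroup E] [NormedSpace ℂ E] [NormedSpace ℝ E] [IsScalarTower ℝ ℂ E]
  [FiniteDimensional ℝ E] [MeasurableSpace E] [BorelSpace E] {μ : Measure E} [μ.IsAddHaarMeasure]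
  {ι : Type*} [Fintype ι] {D : Set E}

/-- A bounded strictly plurisubharmonic exhaustion. -/
structure PS (D : Set E) (ρ : E → ℝ) (c C1 : ℝ) : Prop where
  op : IsOpen D
  sm : ContDiffOn ℝ ∞ ρ D
  lt : ∀ x ∈ D, ρ x < 1
  cpt : ∀ t, t < 1 → IsCompact {x | x ∈ D ∧ ρ x ≤ t}
  grad : ∀ x ∈ D, ‖fderiv ℝ ρ x‖ ≤ C1
  cpos : 0 < c
  psh : ∀ x ∈ D, ∀ v, c * ‖v‖ ^ 2 ≤ levi ρ x v

variable {ρ : E → ℝ} {c C1 : ℝ}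

lemma repr_bound (b : Module.Basis ι ℂ E) : ∃ C : ℝ, 0 ≤ C ∧ ∀ τ : ι → ℂ,
    ∑ j, ‖τ j‖ ^ 2 ≤ C * ‖∑ j, τ j • b j‖ ^ 2 := by
  have : FiniteDimensional ℂ E := FiniteDimensional.right ℝ ℂ E
  let l : ι → E →L[ℂ] ℂ := fun j => LinearMap.toContinuousLinearMap (b.coord j)
  refine ⟨∑ j, ‖l j‖ ^ 2, by positivity, fun τ => ?_⟩
  rw [Finset.sum_mul]
  refine Finset.sum_le_sum fun j _ => ?_
  have h1 : l j (∑ k, τ k • b k) = τ j := by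
    classical
    simp [l, Module.Basis.coord_apply, Finsupp.single_apply]
  have := (l j).le_opNorm (∑ k, τ k • b k)
  rw [h1] at this
  rw [← mul_pow]
  gcongr

def sOf (ρ : E → ℝ) (x : E) : ℝ := 1 - ρ x
def phiOf (ρ : E → ℝ) (B N : ℝ) (x : E) : ℝ := N * ρ x + B / (1 - ρ x)

lemma PS.ex (h : PS D ρ c C1) (B N : ℝ) : EX D (sOf ρ) (phiOf ρ B N) C1 where
  op := h.op
  hs := contDiffOn_const.sub h.sm
  hφ := (contDiffOn_const.mul h.sm).add (contDiffOn_const.div (contDiffOn_const.sub h.sm)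
    fun x hx => by have := h.lt x hx; linarith)
  pos := fun x hx => by have := h.lt x hx; unfold sOf; linarith
  ex := fun t ht => by
    convert h.cpt (1 - t) (by linarith) using 3
    unfold sOf; apply and_congr_right; intro _; constructor <;> intro _ <;> linarith
  grad := fun x hx => by
    have : fderiv ℝ (sOf ρ) x = - fderiv ℝ ρ x := by
      unfold sOf; rw [fderiv_const_sub]
    rw [this, norm_neg]; exact h.grad x hx

lemma PS.curv (b : Module.Basis ι ℂ E) (h : PS D ρ c C1) : ∃ B : ℝ, 0 ≤ B ∧ ∀ N : ℝ, 0 ≤ N →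
    ∀ x ∈ D, ∀ τ : ι → ℂ,
      (12 * (∑ j, ‖dz (b j) (cx (sOf ρ)) x‖ ^ 2) / sOf ρ x ^ 2 + 1 / sOf ρ x ^ 2) * ∑ j, ‖τ j‖ ^ 2
        ≤ levi (phiOf ρ B N) x (∑ j, τ j • b j) / 4 := by
  obtain ⟨Cb, hCb0, hCb⟩ := repr_bound b
  set M := 12 * (∑ j, (C1 * ‖b j‖) ^ 2) + 1 with hM
  have hM0 : 0 ≤ M := by positivity
  have hc := h.cpos
  refine ⟨4 * M * Cb / c, by positivity, fun N hN x hx τ => ?_⟩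
  set B := 4 * M * Cb / c with hB
  have hB0 : 0 ≤ B := by positivity
  set v := ∑ j, τ j • b j with hv
  have hs : 0 < 1 - ρ x := by have := h.lt x hx; linarith
  have hlev := levi_comp h.op h.sm (F := fun t => N * t + B / (1 - t))
    (F' := fun t => N + B / (1 - t) ^ 2) (F2 := 2 * B / (1 - ρ x) ^ 3) hx ?_ ?_ v
  rotate_left
  · intro y hy
    have hy : 1 - ρ y ≠ 0 := by have := h.lt y hy; linarith
    have := ((hasDerivAt_id (ρ y)).const_mul N).add
      ((hasDerivAt_const (ρ y) B).div ((hasDerivAt_const (ρ y) (1:ℝ)).sub (hasDerivAt_id (ρ y))) hy)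
    refine this.congr_deriv ?_
    simp
  · have hy : 1 - ρ x ≠ 0 := hs.ne'
    have := ((hasDerivAt_const (ρ x) N)).add
      ((hasDerivAt_const (ρ x) B).div (((hasDerivAt_const (ρ x) (1:ℝ)).sub (hasDerivAt_id (ρ x))).pow 2)
        (pow_ne_zero 2 hy))
    refine this.congr_deriv ?_
    simp
    field_simp
  have hl0 : c * ‖v‖ ^ 2 ≤ levi ρ x v := h.psh x hx v
  have e1 : levi (phiOf ρ B N) x v = levi (fun y => N * ρ y + B / (1 - ρ y)) x v := rfl
  rw [e1, hlev]
  have hz : ∀ j, ‖dz (b j) (cx (sOf ρ)) x‖ ^ 2 ≤ (C1 * ‖b j‖) ^ 2 := by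
    intro j
    gcongr
    apply dz_norm_le
    intro w
    have hE := h.ex 0 0
    rw [fderiv_cx (hE.ds hx), Complex.norm_real]
    exact (fderiv ℝ (sOf ρ) x).le_of_opNorm_le (hE.grad x hx) w
  have h1 : 12 * (∑ j, ‖dz (b j) (cx (sOf ρ)) x‖ ^ 2) / sOf ρ x ^ 2 + 1 / sOf ρ x ^ 2
      ≤ M / (1 - ρ x) ^ 2 := by
    rw [← add_div]
    change _ ≤ M / sOf ρ x ^ 2
    have := Finset.sum_le_sum fun j (_ : j ∈ Finset.univ) => hz j
    refine div_le_div_of_nonneg_right ?_ (by positivity)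
    linarith
  calc _ ≤ M / (1 - ρ x) ^ 2 * (Cb * ‖v‖ ^ 2) := by
        gcongr
        exact hCb τ
    _ = (B / (1 - ρ x) ^ 2 * (c * ‖v‖ ^ 2)) / 4 := by
        rw [hB]; field_simp
    _ ≤ _ := by
        gcongr
        have a1 : 0 ≤ 2 * B / (1 - ρ x) ^ 3 * ((fderiv ℝ ρ x v) ^ 2 + (fderiv ℝ ρ x (I • v)) ^ 2) := by
          positivity
        have a2 : B / (1 - ρ x) ^ 2 * (c * ‖v‖ ^ 2) ≤ (N + B / (1 - ρ x) ^ 2) * levi ρ x v := by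
          gcongr
          linarith
        linarith

end Peak
end SteinAux

namespace SteinAux
open MeasureTheory Complex Filter
open scoped ContDiff ComplexConjugate

section Peak2
variable {E : Type*} [NormedAddCommGroup E] [NormedSpace ℂ E] [NormedSpace ℝ E] [IsScalarTower ℝ ℂ E]
  [FiniteDimensional ℝ E] [MeasurableSpace E] [BorelSpace E] {μ : Measure E} [μ.IsAddHaarMeasure]
  {ι : Type*} [Fintype ι] {D : Set E} {ρ : E → ℝ} {c C1 : ℝ}

lemma dzb_holo {f : E → ℂ} {x : E} (hf : DifferentiableAt ℂ f x) (v : E) : dzb v f x = 0 := by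
  have h1 : HasFDerivAt f ((fderiv ℂ f x).restrictScalars ℝ) x := hf.hasFDerivAt.restrictScalars ℝ
  unfold dzb
  rw [h1.fderiv]
  simp only [ContinuousLinearMap.coe_restrictScalars', map_smul, smul_eq_mul]
  rw [← mul_assoc, I_mul_I]
  simp

lemma PS.approx (b : Module.Basis ι ℂ E) (h : PS D ρ c C1) {p : E} (hp : p ∈ D) :
    ∃ t, ρ p < t ∧ t < 1 ∧ ∃ r > 0, Metric.closedBall p r ⊆ D ∧ ∃ (k : E → ℂ) (θ : E → ℝ),
      Differentiable ℂ k ∧ k p = 0 ∧ (∀ q ∈ Metric.closedBall p r, 2 * (k q).re ≤ ρ q - ρ p) ∧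
      Continuous θ ∧ (∀ x, θ x ∈ Icc (0:ℝ) 1) ∧ (∀ x ∈ Metric.closedBall p (r / 2), θ x = 1) ∧
      (∀ x, x ∉ Metric.closedBall p r → θ x = 0) ∧
      ∃ A κ : ℝ, 0 ≤ A ∧ 0 < κ ∧ ∀ N : ℕ, ∃ H u : E → ℂ, DifferentiableOn ℂ H D ∧
        IntegrableOn (fun x => ‖u x‖ ^ 2) {x | x ∈ D ∧ ρ x ≤ t} μ ∧
        ∫ x in {x | x ∈ D ∧ ρ x ≤ t}, ‖u x‖ ^ 2 ∂μ ≤ A * Real.exp (-κ * N) ∧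
        ∀ᵐ x ∂μ, x ∈ D → H x = θ x * cexp (N * k x) - u x := by
  have : ProperSpace E := FiniteDimensional.proper_real E
  have hc := h.cpos
  obtain ⟨r, hr, hrD, k, hk, hkp, hre⟩ := levi_poly h.op h.sm hp h.cpos (h.psh p hp)
  obtain ⟨θ, θs, θ1, θI, θt⟩ := exists_bump p (r := r / 2) (R := r) (by linarith) (by linarith)
  have θ0 : ∀ x, x ∉ Metric.closedBall p r → θ x = 0 := by
    intro x hx
    by_contra h0
    exact hx (θt (subset_tsupport _ h0))
  have hp1 := h.lt p hp
  set c0 := min (c / 8 * (r / 2) ^ 2) (1 - ρ p) with hc0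
  have hc0p : 0 < c0 := lt_min (by positivity) (by linarith)
  have hc0a : c0 ≤ c / 8 * (r / 2) ^ 2 := min_le_left _ _
  have hc0b : c0 ≤ 1 - ρ p := min_le_right _ _
  obtain ⟨B, hB0, hcurv⟩ := h.curv b
  set t := ρ p + c0 / 2 with ht
  have ht1 : t < 1 := by linarith
  set Kt := {x | x ∈ D ∧ ρ x ≤ t} with hKt
  have hKc : IsCompact Kt := h.cpt t ht1
  have hρc : ContinuousOn ρ D := h.sm.continuousOn
  have hT0 : Tst D (fun x => (θ x : ℂ)) :=
    Tst.of_support (isCompact_closedBall p r) hrD h.op (cx_smooth θs).contDiffOn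
      fun x hx => by simp [θ0 x hx]
  have hpos : ∀ x ∈ D, 0 < 1 - ρ x := fun x hx => by have := h.lt x hx; linarith
  -- constants
  obtain ⟨Cs, hCs⟩ := (isCompact_closedBall p r).exists_bound_of_continuousOn
    (f := fun x => ((1 - ρ x)⁻¹) ^ 2)
    (((continuousOn_const.sub hρc).inv₀ fun x hx => (hpos x hx).ne').pow 2 |>.mono hrD)
  obtain ⟨C2, hC2⟩ := hKc.exists_bound_of_continuousOn
    (f := fun x => (1 - ρ x) ^ 4 * Real.exp (B / (1 - ρ x)))
    (by
      have h1 : ContinuousOn (fun x => 1 - ρ x) Kt := continuousOn_const.sub (hρc.mono fun x hx => hx.1)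
      refine (h1.pow 4).mul (Real.continuous_exp.comp_continuousOn
        (continuousOn_const.div h1 fun x hx => (hpos x hx.1).ne')))
  have hCs0 : 0 ≤ Cs := (norm_nonneg _).trans (hCs p (Metric.mem_closedBall_self hr.le))
  have hC20 : 0 ≤ C2 := (norm_nonneg _).trans (hC2 p ⟨hp, by linarith⟩)
  have hCθ := fun j => (hT0.dzb (b j)).bdd
  choose Cθ hCθ using hCθ
  set vol := μ.real (Metric.closedBall p r) with hvol
  set A1 := 3 * ∑ j, Cs * Cθ j ^ 2 * vol with hA1
  have hA10 : 0 ≤ A1 := by positivity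
  refine ⟨t, by linarith, ht1, r, hr, hrD, k, θ, hk.differentiable (by simp), hkp, ?_, θs.continuous, θI,
    θ1, θ0, C2 * A1, c0 / 2, by positivity, by positivity, fun N => ?_⟩
  · intro q hq
    have := hre q hq
    have h2 : 0 ≤ c / 8 * ‖q - p‖ ^ 2 := by positivity
    linarith
  have hek : ContDiff ℂ ∞ (fun x => cexp (N * k x)) := (contDiff_const.mul hk).cexp
  have hg : Tst D (fun x => (θ x : ℂ) * cexp (N * k x)) := by
    have := hT0.mul_smooth (hek.restrict_scalars ℝ)
    simpa [mul_comm] using this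
  obtain ⟨u, hu, hest, horth⟩ := exist_dbar (μ := μ) b b (h.ex B N) (hcurv N (by positivity)) hg
  have hE := h.ex B N
  have hF : MemLp (fun x => sg1 (sOf ρ) (phiOf ρ B N) x * ((θ x : ℂ) * cexp (N * k x)) - u x) 2 μ := by
    have h1 := (hg.smul_on h.op hE.sg1s).memLp (μ := μ) 2
    refine MemLp.sub ?_ hu
    simpa [mul_comm] using h1
  obtain ⟨H, hH, hHae⟩ := weyl b h.op hE.i1s hF horth
  have hi1 : ∀ x, ‖i1 (sOf ρ) (phiOf ρ B N) x‖ ^ 2 =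
      (1 - ρ x) ^ 4 * Real.exp (B / (1 - ρ x)) * Real.exp (N * ρ x) := by
    intro x
    unfold i1
    rw [Complex.norm_real, Real.norm_eq_abs, sq_abs, mul_pow, ← Real.exp_nat_mul, mul_assoc, ← Real.exp_add]
    unfold sOf phiOf
    congr 1
    · ring
    · congr 1; push_cast; ring
  have hu2 := memLp_sq hu
  have hbd : ∀ x ∈ Kt, ‖i1 (sOf ρ) (phiOf ρ B N) x * u x‖ ^ 2 ≤ C2 * Real.exp (N * t) * ‖u x‖ ^ 2 := by
    intro x hx
    rw [norm_mul, mul_pow, hi1]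
    gcongr
    · exact (le_abs_self _).trans (hC2 x hx)
    · exact hx.2
  have hKm : MeasurableSet Kt := hKc.isClosed.measurableSet
  have hintg : IntegrableOn (fun x => ‖i1 (sOf ρ) (phiOf ρ B N) x * u x‖ ^ 2) Kt μ := by
    refine Integrable.mono' ((hu2.const_mul (C2 * Real.exp (N * t))).integrableOn (s := Kt)) ?_ ?_
    · have h1 : AEStronglyMeasurable (i1 (sOf ρ) (phiOf ρ B N)) (μ.restrict Kt) :=
        (hE.i1s.continuousOn.mono fun x hx => hx.1).aestronglyMeasurable hKm
      exact ((h1.mul hu.1.restrict).norm).pow 2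
    · rw [ae_restrict_iff' hKm]
      refine Eventually.of_forall fun x hx => ?_
      rw [Real.norm_eq_abs, abs_of_nonneg (by positivity)]
      exact hbd x hx
  refine ⟨H, fun x => i1 (sOf ρ) (phiOf ρ B N) x * u x, hH, hintg, ?_, ?_⟩
  · have hj : ∀ j, ∫ x, ‖sg2 (sOf ρ) (phiOf ρ B N) x *
        dzb (b j) (fun x => (θ x : ℂ) * cexp (N * k x)) x‖ ^ 2 ∂μ
        ≤ Cs * Cθ j ^ 2 * vol * Real.exp (-N * (ρ p + c0)) := by
      intro j
      have hle : ∀ x, ‖sg2 (sOf ρ) (phiOf ρ B N) x *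
        dzb (b j) (fun x => (θ x : ℂ) * cexp (N * k x)) x‖ ^ 2 ≤
        (Metric.closedBall p r).indicator (fun _ => Cs * Cθ j ^ 2 * Real.exp (-N * (ρ p + c0))) x := by
        intro x
        have hdz : dzb (b j) (fun x => (θ x : ℂ) * cexp (N * k x)) x
            = dzb (b j) (fun x => (θ x : ℂ)) x * cexp (N * k x) := by
          rw [dzb_mul (hT0.diff x) (contDiff_diff (hek.restrict_scalars ℝ) x),
            dzb_holo (hek.differentiable (by simp) x)]
          ring
        rw [hdz]
        by_cases hx : x ∈ Metric.closedBall p r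
        · rw [indicator_of_mem hx]
          have hxD := hrD hx
          rcases lt_or_ge (dist x p) (r / 2) with h1 | h1
          · have : dzb (b j) (fun x => (θ x : ℂ)) x = 0 := by
              have e : (fun x => (θ x : ℂ)) =ᶠ[𝓝 x] fun _ => (1:ℂ) := by
                filter_upwards [Metric.isOpen_ball.mem_nhds (Metric.mem_ball.2 h1)] with y hy
                rw [θ1 y (Metric.ball_subset_closedBall hy)]; simp
              rw [dzb_congr e]
              exact dzb_holo (differentiableAt_const _) _
            rw [this]
            simp
            positivity
          · have e1 : ‖sg2 (sOf ρ) (phiOf ρ B N) x‖ ^ 2 ≤ Cs * Real.exp (-(N * ρ x)) := by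
              unfold sg2
              rw [Complex.norm_real, Real.norm_eq_abs, sq_abs, mul_pow, ← Real.exp_nat_mul]
              unfold sOf phiOf
              gcongr
              · exact (le_abs_self _).trans (hCs x hx)
              · have : 0 ≤ B / (1 - ρ x) := div_nonneg hB0 (hpos x hxD).le
                push_cast
                linarith
            have e2 : ‖cexp (N * k x)‖ ^ 2 ≤ Real.exp (N * (ρ x - ρ p - c0)) := by
              rw [Complex.norm_exp, ← Real.exp_nat_mul]
              apply Real.exp_le_exp.2
              have h3 := hre x hx
              have h4 : c / 8 * (r / 2) ^ 2 ≤ c / 8 * ‖x - p‖ ^ 2 := by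
                rw [dist_eq_norm] at h1; gcongr
              have h5 : ((N : ℂ) * k x).re = N * (k x).re := by simp
              rw [h5]
              have : (N : ℝ) * (2 * (k x).re) ≤ N * (ρ x - ρ p - c0) := by
                gcongr; linarith
              push_cast
              linarith
            calc _ = ‖sg2 (sOf ρ) (phiOf ρ B N) x‖ ^ 2 * (‖dzb (b j) (fun x => (θ x : ℂ)) x‖ ^ 2 *
                    ‖cexp (N * k x)‖ ^ 2) := by rw [norm_mul, norm_mul]; ring
              _ ≤ (Cs * Real.exp (-(N * ρ x))) * (Cθ j ^ 2 * Real.exp (N * (ρ x - ρ p - c0))) := by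
                  gcongr
                  exact hCθ j x
              _ = Cs * Cθ j ^ 2 * (Real.exp (-(N * ρ x)) * Real.exp (N * (ρ x - ρ p - c0))) := by ring
              _ = _ := by rw [← Real.exp_add]; congr 2; ring
        · rw [indicator_of_notMem hx]
          have : dzb (b j) (fun x => (θ x : ℂ)) x = 0 := by
            apply (hT0.dzb (b j)).eq_zero
            intro h1
            apply hx
            have h2 := support_dzb _ _ h1
            refine closure_minimal (fun y hy => ?_) Metric.isClosed_closedBall h2
            by_contra h3
            exact hy (by simp [θ0 y h3])
          rw [this]; simp
      refine (integral_mono_of_nonneg (Eventually.of_forall fun x => by positivity) ?_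
        (Eventually.of_forall hle)).trans ?_
      · rw [integrable_indicator_iff measurableSet_closedBall]
        exact integrableOn_const (measure_closedBall_lt_top.ne)
      · rw [integral_indicator measurableSet_closedBall, setIntegral_const, smul_eq_mul]
        apply le_of_eq; ring
    have hu3 : ∫ x, ‖u x‖ ^ 2 ∂μ ≤ A1 * Real.exp (-N * (ρ p + c0)) := by
      refine hest.trans ?_
      rw [hA1, mul_assoc, Finset.sum_mul]
      gcongr with j
      exact hj j
    calc _ ≤ ∫ x in Kt, C2 * Real.exp (N * t) * ‖u x‖ ^ 2 ∂μ :=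
          setIntegral_mono_on hintg ((hu2.const_mul _).integrableOn) hKm hbd
      _ ≤ ∫ x, C2 * Real.exp (N * t) * ‖u x‖ ^ 2 ∂μ :=
          setIntegral_le_integral (hu2.const_mul _) (Eventually.of_forall fun x => by positivity)
      _ = C2 * Real.exp (N * t) * ∫ x, ‖u x‖ ^ 2 ∂μ := integral_const_mul _ _
      _ ≤ C2 * Real.exp (N * t) * (A1 * Real.exp (-N * (ρ p + c0))) := by gcongr
      _ = C2 * A1 * (Real.exp (N * t) * Real.exp (-N * (ρ p + c0))) := by ring
      _ = _ := by rw [← Real.exp_add]; congr 2; rw [ht]; ring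
  · filter_upwards [hHae] with x hx hxD
    rw [← hx hxD, mul_sub, ← mul_assoc, mul_comm (i1 _ _ x), hE.sg1_i1 hxD, one_mul]

end Peak2
end SteinAux

namespace SteinAux
open MeasureTheory Complex Filter
open scoped ContDiff ComplexConjugate

section Peak3
variable {E : Type*} [NormedAddCommGroup E] [NormedSpace ℂ E] [NormedSpace ℝ E] [IsScalarTower ℝ ℂ E]
  [FiniteDimensional ℝ E] [MeasurableSpace E] [BorelSpace E] {μ : Measure E} [μ.IsAddHaarMeasure]
  {ι : Type*} [Fintype ι] {D : Set E} {ρ : E → ℝ} {c C1 : ℝ}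

lemma tendsto_exp_neg {κ : ℝ} (hκ : 0 < κ) :
    Tendsto (fun N : ℕ => Real.exp (-κ * N)) atTop (𝓝 0) := by
  refine Real.tendsto_exp_atBot.comp ?_
  exact (tendsto_natCast_atTop_atTop).const_mul_atTop_of_neg (by linarith)

include μ in
lemma PS.peak (b : Module.Basis ι ℂ E) (h : PS D ρ c C1) {K : Set E} (hK : IsCompact K) (hKD : K ⊆ D)
    {a : ℝ} (ha : ∀ x ∈ K, ρ x ≤ a) {p : E} (hp : p ∈ D) (hap : a < ρ p) :
    ∃ F : E → ℂ, DifferentiableOn ℂ F D ∧ 1 / 2 < ‖F p‖ ∧ ∀ x ∈ K, ‖F x‖ ≤ 1 / 4 := by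
  have : ProperSpace E := FiniteDimensional.proper_real E
  obtain ⟨t, hpt, ht1, r, hr, hrD, k, θ, hk, hkp, hre, θc, θI, θ1, θ0, A, κ, hA, hκ, hN⟩ :=
    h.approx (μ := μ) b hp
  have hρc : ContinuousOn ρ D := h.sm.continuousOn
  set Kt := {x | x ∈ D ∧ ρ x ≤ t} with hKt
  have hKm : MeasurableSet Kt := (h.cpt t ht1).isClosed.measurableSet
  set a' := (a + ρ p) / 2 with ha'
  have hW : IsOpen (D ∩ ρ ⁻¹' Iio a') := hρc.isOpen_inter_preimage h.op isOpen_Iio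
  have hKW : K ⊆ D ∩ ρ ⁻¹' Iio a' := fun x hx => ⟨hKD hx, by
    have := ha x hx; simp only [mem_preimage, mem_Iio]; linarith⟩
  obtain ⟨δ, hδ, hδW⟩ := hK.exists_cthickening_subset_open hW hKW
  have hW2 : IsOpen ((D ∩ ρ ⁻¹' Iio t) ∩ Metric.ball p (r / 2)) :=
    (hρc.isOpen_inter_preimage h.op isOpen_Iio).inter Metric.isOpen_ball
  obtain ⟨ε, hε, hεW⟩ := Metric.nhds_basis_closedBall.mem_iff.1
    (hW2.mem_nhds ⟨⟨hp, hpt⟩, Metric.mem_ball_self (half_pos hr)⟩)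
  obtain ⟨C3, hC30, hC3⟩ := mean_est (μ := μ) b hδ
  obtain ⟨C4, hC40, hC4⟩ := mean_est (μ := μ) b hε
  set vol := μ.real (Metric.closedBall p r) with hvol
  have l1 := ((tendsto_exp_neg hκ).const_mul (C4 * A))
  have l2 := (((tendsto_exp_neg (κ := ρ p - a') (by linarith)).const_mul (2 * vol)).add
    ((tendsto_exp_neg hκ).const_mul (2 * A))).const_mul C3
  simp only [mul_zero, add_zero] at l1 l2
  obtain ⟨N, hN1, hN2⟩ := ((l1.eventually (gt_mem_nhds (show (0:ℝ) < 1/4 by norm_num))).and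
    (l2.eventually (gt_mem_nhds (show (0:ℝ) < 1/16 by norm_num)))).exists
  obtain ⟨H, u, hH, hui, hu, hae⟩ := hN N
  have sub_int : ∀ B ⊆ Kt, ∫ x in B, ‖u x‖ ^ 2 ∂μ ≤ A * Real.exp (-κ * N) := fun B hB =>
    (setIntegral_mono_set hui (Eventually.of_forall fun x => by positivity) hB.eventuallyLE).trans hu
  refine ⟨H, hH, ?_, ?_⟩
  · have hbD : Metric.ball p (r / 2) ⊆ D :=
      (Metric.ball_subset_closedBall.trans (Metric.closedBall_subset_closedBall (by linarith))).trans hrD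
    have := hC4 (Metric.ball p (r / 2)) (fun x => H x - cexp (N * k x)) p Metric.isOpen_ball
      ((hH.mono hbD).sub (by fun_prop)) (fun x hx => (hεW hx).2)
    have e1 : ∫ x in Metric.closedBall p ε, ‖H x - cexp (N * k x)‖ ^ 2 ∂μ
        = ∫ x in Metric.closedBall p ε, ‖u x‖ ^ 2 ∂μ := by
      refine setIntegral_congr_ae measurableSet_closedBall ?_
      filter_upwards [hae] with x hx hxe
      rw [hx (hεW hxe).1.1, θ1 x (Metric.ball_subset_closedBall (hεW hxe).2)]
      simp
    rw [e1] at this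
    have h2 := sub_int (Metric.closedBall p ε) (fun x hx => ⟨(hεW hx).1.1, (hεW hx).1.2.le⟩)
    have h3 : ‖H p - 1‖ ^ 2 < (1/2) ^ 2 := by
      have h4 : ‖H p - cexp (N * k p)‖ ^ 2 ≤ C4 * (A * Real.exp (-κ * N)) :=
        this.trans (by gcongr)
      rw [hkp, mul_zero, Complex.exp_zero] at h4
      rw [← mul_assoc] at h4
      have h7 : (1/2 : ℝ) ^ 2 = 1 / 4 := by norm_num
      rw [h7]
      linarith
    have h5 := lt_of_pow_lt_pow_left₀ 2 (by norm_num) h3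
    have h6 : ‖(1:ℂ)‖ ≤ ‖H p‖ + ‖H p - 1‖ := by
      have := norm_sub_le (H p) (H p - 1)
      simpa using this
    rw [norm_one] at h6
    linarith
  · intro x hx
    have hsub : Metric.closedBall x δ ⊆ D ∩ ρ ⁻¹' Iio a' :=
      (Metric.closedBall_subset_cthickening hx δ).trans hδW
    have hsub2 : Metric.closedBall x δ ⊆ Kt := fun y hy => ⟨(hsub hy).1, by
      have : ρ y < a' := (hsub hy).2
      linarith⟩
    have h1 := hC3 D H x h.op hH (fun y hy => (hsub hy).1)
    set ind := (Metric.closedBall p r).indicator (fun _ => Real.exp (-(ρ p - a') * N)) with hind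
    have hindi : Integrable ind μ := by
      rw [hind, integrable_indicator_iff measurableSet_closedBall]
      exact integrableOn_const (measure_closedBall_lt_top.ne)
    have hindint : ∫ y, ind y ∂μ = vol * Real.exp (-(ρ p - a') * N) := by
      rw [hind, integral_indicator measurableSet_closedBall, setIntegral_const, smul_eq_mul]
    have hind0 : ∀ y, 0 ≤ ind y := fun y => indicator_nonneg (fun _ _ => (Real.exp_pos _).le) y
    have hgind : ∀ y ∈ Metric.closedBall x δ, ‖(θ y : ℂ) * cexp (N * k y)‖ ^ 2 ≤ ind y := by
      intro y hy
      by_cases hyr : y ∈ Metric.closedBall p r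
      · rw [hind, indicator_of_mem hyr, norm_mul, mul_pow, Complex.norm_real, Complex.norm_exp,
          ← Real.exp_nat_mul]
        have h2 : ‖θ y‖ ^ 2 ≤ 1 := by
          rw [Real.norm_eq_abs, sq_abs]
          have := θI y
          exact pow_le_one₀ this.1 this.2
        have h3 : Real.exp ((2:ℕ) * ((N : ℂ) * k y).re) ≤ Real.exp (-(ρ p - a') * N) := by
          apply Real.exp_le_exp.2
          have h5 : ((N : ℂ) * k y).re = N * (k y).re := by simp
          rw [h5]
          have h6 : ρ y < a' := (hsub hy).2
          have h7 := hre y hyr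
          have : (N : ℝ) * (2 * (k y).re) ≤ N * (a' - ρ p) := by gcongr; linarith
          push_cast
          linarith
        calc _ ≤ 1 * Real.exp (-(ρ p - a') * N) := by gcongr
          _ = _ := one_mul _
      · simp [θ0 y hyr, hind0 y]
    have h2 : ∫ y in Metric.closedBall x δ, ‖H y‖ ^ 2 ∂μ ≤
        ∫ y in Metric.closedBall x δ, (2 * ind y + 2 * ‖u y‖ ^ 2) ∂μ := by
      refine setIntegral_mono_on_ae ?_ ?_ measurableSet_closedBall ?_
      · apply ContinuousOn.integrableOn_compact (isCompact_closedBall _ _)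
        have := hH.continuousOn.mono (s := D) (t := Metric.closedBall x δ) (fun y hy => (hsub hy).1)
        fun_prop
      · exact ((hindi.const_mul 2).integrableOn).add ((hui.mono_set hsub2).const_mul 2)
      · filter_upwards [hae] with y hy hyx
        rw [hy (hsub hyx).1]
        refine (two_sq _ _).trans ?_
        have := hgind y hyx
        linarith
    have h3 : ∫ y in Metric.closedBall x δ, (2 * ind y + 2 * ‖u y‖ ^ 2) ∂μ ≤
        2 * vol * Real.exp (-(ρ p - a') * N) + 2 * A * Real.exp (-κ * N) := by
      rw [integral_add (by exact (hindi.const_mul 2).integrableOn)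
        (by exact (hui.mono_set hsub2).const_mul 2), integral_const_mul, integral_const_mul]
      have e1 := setIntegral_le_integral (s := Metric.closedBall x δ) hindi (Eventually.of_forall hind0)
      rw [hindint] at e1
      have e2 := sub_int _ hsub2
      linarith
    have h4 : ‖H x‖ ^ 2 ≤ (1/4) ^ 2 := by
      calc _ ≤ _ := h1
        _ ≤ _ := mul_le_mul_of_nonneg_left (h2.trans h3) hC30
        _ ≤ _ := by norm_num at hN2 ⊢; linarith
    exact (pow_le_pow_iff_left₀ (norm_nonneg _) (by norm_num) (by norm_num)).1 h4

end Peak3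
end SteinAux

namespace SteinAux
open MeasureTheory Complex Filter
open scoped ContDiff ComplexConjugate

section SteinPsh

lemma hull_compact {E : Type*} [NormedAddCommGroup E] [NormedSpace ℂ E]
    {Ω K L : Set E} (hΩ : IsOpen Ω) (hL : IsCompact L) (hLΩ : L ⊆ Ω)
    (h : hullO Ω K ⊆ L) : IsCompact (hullO Ω K) := by
  refine hL.of_isClosed_subset (isClosed_of_closure_subset fun z hz => ?_) h
  have hzL : z ∈ L := closure_minimal h hL.isClosed hz
  refine ⟨hLΩ hzL, fun f hf => ?_⟩
  have hc : ContinuousAt (fun z => ‖f z‖) z :=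
    ((hf z (hLΩ hzL)).differentiableAt (hΩ.mem_nhds (hLΩ hzL))).continuousAt.norm
  obtain ⟨x, hx, hxz⟩ := mem_closure_iff_seq_limit.1 hz
  exact le_of_tendsto' (hc.tendsto.comp hxz) fun n => (hx n).2 f hf

lemma iSup_le_of {α : Type*} {K : Set α} {F : α → ℝ} {a : ℝ} (ha : 0 ≤ a) (h : ∀ x ∈ K, F x ≤ a) :
    ⨆ w ∈ K, F w ≤ a :=
  Real.iSup_le (fun w => Real.iSup_le (fun hw => h w hw) ha) ha

lemma hull_empty {E : Type*} [NormedAddCommGroup E] [NormedSpace ℂ E] (Ω : Set E) :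
    hullO Ω ∅ = ∅ := by
  rw [eq_empty_iff_forall_notMem]
  intro z hz
  have := hz.2 (fun _ => 1) (differentiableOn_const _)
  simp at this
  linarith

variable {E : Type*} [NormedAddCommGroup E] [NormedSpace ℂ E] [NormedSpace ℝ E] [IsScalarTower ℝ ℂ E]
  [FiniteDimensional ℝ E] [MeasurableSpace E] [BorelSpace E] {μ : Measure E} [μ.IsAddHaarMeasure]
  {ι : Type*} [Fintype ι] {D : Set E} {ρ : E → ℝ} {c C1 : ℝ}

include μ in
theorem PS.stein (b : Module.Basis ι ℂ E) (h : PS D ρ c C1) : IsSteinOpen D := by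
  refine ⟨h.op, fun K hKD hK => ?_⟩
  rcases K.eq_empty_or_nonempty with rfl | hne
  · rw [hull_empty]; exact isCompact_empty
  obtain ⟨x0, hx0, hmax⟩ := hK.exists_isMaxOn hne (h.sm.continuousOn.mono hKD)
  refine hull_compact h.op (h.cpt (ρ x0) (h.lt x0 (hKD hx0))) (fun x hx => hx.1) fun z hz => ⟨hz.1, ?_⟩
  by_contra hlt
  rw [not_le] at hlt
  obtain ⟨F, hF, hp, hFK⟩ := h.peak (μ := μ) b hK hKD (fun x hx => hmax hx) hz.1 hlt
  have h1 := hz.2 F hF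
  have h2 := iSup_le_of (F := fun w => ‖F w‖) (by norm_num) hFK
  linarith

end SteinPsh
end SteinAux

namespace SteinAux
open MeasureTheory Complex Filter
open scoped ContDiff ComplexConjugate

section LeviAlg
variable {E : Type*} [NormedAddCommGroup E] [NormedSpace ℂ E] [NormedSpace ℝ E]

lemma cd2_ev {f : E → ℝ} {x : E} (hf : ContDiffAt ℝ 2 f x) : ∀ᶠ y in 𝓝 x, DifferentiableAt ℝ f y := by
  filter_upwards [hf.eventually (by simp)] with y hy using hy.differentiableAt (by norm_num)

lemma cd2_d2 {f : E → ℝ} {x : E} (hf : ContDiffAt ℝ 2 f x) : DifferentiableAt ℝ (fderiv ℝ f) x :=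
  (hf.fderiv_right (m := 1) (by norm_num)).differentiableAt (by norm_num)

lemma levi_add {f g : E → ℝ} {x : E} (hf : ContDiffAt ℝ 2 f x) (hg : ContDiffAt ℝ 2 g x) (v : E) :
    levi (fun y => f y + g y) x v = levi f x v + levi g x v := by
  have e1 : fderiv ℝ (fun y => f y + g y) =ᶠ[𝓝 x] fun y => fderiv ℝ f y + fderiv ℝ g y := by
    filter_upwards [cd2_ev hf, cd2_ev hg] with y h1 h2 using fderiv_fun_add h1 h2
  unfold levi
  rw [e1.fderiv_eq, fderiv_fun_add (cd2_d2 hf) (cd2_d2 hg)]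
  simp; ring

lemma levi_const_mul {f : E → ℝ} {x : E} (hf : ContDiffAt ℝ 2 f x) (a : ℝ) (v : E) :
    levi (fun y => a * f y) x v = a * levi f x v := by
  have e1 : fderiv ℝ (fun y => a * f y) =ᶠ[𝓝 x] fun y => a • fderiv ℝ f y := by
    filter_upwards [cd2_ev hf] with y h1 using fderiv_const_mul h1 a
  unfold levi
  rw [e1.fderiv_eq, fderiv_fun_const_smul (cd2_d2 hf)]
  simp; ring

lemma levi_const (a : ℝ) (x v : E) : levi (fun _ => a) x v = 0 := by
  unfold levi
  have : fderiv ℝ (fun _ : E => a) = fun _ => 0 := by ext1 y; simp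
  rw [this]; simp

lemma levi_fsum {κ : Type*} (s : Finset κ) {f : κ → E → ℝ} {x : E}
    (hf : ∀ i ∈ s, ContDiffAt ℝ 2 (f i) x) (v : E) :
    levi (fun y => ∑ i ∈ s, f i y) x v = ∑ i ∈ s, levi (f i) x v := by
  classical
  induction s using Finset.induction_on with
  | empty => simp [levi_const]
  | insert a s ha ih =>
    simp_rw [Finset.sum_insert ha]
    rw [levi_add (hf a (Finset.mem_insert_self a s))
      (ContDiffAt.sum fun i hi => hf i (Finset.mem_insert_of_mem hi)),
      ih fun i hi => hf i (Finset.mem_insert_of_mem hi)]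

lemma levi_lin (l : E →L[ℝ] ℝ) (x v : E) : levi (fun y => l y) x v = 0 := by
  unfold levi
  have : fderiv ℝ (fun y : E => l y) = fun _ => l := by ext1 y; exact l.fderiv
  rw [this]; simp

lemma levi_sq {f : E → ℝ} {x : E} (hf : ContDiffAt ℝ 2 f x) (v : E) :
    levi (fun y => f y ^ 2) x v =
      2 * ((fderiv ℝ f x v) ^ 2 + (fderiv ℝ f x (I • v)) ^ 2) + 2 * f x * levi f x v := by
  have e1 : fderiv ℝ (fun y => f y ^ 2) =ᶠ[𝓝 x] fun y => (2 * f y) • fderiv ℝ f y := by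
    filter_upwards [cd2_ev hf] with y h1
    have := (h1.hasFDerivAt.pow 2).fderiv
    rw [this]; simp
  have h2 : HasFDerivAt (fun y => 2 * f y) ((2:ℝ) • fderiv ℝ f x) x :=
    (hf.differentiableAt (by norm_num)).hasFDerivAt.const_mul 2
  have h3 := h2.smul (cd2_d2 hf).hasFDerivAt
  have h4 : fderiv ℝ (fun y => (2 * f y) • fderiv ℝ f y) x = _ := h3.fderiv
  unfold levi
  rw [e1.fderiv_eq, h4]
  simp
  ring

lemma levi_lin_sq (l : E →L[ℝ] ℝ) (x v : E) :
    levi (fun y => l y ^ 2) x v = 2 * (l v ^ 2 + l (I • v) ^ 2) := by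
  rw [levi_sq (f := fun y => l y) (l.contDiff.contDiffAt), levi_lin]
  simp

lemma levi_slice {X Z : Type*} [NormedAddCommGroup X] [NormedSpace ℂ X] [NormedSpace ℝ X]
    [NormedAddCommGroup Z] [NormedSpace ℂ Z] [NormedSpace ℝ Z] {T : X × Z → ℝ} {ζ : X} {z : Z}
    (hT : ContDiffAt ℝ 2 T (ζ, z)) (w : Z) :
    levi (fun z' => T (ζ, z')) z w = levi T (ζ, z) (0, w) := by
  have hj : ∀ z' : Z, HasFDerivAt (fun z' : Z => (ζ, z')) (ContinuousLinearMap.inr ℝ X Z) z' :=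
    fun z' => hasFDerivAt_prodMk_right ζ z'
  have hc : Tendsto (fun z' : Z => (ζ, z')) (𝓝 z) (𝓝 (ζ, z)) := (hj z).continuousAt
  have e1 : fderiv ℝ (fun z' => T (ζ, z')) =ᶠ[𝓝 z]
      fun z' => (fderiv ℝ T (ζ, z')).comp (ContinuousLinearMap.inr ℝ X Z) := by
    filter_upwards [hc.eventually (cd2_ev hT)] with z' h1
    exact (h1.hasFDerivAt.comp z' (hj z')).fderiv
  have h2 : HasFDerivAt (fun z' => fderiv ℝ T (ζ, z'))
      ((fderiv ℝ (fderiv ℝ T) (ζ, z)).comp (ContinuousLinearMap.inr ℝ X Z)) z :=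
    (cd2_d2 hT).hasFDerivAt.comp z (hj z)
  have h3 := (h2.clm_comp (hasFDerivAt_const (ContinuousLinearMap.inr ℝ X Z) z)).fderiv
  unfold levi
  rw [e1.fderiv_eq, h3]
  simp

end LeviAlg

section Holo
variable {E : Type*} [NormedAddCommGroup E] [NormedSpace ℂ E] [NormedSpace ℝ E] [IsScalarTower ℝ ℂ E]
  [FiniteDimensional ℝ E] [MeasurableSpace E] [BorelSpace E] {μ : Measure E} [μ.IsAddHaarMeasure]
  {ι : Type*} [Fintype ι] {D : Set E}

include μ in
lemma holo_smooth (b : Module.Basis ι ℂ E) {g : E → ℂ} (hD : IsOpen D) (hg : DifferentiableOn ℂ g D) :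
    ContDiffOn ℝ ∞ g D := by
  have : ProperSpace E := FiniteDimensional.proper_real E
  intro x hx
  obtain ⟨R, hR, hRD⟩ := Metric.nhds_basis_closedBall.mem_iff.1 (hD.mem_nhds hx)
  obtain ⟨η, h⟩ := exists_moll (μ := μ) b (half_pos hR)
  have hmem : LocallyIntegrable ((Metric.closedBall x R).indicator g) μ := by
    apply Integrable.locallyIntegrable
    rw [integrable_indicator_iff measurableSet_closedBall]
    exact (hg.continuousOn.mono hRD).integrableOn_compact (isCompact_closedBall _ _)
  have hs := h.sm_smooth hmem
  refine ContDiffAt.contDiffWithinAt (hs.contDiffAt.congr_of_eventuallyEq ?_)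
  filter_upwards [Metric.ball_mem_nhds x (half_pos hR)] with y hy
  have hsub : Metric.closedBall y (R / 2) ⊆ Metric.closedBall x R := by
    apply Metric.closedBall_subset_closedBall'
    rw [Metric.mem_ball] at hy
    linarith
  rw [← h.mean hD hg (hsub.trans hRD)]
  unfold sm
  congr 1; ext t
  by_cases ht : t ∈ Metric.closedBall x R
  · rw [indicator_of_mem ht]
  · have : η (y - t) = 0 := h.supp _ (by
      have h2 : t ∉ Metric.closedBall y (R / 2) := fun h3 => ht (hsub h3)
      rw [Metric.mem_closedBall, dist_comm, dist_eq_norm] at h2; linarith)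
    simp [this]

include μ in
lemma levi_holo (b : Module.Basis ι ℂ E) {g : E → ℂ} (hD : IsOpen D) (hg : DifferentiableOn ℂ g D)
    {x : E} (hx : x ∈ D) (w : E) :
    levi (fun y => (g y).re) x w = 0 ∧ levi (fun y => (g y).im) x w = 0 := by
  have hs := (holo_smooth (μ := μ) b hD hg)
  have hat : ∀ y ∈ D, DifferentiableAt ℝ g y := fun y hy =>
    (hs.contDiffAt (hD.mem_nhds hy)).differentiableAt (by simp)
  have hI : ∀ y ∈ D, ∀ v, fderiv ℝ g y (I • v) = I * fderiv ℝ g y v := by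
    intro y hy v
    have hf := (hg y hy).differentiableAt (hD.mem_nhds hy)
    have h1 : HasFDerivAt g ((fderiv ℂ g y).restrictScalars ℝ) y := hf.hasFDerivAt.restrictScalars ℝ
    rw [h1.fderiv]
    simp
  have hd2 : DifferentiableAt ℝ (fderiv ℝ g) x :=
    ((hs.contDiffAt (hD.mem_nhds hx)).fderiv_right (m := 1) (by norm_cast)).differentiableAt (by norm_num)
  have hsym : ∀ v w, fderiv ℝ (fderiv ℝ g) x v w = fderiv ℝ (fderiv ℝ g) x w v := by
    have := (hs.contDiffAt (hD.mem_nhds hx)).isSymmSndFDerivAt (by simp; exact ENat.LEInfty.out)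
    exact fun v w => this v w
  have hap : ∀ u v, fderiv ℝ (fun y => fderiv ℝ g y v) x u = fderiv ℝ (fderiv ℝ g) x u v := by
    intro u v
    have := (hd2.hasFDerivAt.clm_apply (hasFDerivAt_const v x)).fderiv
    rw [this]; simp
  have hII : ∀ u v, fderiv ℝ (fderiv ℝ g) x u (I • v) = I * fderiv ℝ (fderiv ℝ g) x u v := by
    intro u v
    rw [← hap, ← hap]
    have e : (fun y => fderiv ℝ g y (I • v)) =ᶠ[𝓝 x] fun y => I * fderiv ℝ g y v := by
      filter_upwards [hD.mem_nhds hx] with y hy using hI y hy v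
    rw [e.fderiv_eq, fderiv_const_mul (hd2.clm_apply (differentiableAt_const v))]
    simp
  have key : fderiv ℝ (fderiv ℝ g) x w w + fderiv ℝ (fderiv ℝ g) x (I • w) (I • w) = 0 := by
    rw [hII, hsym (I • w) w, hII, ← mul_assoc, I_mul_I]; ring
  have gen : ∀ l : ℂ →L[ℝ] ℝ, levi (fun y => l (g y)) x w = 0 := by
    intro l
    have e1 : fderiv ℝ (fun y => l (g y)) =ᶠ[𝓝 x] fun y => l.comp (fderiv ℝ g y) := by
      filter_upwards [hD.mem_nhds hx] with y hy
      exact (l.hasFDerivAt.comp y (hat y hy).hasFDerivAt).fderiv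
    have h3 := ((hasFDerivAt_const l x).clm_comp hd2.hasFDerivAt).fderiv
    unfold levi
    rw [e1.fderiv_eq, h3]
    simp
    rw [← map_add, key, map_zero]
  exact ⟨gen reCLM, gen imCLM⟩

include μ in
lemma levi_normsq (b : Module.Basis ι ℂ E) {g : E → ℂ} (hD : IsOpen D) (hg : DifferentiableOn ℂ g D)
    {x : E} (hx : x ∈ D) (w : E) :
    0 ≤ levi (fun y => ‖g y‖ ^ 2) x w := by
  have hs := ((holo_smooth (μ := μ) b hD hg).contDiffAt (hD.mem_nhds hx)).of_le (n := ∞) (m := 2)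
    ENat.LEInfty.out
  have hre : ContDiffAt ℝ 2 (fun y => (g y).re) x := reCLM.contDiff.contDiffAt.comp x hs
  have him : ContDiffAt ℝ 2 (fun y => (g y).im) x := imCLM.contDiff.contDiffAt.comp x hs
  have e : (fun y => ‖g y‖ ^ 2) = fun y => (g y).re ^ 2 + (g y).im ^ 2 := by
    ext y; rw [Complex.sq_norm, Complex.normSq_apply]; ring
  obtain ⟨h1, h2⟩ := levi_holo (μ := μ) b hD hg hx w
  rw [e, levi_add (hre.pow 2) (him.pow 2), levi_sq hre, levi_sq him, h1, h2, mul_zero, mul_zero, add_zero, add_zero]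
  positivity

include μ in
lemma normsq_smooth (b : Module.Basis ι ℂ E) {g : E → ℂ} (hD : IsOpen D) (hg : DifferentiableOn ℂ g D) :
    ContDiffOn ℝ ∞ (fun y => ‖g y‖ ^ 2) D := by
  have hs := holo_smooth (μ := μ) b hD hg
  have e : (fun y => ‖g y‖ ^ 2) = fun y => (g y).re ^ 2 + (g y).im ^ 2 := by
    ext y; rw [Complex.sq_norm, Complex.normSq_apply]; ring
  rw [e]
  exact ((reCLM.contDiff.comp_contDiffOn hs).pow 2).add ((imCLM.contDiff.comp_contDiffOn hs).pow 2)

end Holo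
end SteinAux

namespace SteinAux
open MeasureTheory Complex Filter
open scoped ContDiff ComplexConjugate

section Local

lemma le_iSup_compact {Z : Type*} [TopologicalSpace Z] {K : Set Z} (hK : IsCompact K) {F : Z → ℝ}
    (hF : ContinuousOn F K) (h0 : ∀ z, 0 ≤ F z) {w : Z} (hw : w ∈ K) : F w ≤ ⨆ w ∈ K, F w := by
  obtain ⟨C, hC⟩ := hK.exists_bound_of_continuousOn hF
  have hC0 : 0 ≤ C := (norm_nonneg _).trans (hC w hw)
  have h1 : BddAbove (range fun w => ⨆ (_ : w ∈ K), F w) := by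
    refine ⟨C, ?_⟩
    rintro _ ⟨y, rfl⟩
    exact Real.iSup_le (fun hy => (le_abs_self _).trans (hC y hy)) hC0
  refine le_trans ?_ (le_ciSup h1 w)
  rw [ciSup_pos hw]

lemma iSup2_nonneg {Z : Type*} (K : Set Z) {F : Z → ℝ} (h0 : ∀ z, 0 ≤ F z) : 0 ≤ ⨆ w ∈ K, F w :=
  Real.iSup_nonneg fun w => Real.iSup_nonneg fun _ => h0 w

/-- tube lemma -/
lemma tube {X Z : Type*} [MetricSpace X] [TopologicalSpace Z] [T2Space Z] {K : Set (X × Z)} (hK : IsCompact K)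
    {G : Set Z} (hG : IsOpen G) {u : X} (h : ∀ z, (u, z) ∈ K → z ∈ G) :
    ∃ r > 0, ∀ x ∈ K, dist x.1 u ≤ r → x.2 ∈ G := by
  have hK' : IsCompact (K \ (univ ×ˢ G)) := hK.diff (isOpen_univ.prod hG)
  rcases (K \ (univ ×ˢ G)).eq_empty_or_nonempty with he | hne
  · refine ⟨1, one_pos, fun x hx _ => ?_⟩
    by_contra hx2
    exact (eq_empty_iff_forall_notMem.1 he) x ⟨hx, fun h => hx2 h.2⟩
  · obtain ⟨y, hy, hmin⟩ := hK'.exists_isMinOn hne (f := fun x => dist x.1 u)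
      (by fun_prop)
    have hpos : 0 < dist y.1 u := by
      rw [dist_pos]
      rintro rfl
      exact hy.2 ⟨mem_univ _, h _ hy.1⟩
    refine ⟨dist y.1 u / 2, by positivity, fun x hx hd => ?_⟩
    by_contra hx2
    have h1 : dist y.1 u ≤ dist x.1 u := hmin (⟨hx, fun h => hx2 h.2⟩ : x ∈ K \ (univ ×ˢ G))
    linarith

variable {X : Type*} [MetricSpace X]
variable {E : Type*} [NormedAddCommGroup E] [NormedSpace ℂ E] [NormedSpace ℝ E] [IsScalarTower ℝ ℂ E]
  [FiniteDimensional ℝ E] [MeasurableSpace E] [BorelSpace E] {μ : Measure E} [μ.IsAddHaarMeasure]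
  {ι : Type*} [Fintype ι]

include μ in
lemma local_psh (b : Module.Basis ι ℂ E) {S C L : Set (X × E)} (hS : IsCompact S) (hC : IsCompact C)
    (hL : IsCompact L) (hSC : S ⊆ C) (hLC : L ⊆ C) {u : X} {Ω : Set E} (hΩ : IsOpen Ω)
    (hCΩ : ∀ z, (u, z) ∈ C → z ∈ Ω)
    (hhull : ∀ z, (u, z) ∈ L → z ∉ hullO Ω (fiberOf S u)) :
    ∃ r > 0, (∀ x ∈ C, dist x.1 u ≤ r → x.2 ∈ Ω) ∧ ∀ η > 0, ∃ β : E → ℝ,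
      ContDiffOn ℝ ∞ β Ω ∧ (∀ z, 0 ≤ β z) ∧ (∀ z ∈ Ω, ∀ w, 0 ≤ levi β z w) ∧
      (∀ x ∈ S, dist x.1 u ≤ r → β x.2 < η) ∧ (∀ x ∈ L, dist x.1 u ≤ r → 1 ≤ β x.2) := by
  have hfib : ∀ {K : Set (X × E)}, IsCompact K → IsCompact (fiberOf K u) := by
    intro K hK
    have : fiberOf K u = Prod.snd '' (K ∩ ({u} ×ˢ univ)) := by
      ext z; simp [fiberOf]
    rw [this]
    exact (hK.inter_right (isClosed_singleton.prod isClosed_univ)).image continuous_snd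
  have hSu := hfib hS
  have hLu := hfib hL
  have hSuΩ : fiberOf S u ⊆ Ω := fun z hz => hCΩ z (hSC hz)
  have hLuΩ : fiberOf L u ⊆ Ω := fun z hz => hCΩ z (hLC hz)
  -- separating functions
  have sep : ∀ z, ∃ f : E → ℂ, DifferentiableOn ℂ f Ω ∧ (∀ w ∈ fiberOf S u, ‖f w‖ < 1) ∧
      (z ∈ fiberOf L u → 1 < ‖f z‖) := by
    intro z
    by_cases hz : z ∈ fiberOf L u
    swap
    · exact ⟨0, differentiableOn_const _, by simp, fun h => absurd h hz⟩
    have h1 := hhull z hz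
    simp only [hullO, mem_setOf_eq, not_and, not_forall, not_le] at h1
    obtain ⟨f, hf, hlt⟩ := h1 (hLuΩ hz)
    set s := ⨆ w ∈ fiberOf S u, ‖f w‖ with hs
    have hs0 : 0 ≤ s := iSup2_nonneg _ fun z => norm_nonneg _
    obtain ⟨α, ha1, ha2⟩ := exists_between hlt
    have hα : 0 < α := lt_of_le_of_lt hs0 ha1
    refine ⟨fun w => f w / α, by simp only [div_eq_mul_inv]; exact hf.mul_const _, fun w hw => ?_, fun _ => ?_⟩
    · have := le_iSup_compact hSu (F := fun w => ‖f w‖) (hf.continuousOn.mono hSuΩ).norm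
        (fun _ => norm_nonneg _) hw
      rw [norm_div, Complex.norm_real, Real.norm_eq_abs, abs_of_pos hα, div_lt_one hα]
      linarith
    · rw [norm_div, Complex.norm_real, Real.norm_eq_abs, abs_of_pos hα, one_lt_div hα]
      exact ha2
  choose f hf hf1 hf2 using sep
  have hopen : ∀ z, IsOpen (Ω ∩ (fun w => ‖f z w‖) ⁻¹' Ioi 1) := fun z =>
    (hf z).continuousOn.norm.isOpen_inter_preimage hΩ isOpen_Ioi
  have hopen2 : ∀ z, IsOpen (Ω ∩ (fun w => ‖f z w‖) ⁻¹' Iio 1) := fun z =>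
    (hf z).continuousOn.norm.isOpen_inter_preimage hΩ isOpen_Iio
  obtain ⟨t, ht⟩ := hLu.elim_finite_subcover (fun z => Ω ∩ (fun w => ‖f z w‖) ⁻¹' Ioi 1) hopen
    (fun z hz => mem_iUnion.2 ⟨z, hLuΩ hz, hf2 z hz⟩)
  obtain ⟨r1, hr1, h1⟩ := tube hC hΩ hCΩ
  obtain ⟨r2, hr2, h2⟩ := tube hL (G := ⋃ z ∈ t, Ω ∩ (fun w => ‖f z w‖) ⁻¹' Ioi 1)
    (isOpen_biUnion fun z _ => hopen z) (fun z hz => ht hz)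
  obtain ⟨r3, hr3, h3⟩ := tube hS (G := Ω ∩ ⋂ z ∈ t, Ω ∩ (fun w => ‖f z w‖) ⁻¹' Iio 1)
    (hΩ.inter (isOpen_biInter_finset fun z _ => hopen2 z))
    (fun z hz => ⟨hSuΩ hz, mem_iInter₂.2 fun w _ => ⟨hSuΩ hz, hf1 w z hz⟩⟩)
  set r := min r1 (min r2 r3) with hr
  have hrr1 : r ≤ r1 := min_le_left _ _
  have hrr2 : r ≤ r2 := (min_le_right _ _).trans (min_le_left _ _)
  have hrr3 : r ≤ r3 := (min_le_right _ _).trans (min_le_right _ _)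
  refine ⟨r, lt_min hr1 (lt_min hr2 hr3), fun x hx hd => h1 x hx (hd.trans hrr1), fun η hη => ?_⟩
  -- uniform bounds
  have hSr : IsCompact (S ∩ {x | dist x.1 u ≤ r}) :=
    hS.inter_right (isClosed_le (by fun_prop) continuous_const)
  have bd : ∀ z, ∃ q : ℝ, 0 ≤ q ∧ q < 1 ∧ (z ∈ t → ∀ x ∈ S, dist x.1 u ≤ r → ‖f z x.2‖ ^ 2 ≤ q) := by
    intro z
    by_cases hz : z ∈ t
    swap
    · exact ⟨0, le_rfl, one_pos, fun h => absurd h hz⟩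
    rcases (S ∩ {x | dist x.1 u ≤ r}).eq_empty_or_nonempty with he | hne
    · exact ⟨0, le_rfl, one_pos, fun _ x hx hd =>
        absurd (show x ∈ S ∩ {x | dist x.1 u ≤ r} from ⟨hx, hd⟩) (by simp [he])⟩
    have hm : MapsTo (fun x : X × E => x.2) (S ∩ {x | dist x.1 u ≤ r}) Ω := fun x hx =>
      (h3 x hx.1 (le_trans hx.2 hrr3)).1
    have hcont : ContinuousOn (fun x : X × E => ‖f z x.2‖ ^ 2) (S ∩ {x | dist x.1 u ≤ r}) :=
      (((hf z).continuousOn.comp continuous_snd.continuousOn hm).norm).pow 2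
    obtain ⟨y, hy, hmax⟩ := hSr.exists_isMaxOn hne hcont
    refine ⟨‖f z y.2‖ ^ 2, by positivity, ?_, fun _ x hx hd =>
      hmax (show x ∈ S ∩ {x | dist x.1 u ≤ r} from ⟨hx, hd⟩)⟩
    have := (mem_iInter₂.1 (h3 y hy.1 (le_trans hy.2 hrr3)).2 z hz).2
    exact pow_lt_one₀ (norm_nonneg _) this (by norm_num)
  choose q hq0 hq1 hq using bd
  have lim : Tendsto (fun N : ℕ => ∑ z ∈ t, q z ^ N) atTop (𝓝 (∑ z ∈ t, 0)) :=
    tendsto_finsetSum _ fun z _ => tendsto_pow_atTop_nhds_zero_of_lt_one (hq0 z) (hq1 z)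
  rw [Finset.sum_const_zero] at lim
  obtain ⟨N, hN⟩ := (lim.eventually (gt_mem_nhds hη)).exists
  have hg : ∀ z, DifferentiableOn ℂ (fun w => f z w ^ N) Ω := fun z => (hf z).pow N
  refine ⟨fun w => ∑ z ∈ t, ‖f z w ^ N‖ ^ 2, ?_, fun z => by positivity, fun w hw v => ?_, ?_, ?_⟩
  · exact ContDiffOn.sum fun z _ => normsq_smooth (μ := μ) b hΩ (hg z)
  · rw [levi_fsum t fun z _ => ((normsq_smooth (μ := μ) b hΩ (hg z)).contDiffAt (hΩ.mem_nhds hw)).of_le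
      ENat.LEInfty.out]
    exact Finset.sum_nonneg fun z _ => levi_normsq (μ := μ) b hΩ (hg z) hw v
  · intro x hx hd
    refine lt_of_le_of_lt (Finset.sum_le_sum fun z hz => ?_) hN
    rw [norm_pow, ← pow_mul, mul_comm N 2, pow_mul]
    exact pow_le_pow_left₀ (by positivity) (hq z hz x hx hd) N
  · intro x hx hd
    obtain ⟨z, hz, hz2⟩ := mem_iUnion₂.1 (h2 x hx (hd.trans hrr2))
    refine le_trans ?_ (Finset.single_le_sum (f := fun z => ‖f z x.2 ^ N‖ ^ 2)
      (fun z _ => by positivity) hz)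
    have h5 : 1 < ‖f z x.2‖ := hz2.2
    simp only [norm_pow]
    exact one_le_pow₀ (one_le_pow₀ h5.le)

end Local
end SteinAux

namespace SteinAux
open MeasureTheory Complex Filter
open scoped ContDiff ComplexConjugate


section Coord
variable {n m : ℕ}

/-- coordinate projections -/
def reC (i : Fin n) : EuclideanSpace ℂ (Fin n) →L[ℝ] ℝ :=
  Complex.reCLM.comp (PiLp.proj 2 (fun _ : Fin n => ℂ) i : EuclideanSpace ℂ (Fin n) →L[ℝ] ℂ)

def imC (i : Fin n) : EuclideanSpace ℂ (Fin n) →L[ℝ] ℝ :=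
  Complex.imCLM.comp (PiLp.proj 2 (fun _ : Fin n => ℂ) i : EuclideanSpace ℂ (Fin n) →L[ℝ] ℂ)

lemma reC_apply (i : Fin n) (x : EuclideanSpace ℂ (Fin n)) : reC i x = (x i).re := rfl
lemma imC_apply (i : Fin n) (x : EuclideanSpace ℂ (Fin n)) : imC i x = (x i).im := rfl

/-- the real part as a real linear map -/
def reX (n : ℕ) : EuclideanSpace ℂ (Fin n) →L[ℝ] EuclideanSpace ℂ (Fin n) :=
  LinearMap.toContinuousLinearMap
    { toFun := fun x => WithLp.toLp 2 (fun i => ((x i).re : ℂ))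
      map_add' := by intro x y; ext i; simp
      map_smul' := by intro a x; ext i; simp }

lemma reX_apply (x : EuclideanSpace ℂ (Fin n)) (i : Fin n) : reX n x i = ((x i).re : ℂ) := rfl

def sig (x : EuclideanSpace ℂ (Fin n)) : ℝ := ∑ i, (imC i x) ^ 2
def nsq (x : EuclideanSpace ℂ (Fin n)) : ℝ := ∑ i, ((reC i x) ^ 2 + (imC i x) ^ 2)

lemma sig_nonneg (x : EuclideanSpace ℂ (Fin n)) : 0 ≤ sig x := Finset.sum_nonneg fun i _ => sq_nonneg _
lemma nsq_nonneg (x : EuclideanSpace ℂ (Fin n)) : 0 ≤ nsq x := Finset.sum_nonneg fun i _ => by positivity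
lemma nsq_eq (x : EuclideanSpace ℂ (Fin n)) : nsq x = ‖x‖ ^ 2 := by
  rw [EuclideanSpace.norm_sq_eq]
  refine Finset.sum_congr rfl fun i _ => ?_
  rw [reC_apply, imC_apply, Complex.sq_norm, Complex.normSq_apply]; ring
lemma norm_split (x : EuclideanSpace ℂ (Fin n)) : ‖x‖ ^ 2 = ‖reX n x‖ ^ 2 + sig x := by
  rw [EuclideanSpace.norm_sq_eq, EuclideanSpace.norm_sq_eq, sig, ← Finset.sum_add_distrib]
  refine Finset.sum_congr rfl fun i _ => ?_
  rw [reX_apply, imC_apply, Complex.sq_norm, Complex.sq_norm, Complex.normSq_apply, Complex.normSq_apply]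
  simp; ring
lemma sig_smooth : ContDiff ℝ ∞ (sig (n := n)) := ContDiff.sum fun i _ => (imC i).contDiff.pow 2
lemma nsq_smooth : ContDiff ℝ ∞ (nsq (n := n)) :=
  ContDiff.sum fun i _ => ((reC i).contDiff.pow 2).add ((imC i).contDiff.pow 2)
lemma sig_real {x : EuclideanSpace ℂ (Fin n)} (hx : x ∈ realSlice n) : sig x = 0 := by
  refine Finset.sum_eq_zero fun i _ => ?_
  rw [imC_apply, hx i]; simp
lemma reX_real {x : EuclideanSpace ℂ (Fin n)} (hx : x ∈ realSlice n) : reX n x = x := by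
  ext i; rw [reX_apply]
  exact Complex.ext (by simp) (by simp [hx i])
lemma real_of_sig {x : EuclideanSpace ℂ (Fin n)} (hx : sig x = 0) : x ∈ realSlice n := by
  intro i
  have := (Finset.sum_eq_zero_iff_of_nonneg (fun i _ => sq_nonneg (imC i x))).1 hx i (Finset.mem_univ i)
  exact pow_eq_zero_iff (two_ne_zero) |>.1 this
lemma reX_mem (x : EuclideanSpace ℂ (Fin n)) : reX n x ∈ realSlice n := by
  intro i; rw [reX_apply]; simp
lemma isClosed_realSlice : IsClosed (realSlice n) := by
  have : realSlice n = ⋂ i, {x : EuclideanSpace ℂ (Fin n) | imC i x = 0} := by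
    ext x; simp [realSlice, imC_apply]
  rw [this]
  exact isClosed_iInter fun i => isClosed_eq (imC i).continuous continuous_const

def kap (x : EuclideanSpace ℂ (Fin n) × EuclideanSpace ℂ (Fin m)) :
    EuclideanSpace ℂ (Fin n) × EuclideanSpace ℂ (Fin m) := (reX n x.1, x.2)

lemma kap_cont : Continuous (kap (n := n) (m := m)) :=
  ((reX n).continuous.comp continuous_fst).prodMk continuous_snd

lemma tubeset_compact {C : Set (EuclideanSpace ℂ (Fin n) × EuclideanSpace ℂ (Fin m))} (hC : IsCompact C) (d : ℝ) :
    IsCompact {x : EuclideanSpace ℂ (Fin n) × EuclideanSpace ℂ (Fin m) | kap x ∈ C ∧ sig x.1 ≤ d} := by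
  refine Metric.isCompact_of_isClosed_isBounded ?_ ?_
  · exact (hC.isClosed.preimage kap_cont).inter
      (isClosed_le (sig_smooth.continuous.comp continuous_fst) continuous_const)
  · obtain ⟨R, hR⟩ := hC.isBounded.exists_norm_le
    refine isBounded_iff_forall_norm_le.2 ⟨Real.sqrt (R ^ 2 + d) + R, fun x hx => ?_⟩
    have h1 := hR _ hx.1
    have h2 : ‖reX n x.1‖ ≤ R := (norm_fst_le (kap x)).trans h1
    have h3 : ‖x.2‖ ≤ R := (norm_snd_le (kap x)).trans h1
    have hR0 : 0 ≤ R := (norm_nonneg _).trans h1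
    have h4 : ‖x.1‖ ≤ Real.sqrt (R ^ 2 + d) := by
      refine Real.le_sqrt_of_sq_le ?_
      rw [norm_split]
      have := hx.2
      have : ‖reX n x.1‖ ^ 2 ≤ R ^ 2 := pow_le_pow_left₀ (norm_nonneg _) h2 2
      linarith [hx.2]
    have h5 := Real.sqrt_nonneg (R ^ 2 + d)
    rw [Prod.norm_def]
    exact max_le (by linarith) (by linarith)

lemma levi_quad (ε M : ℝ) (x v : EuclideanSpace ℂ (Fin n) × EuclideanSpace ℂ (Fin m)) :
    levi (fun x : EuclideanSpace ℂ (Fin n) × EuclideanSpace ℂ (Fin m) => ε * nsq x.2 + M * sig x.1) x v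
      = 4 * ε * ‖v.2‖ ^ 2 + 2 * M * ‖v.1‖ ^ 2 := by
  have s1 : ContDiff ℝ 2 (fun x : EuclideanSpace ℂ (Fin n) × EuclideanSpace ℂ (Fin m) => nsq x.2) :=
    (nsq_smooth.comp contDiff_snd).of_le ENat.LEInfty.out
  have s2 : ContDiff ℝ 2 (fun x : EuclideanSpace ℂ (Fin n) × EuclideanSpace ℂ (Fin m) => sig x.1) :=
    (sig_smooth.comp contDiff_fst).of_le ENat.LEInfty.out
  let a : Fin m → (EuclideanSpace ℂ (Fin n) × EuclideanSpace ℂ (Fin m)) →L[ℝ] ℝ := fun i =>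
    (reC i).comp (ContinuousLinearMap.snd ℝ _ _)
  let a' : Fin m → (EuclideanSpace ℂ (Fin n) × EuclideanSpace ℂ (Fin m)) →L[ℝ] ℝ := fun i =>
    (imC i).comp (ContinuousLinearMap.snd ℝ _ _)
  let b : Fin n → (EuclideanSpace ℂ (Fin n) × EuclideanSpace ℂ (Fin m)) →L[ℝ] ℝ := fun i =>
    (imC i).comp (ContinuousLinearMap.fst ℝ _ _)
  have e1 : levi (fun x : EuclideanSpace ℂ (Fin n) × EuclideanSpace ℂ (Fin m) => nsq x.2) x v
      = 4 * ‖v.2‖ ^ 2 := by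
    have : (fun x : EuclideanSpace ℂ (Fin n) × EuclideanSpace ℂ (Fin m) => nsq x.2)
      = fun x => ∑ i, (a i x ^ 2 + a' i x ^ 2) := rfl
    rw [this, levi_fsum Finset.univ (fun i _ => (((a i).contDiff.pow 2).add ((a' i).contDiff.pow 2)).contDiffAt),
      EuclideanSpace.norm_sq_eq, Finset.mul_sum]
    refine Finset.sum_congr rfl fun i _ => ?_
    rw [levi_add ((a i).contDiff.pow 2).contDiffAt ((a' i).contDiff.pow 2).contDiffAt, levi_lin_sq, levi_lin_sq,
      Complex.sq_norm, Complex.normSq_apply]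
    simp [a, a', reC_apply, imC_apply]
    ring
  have e2 : levi (fun x : EuclideanSpace ℂ (Fin n) × EuclideanSpace ℂ (Fin m) => sig x.1) x v
      = 2 * ‖v.1‖ ^ 2 := by
    have : (fun x : EuclideanSpace ℂ (Fin n) × EuclideanSpace ℂ (Fin m) => sig x.1)
      = fun x => ∑ i, b i x ^ 2 := rfl
    rw [this, levi_fsum Finset.univ (fun i _ => ((b i).contDiff.pow 2).contDiffAt),
      EuclideanSpace.norm_sq_eq, Finset.mul_sum]
    refine Finset.sum_congr rfl fun i _ => ?_
    rw [levi_lin_sq, Complex.sq_norm, Complex.normSq_apply]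
    simp [b, imC_apply]
    ring
  rw [levi_add (contDiff_const.mul s1).contDiffAt (contDiff_const.mul s2).contDiffAt,
    levi_const_mul s1.contDiffAt, levi_const_mul s2.contDiffAt, e1, e2]
  ring

end Coord

section LowerBound
variable {X Z : Type*} [NormedAddCommGroup X] [NormedSpace ℂ X] [NormedSpace ℝ X] [IsScalarTower ℝ ℂ X]
    [NormedAddCommGroup Z] [NormedSpace ℂ Z] [NormedSpace ℝ Z] [IsScalarTower ℝ ℂ Z]

lemma levi_lower {T : X × Z → ℝ} {x : X × Z} {C : ℝ} (hC : ‖fderiv ℝ (fderiv ℝ T) x‖ ≤ C)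
    (h0 : ∀ w, 0 ≤ levi T x (0, w)) (v : X × Z) :
    -(4 * C * ‖v.1‖ * ‖v.2‖) - 2 * C * ‖v.1‖ ^ 2 ≤ levi T x v := by
  set B := fderiv ℝ (fderiv ℝ T) x with hB
  have key : ∀ p : X, ∀ q : Z, B (0, q) (0, q) - 2 * C * ‖p‖ * ‖q‖ - C * ‖p‖ ^ 2 ≤ B (p, q) (p, q) := by
    intro p q
    have e : (p, q) = (p, (0:Z)) + ((0:X), q) := by simp
    have hb : ∀ a c : X × Z, -(C * ‖a‖ * ‖c‖) ≤ B a c := by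
      intro a c
      have h1 := B.le_opNorm₂ a c
      have h2 : ‖B‖ * ‖a‖ * ‖c‖ ≤ C * ‖a‖ * ‖c‖ := by gcongr
      have h3 := neg_abs_le (B a c)
      rw [Real.norm_eq_abs] at h1
      linarith
    rw [e]
    simp only [map_add, ContinuousLinearMap.add_apply]
    have n1 : ‖(p, (0:Z))‖ = ‖p‖ := by simp [Prod.norm_def]
    have n2 : ‖((0:X), q)‖ = ‖q‖ := by simp [Prod.norm_def]
    have b1 := hb (p, 0) (0, q)
    have b2 := hb (0, q) (p, 0)
    have b3 := hb (p, 0) (p, 0)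
    rw [n1, n2] at b1 b2
    rw [n1] at b3
    nlinarith
  have h1 := key v.1 v.2
  have h2 := key (I • v.1) (I • v.2)
  have h3 := h0 v.2
  simp only [levi, Prod.smul_mk, smul_zero] at h3
  rw [← hB] at h3
  rw [norm_smul, norm_smul, Complex.norm_I, one_mul, one_mul] at h2
  have e2 : I • v = (I • v.1, I • v.2) := rfl
  have e3 : levi T x v = B (v.1, v.2) (v.1, v.2) + B (I • v.1, I • v.2) (I • v.1, I • v.2) := rfl
  rw [e3]
  nlinarith

end LowerBound
end SteinAux

namespace SteinAux
open MeasureTheory Complex Filter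
open scoped ContDiff ComplexConjugate


section Glue
variable {n m : ℕ}

lemma glue {S C WV W O : Set (EuclideanSpace ℂ (Fin n) × EuclideanSpace ℂ (Fin m))}
    {T : EuclideanSpace ℂ (Fin n) × EuclideanSpace ℂ (Fin m) → ℝ}
    (hS : IsCompact S) (hC : IsCompact C) (hWV : IsOpen WV) (hW : IsOpen W) (hO : IsOpen O)
    (hSr : ∀ x ∈ S, x.1 ∈ realSlice n) (hSW : S ⊆ WV) (hSC : S ⊆ C) (hCW : C ⊆ W)
    (hVC : ∀ x ∈ WV, x.1 ∈ realSlice n → x ∈ C)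
    (hCO : ∀ x, kap x ∈ C → x ∈ O) (hT : ContDiffOn ℝ ∞ T O) (hT0 : ∀ x, 0 ≤ T x)
    (hlev : ∀ x, kap x ∈ C → ∀ w, 0 ≤ levi T x (0, w))
    (hTS : ∀ x ∈ S, T x < 1 / 2) (hTL : ∀ x, kap x ∈ C → kap x ∉ WV → 1 ≤ T x) :
    ∃ D, IsSteinOpen D ∧ S ⊆ D ∧ D ⊆ W := by
  have csig : Continuous fun x : EuclideanSpace ℂ (Fin n) × EuclideanSpace ℂ (Fin m) => sig x.1 :=
    sig_smooth.continuous.comp continuous_fst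
  have cnsq : Continuous fun x : EuclideanSpace ℂ (Fin n) × EuclideanSpace ℂ (Fin m) => nsq x.2 :=
    nsq_smooth.continuous.comp continuous_snd
  have hN1 := tubeset_compact hC 1
  -- choice of d
  obtain ⟨d, hd0, hd1, hdW⟩ : ∃ d > 0, d ≤ 1 ∧ ∀ x, kap x ∈ C → sig x.1 ≤ d → x ∈ W := by
    have hc := hN1.diff hW
    rcases ({x : EuclideanSpace ℂ (Fin n) × EuclideanSpace ℂ (Fin m) | kap x ∈ C ∧ sig x.1 ≤ 1} \
      W).eq_empty_or_nonempty with he | hne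
    · refine ⟨1, one_pos, le_rfl, fun x h1 h2 => ?_⟩
      by_contra hx
      exact (eq_empty_iff_forall_notMem.1 he) x ⟨⟨h1, h2⟩, hx⟩
    · obtain ⟨y, hy, hmin⟩ := hc.exists_isMinOn hne csig.continuousOn
      have hpos : 0 < sig y.1 := by
        refine lt_of_le_of_ne (sig_nonneg _) fun h => hy.2 (hCW ?_)
        have h2 := reX_real (real_of_sig h.symm)
        have h3 : kap y = y := Prod.ext h2 rfl
        exact h3 ▸ hy.1.1
      refine ⟨min 1 (sig y.1 / 2), by positivity, min_le_left _ _, fun x h1 h2 => ?_⟩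
      by_contra hx
      have h3 : sig y.1 ≤ sig x.1 := hmin (show x ∈ _ \ W from ⟨⟨h1, h2.trans (min_le_left _ _)⟩, hx⟩)
      have h4 := h2.trans (min_le_right _ _)
      linarith
  -- bound on second derivative
  have hN1O : {x : EuclideanSpace ℂ (Fin n) × EuclideanSpace ℂ (Fin m) | kap x ∈ C ∧ sig x.1 ≤ 1} ⊆ O :=
    fun x hx => hCO x hx.1
  have c1 : ContDiffOn ℝ ∞ (fderiv ℝ T) O := hT.fderiv_of_isOpen hO (by simp)
  have c2 : ContinuousOn (fderiv ℝ (fderiv ℝ T)) O := c1.continuousOn_fderiv_of_isOpen hO (by simp)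
  obtain ⟨K, hK⟩ := hN1.exists_bound_of_continuousOn (f := fderiv ℝ (fderiv ℝ T)) (c2.mono hN1O)
  set C2 := max K 0 with hC2
  have hC20 : 0 ≤ C2 := le_max_right _ _
  have hC2b : ∀ x, kap x ∈ C → sig x.1 ≤ 1 → ‖fderiv ℝ (fderiv ℝ T) x‖ ≤ C2 := fun x h1 h2 =>
    (hK x ⟨h1, h2⟩).trans (le_max_left _ _)
  -- choice of ε
  obtain ⟨R, hR⟩ := hS.exists_bound_of_continuousOn cnsq.continuousOn
  set R' := max R 0 with hR'
  have hR0 : 0 ≤ R' := le_max_right _ _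
  have hRb : ∀ x ∈ S, nsq x.2 ≤ R' := fun x hx =>
    ((le_abs_self _).trans (hR x hx)).trans (le_max_left _ _)
  set ε := 1 / (4 * (R' + 1)) with hε
  have hε0 : 0 < ε := by positivity
  have hεR : ε * R' < 1 / 2 := by
    rw [hε, div_mul_eq_mul_div, div_lt_iff₀ (by positivity)]; linarith
  set M := C2 + C2 ^ 2 / ε + 1 + 1 / d with hM
  have hM0 : 0 < M := by positivity
  have hMd : 1 ≤ M * d := by
    have h1 : 1 / d * d = 1 := by field_simp
    have h2 : 0 ≤ (C2 + C2 ^ 2 / ε + 1) * d := by positivity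
    rw [hM, add_mul, h1]; linarith
  set q : EuclideanSpace ℂ (Fin n) × EuclideanSpace ℂ (Fin m) → ℝ := fun x => ε * nsq x.2 + M * sig x.1 with hq
  have hqs : ContDiff ℝ ∞ q := (contDiff_const.mul (nsq_smooth.comp contDiff_snd)).add
    (contDiff_const.mul (sig_smooth.comp contDiff_fst))
  have hq0 : ∀ x : EuclideanSpace ℂ (Fin n) × EuclideanSpace ℂ (Fin m), 0 ≤ ε * nsq x.2 := fun x => mul_nonneg hε0.le (nsq_nonneg _)
  have hq1 : ∀ x : EuclideanSpace ℂ (Fin n) × EuclideanSpace ℂ (Fin m), 0 ≤ M * sig x.1 := fun x => mul_nonneg hM0.le (sig_nonneg _)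
  set ρ : EuclideanSpace ℂ (Fin n) × EuclideanSpace ℂ (Fin m) → ℝ := fun x => T x + q x with hρ
  have hρs : ContDiffOn ℝ ∞ ρ O := hT.add hqs.contDiffOn
  set D : Set (EuclideanSpace ℂ (Fin n) × EuclideanSpace ℂ (Fin m)) :=
    {x | kap x ∈ WV ∧ sig x.1 < d ∧ ρ x < 1} with hD
  have hDC : ∀ x ∈ D, kap x ∈ C := fun x hx => hVC _ hx.1 (reX_mem _)
  have hDO : D ⊆ O := fun x hx => hCO x (hDC x hx)
  have hDop : IsOpen D := by
    have h1 : D = (kap ⁻¹' WV ∩ {x | sig x.1 < d}) ∩ (O ∩ ρ ⁻¹' Iio 1) := by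
      ext x
      constructor
      · intro hx
        exact ⟨⟨hx.1, hx.2.1⟩, hDO hx, hx.2.2⟩
      · rintro ⟨⟨h1, h2⟩, h3, h4⟩
        exact ⟨h1, h2, h4⟩
    rw [h1]
    exact ((hWV.preimage kap_cont).inter (isOpen_lt csig continuous_const)).inter
      (hρs.continuousOn.isOpen_inter_preimage hO isOpen_Iio)
  have hNd := tubeset_compact hC d
  have hNdO : {x : EuclideanSpace ℂ (Fin n) × EuclideanSpace ℂ (Fin m) | kap x ∈ C ∧ sig x.1 ≤ d} ⊆ O :=
    fun x hx => hCO x hx.1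
  have gρ : ContinuousOn (fderiv ℝ ρ) O := hρs.continuousOn_fderiv_of_isOpen hO (by simp)
  obtain ⟨C1, hC1⟩ := hNd.exists_bound_of_continuousOn (f := fderiv ℝ ρ) (gρ.mono hNdO)
  have hPS : PS D ρ (min (2 * ε) 2) C1 := by
    refine ⟨hDop, hρs.mono hDO, fun x hx => hx.2.2, fun t ht => ?_, fun x hx => hC1 x ⟨hDC x hx, hx.2.1.le⟩,
      by positivity, fun x hx v => ?_⟩
    · have e : {x | x ∈ D ∧ ρ x ≤ t} = {x | kap x ∈ C ∧ sig x.1 ≤ d} ∩ ρ ⁻¹' Iic t := by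
        ext x
        constructor
        · rintro ⟨hx, h2⟩
          exact ⟨⟨hDC x hx, hx.2.1.le⟩, h2⟩
        · rintro ⟨⟨h1, h2⟩, h3⟩
          have h3 : ρ x ≤ t := h3
          have h4 : T x + (ε * nsq x.2 + M * sig x.1) ≤ t := h3
          refine ⟨⟨?_, ?_, lt_of_le_of_lt h3 ht⟩, h3⟩
          · by_contra h5
            linarith [hTL x h1 h5, hq0 x, hq1 x]
          · refine lt_of_le_of_ne h2 fun h5 => ?_
            rw [h5] at h4
            linarith [hT0 x, hq0 x]
      rw [e]
      have := (hρs.continuousOn.mono hNdO).preimage_isClosed_of_isClosed hNd.isClosed (isClosed_Iic (a := t))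
      exact hNd.of_isClosed_subset this inter_subset_left
    · have hxC := hDC x hx
      have cT : ContDiffAt ℝ 2 T x := (hT.contDiffAt (hO.mem_nhds (hCO x hxC))).of_le ENat.LEInfty.out
      have l1 := levi_lower (hC2b x hxC (hx.2.1.le.trans hd1)) (hlev x hxC) v
      have l2 : levi ρ x v = levi T x v + levi q x v :=
        levi_add cT (hqs.contDiffAt.of_le ENat.LEInfty.out) v
      have l3 := levi_quad ε M x v
      rw [l2, show levi q x v = 4 * ε * ‖v.2‖ ^ 2 + 2 * M * ‖v.1‖ ^ 2 from l3]
      set a := ‖v.1‖ with ha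
      set c := ‖v.2‖ with hc
      have ha0 : 0 ≤ a := norm_nonneg _
      have hc0 : 0 ≤ c := norm_nonneg _
      have am : 4 * C2 * a * c ≤ 2 * ε * c ^ 2 + 2 * (C2 ^ 2 / ε) * a ^ 2 := by
        have : 2 * ε * c ^ 2 + 2 * (C2 ^ 2 / ε) * a ^ 2 - 4 * C2 * a * c = 2 / ε * (ε * c - C2 * a) ^ 2 := by
          field_simp; ring
        have h2 : 0 ≤ 2 / ε * (ε * c - C2 * a) ^ 2 := by positivity
        linarith
      have low : 2 * ε * c ^ 2 + 2 * a ^ 2 ≤ levi T x v + (4 * ε * c ^ 2 + 2 * M * a ^ 2) := by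
        have h1 : 2 * M * a ^ 2 = 2 * C2 * a ^ 2 + 2 * (C2 ^ 2 / ε) * a ^ 2 + 2 * a ^ 2 + 2 * (1 / d) * a ^ 2 := by
          rw [hM]; ring
        have h2 : 0 ≤ 2 * (1 / d) * a ^ 2 := by positivity
        linarith
      refine le_trans ?_ low
      have hv : ‖v‖ ^ 2 ≤ a ^ 2 + c ^ 2 := by
        rw [Prod.norm_def]
        rcases max_choice ‖v.1‖ ‖v.2‖ with h | h <;> rw [h]
        · nlinarith
        · nlinarith
      have m1 : min (2 * ε) 2 ≤ 2 * ε := min_le_left _ _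
      have m2 : min (2 * ε) 2 ≤ 2 := min_le_right _ _
      have m0 : 0 ≤ min (2 * ε) 2 := by positivity
      calc min (2 * ε) 2 * ‖v‖ ^ 2 ≤ min (2 * ε) 2 * (a ^ 2 + c ^ 2) := mul_le_mul_of_nonneg_left hv m0
        _ = min (2 * ε) 2 * c ^ 2 + min (2 * ε) 2 * a ^ 2 := by ring
        _ ≤ 2 * ε * c ^ 2 + 2 * a ^ 2 := add_le_add (mul_le_mul_of_nonneg_right m1 (sq_nonneg _))
            (mul_le_mul_of_nonneg_right m2 (sq_nonneg _))
  letI : MeasurableSpace (EuclideanSpace ℂ (Fin n) × EuclideanSpace ℂ (Fin m)) := borel _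
  haveI : BorelSpace (EuclideanSpace ℂ (Fin n) × EuclideanSpace ℂ (Fin m)) := ⟨rfl⟩
  refine ⟨D, PS.stein (μ := MeasureTheory.Measure.addHaar) (Module.finBasis ℂ _) hPS, fun x hx => ?_,
    fun x hx => hdW x (hDC x hx) hx.2.1.le⟩
  have hr := hSr x hx
  have hk : kap x = x := Prod.ext (reX_real hr) rfl
  refine ⟨by rw [hk]; exact hSW hx, by rw [sig_real hr]; exact hd0, ?_⟩
  have h1 := hTS x hx
  have h2 : ε * nsq x.2 ≤ ε * R' := mul_le_mul_of_nonneg_left (hRb x hx) hε0.le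
  have h3 : ρ x = T x + (ε * nsq x.2 + M * sig x.1) := rfl
  rw [h3, sig_real hr]
  linarith

end Glue
end SteinAux

namespace SteinAux
open MeasureTheory Complex Filter
open scoped ContDiff ComplexConjugate


section Easy
variable {X Z : Type*} [NormedAddCommGroup X] [NormedSpace ℂ X] [NormedAddCommGroup Z] [NormedSpace ℂ Z]

lemma hull_fiber {Ω Q : Set (X × Z)} (hQ : IsCompact Q) (hQΩ : Q ⊆ Ω) {u : X} {K : Set Z}
    (hK : ∀ w ∈ K, (u, w) ∈ Q) {z : Z} (hz : z ∈ hullO (fiberOf Ω u) K) : (u, z) ∈ hullO Ω Q := by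
  refine ⟨hz.1, fun f hf => ?_⟩
  have h1 : DifferentiableOn ℂ (fun w => f (u, w)) (fiberOf Ω u) :=
    hf.comp ((differentiable_const u).prodMk differentiable_id).differentiableOn (fun w hw => hw)
  refine (hz.2 _ h1).trans (iSup_le_of (iSup2_nonneg _ fun _ => norm_nonneg _) fun w hw => ?_)
  exact le_iSup_compact hQ (F := fun x => ‖f x‖) (hf.continuousOn.mono hQΩ).norm
    (fun _ => norm_nonneg _) (hK w hw)

lemma fiber_compact {K : Set (X × Z)} (hK : IsCompact K) (u : X) : IsCompact (fiberOf K u) := by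
  have : fiberOf K u = Prod.snd '' (K ∩ ({u} ×ˢ univ)) := by
    ext z; simp [fiberOf]
  rw [this]
  exact (hK.inter_right (isClosed_singleton.prod isClosed_univ)).image continuous_snd

lemma fiber_stein {Ω : Set (X × Z)} (hΩ : IsSteinOpen Ω) (u : X) : IsSteinOpen (fiberOf Ω u) := by
  have ho : IsOpen (fiberOf Ω u) := hΩ.1.preimage (continuous_const.prodMk continuous_id)
  refine ⟨ho, fun K hK hKc => ?_⟩
  have hQ : IsCompact (({u} : Set X) ×ˢ K) := isCompact_singleton.prod hKc
  have hQΩ : ({u} : Set X) ×ˢ K ⊆ Ω := by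
    rintro ⟨a, w⟩ ⟨h1, h2⟩
    rw [mem_singleton_iff] at h1
    simp only at h1
    subst h1
    exact hK h2
  have hc := fiber_compact (hΩ.2 _ hQΩ hQ) u
  exact hull_compact ho hc (fun z hz => hz.1) (fun z hz => hull_fiber hQ hQΩ (fun w hw => ⟨rfl, hw⟩) hz)

end Easy

section Main
variable {n m : ℕ}

lemma easy_dir (S : Set (EuclideanSpace ℂ (Fin n) × EuclideanSpace ℂ (Fin m)))
    (hS : IsCompact S) (hP : Prod.fst '' S ⊆ realSlice n) (h : IsSteinCompactum S) :
      ∀ U, OpenInSlice U → S ⊆ U →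
        ∃ V Ω : Set (EuclideanSpace ℂ (Fin n) × EuclideanSpace ℂ (Fin m)),
          OpenInSlice V ∧ OpenInSlice Ω ∧ S ⊆ V ∧
          IsCompact (closure V) ∧ closure V ⊆ Ω ∧ Ω ⊆ U ∧
          ∀ u ∈ Prod.fst '' S,
            IsSteinOpen (fiberOf Ω u) ∧
            hullO (fiberOf Ω u) (fiberOf S u) ⊆ fiberOf V u := by
  rintro U ⟨W, hW, rfl⟩ hSU
  obtain ⟨Ω, hΩ, hSΩ, hΩW⟩ := h W hW fun x hx => (hSU hx).1
  have hH := hΩ.2 S hSΩ hS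
  obtain ⟨K, hK, hHK, hKΩ⟩ := exists_compact_between hH hΩ.1 (fun x hx => hx.1)
  have hcl : IsClosed (realSlice n ×ˢ (univ : Set (EuclideanSpace ℂ (Fin m)))) :=
    isClosed_realSlice.prod isClosed_univ
  have hclV : closure (interior K ∩ realSlice n ×ˢ (univ : Set (EuclideanSpace ℂ (Fin m)))) ⊆
      K ∩ realSlice n ×ˢ (univ : Set (EuclideanSpace ℂ (Fin m))) :=
    closure_minimal (inter_subset_inter_left _ interior_subset) (hK.isClosed.inter hcl)
  refine ⟨interior K ∩ (realSlice n ×ˢ univ), Ω ∩ (realSlice n ×ˢ univ), ⟨_, isOpen_interior, rfl⟩,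
    ⟨_, hΩ.1, rfl⟩, fun x hx => ⟨hHK ⟨hSΩ hx, fun f hf => ?_⟩, (hSU hx).2⟩, ?_, ?_,
    inter_subset_inter_left _ hΩW, fun u hu => ?_⟩
  · exact le_iSup_compact hS (F := fun x => ‖f x‖) (hf.continuousOn.mono hSΩ).norm
      (fun _ => norm_nonneg _) hx
  · exact hK.of_isClosed_subset isClosed_closure (hclV.trans inter_subset_left)
  · exact hclV.trans (inter_subset_inter_left _ hKΩ)
  · have e : fiberOf (Ω ∩ (realSlice n ×ˢ (univ : Set (EuclideanSpace ℂ (Fin m))))) u = fiberOf Ω u := by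
      ext z
      exact ⟨fun h => h.1, fun h => ⟨h, hP hu, mem_univ _⟩⟩
    rw [e]
    refine ⟨fiber_stein hΩ u, fun z hz => ⟨hHK ?_, hP hu, mem_univ _⟩⟩
    exact hull_fiber hS hSΩ (fun w hw => hw) hz

lemma one_le_sum_prod {κ : Type*} (t : Finset κ) (a : κ → ℝ) (ha : ∀ k, a k ∈ Icc (0:ℝ) 1) :
    1 ≤ ∑ k ∈ t, a k + ∏ k ∈ t, (1 - a k) := by
  classical
  induction t using Finset.induction_on with
  | empty => simp
  | insert k t hk ih =>
    rw [Finset.sum_insert hk, Finset.prod_insert hk]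
    have h1 : ∏ k ∈ t, (1 - a k) ≤ 1 :=
      Finset.prod_le_one (fun i _ => by linarith [(ha i).2]) (fun i _ => by linarith [(ha i).1])
    nlinarith [(ha k).1]

lemma hard_dir (S : Set (EuclideanSpace ℂ (Fin n) × EuclideanSpace ℂ (Fin m)))
    (hS : IsCompact S) (hP : Prod.fst '' S ⊆ realSlice n)
    (h : ∀ U, OpenInSlice U → S ⊆ U →
        ∃ V Ω : Set (EuclideanSpace ℂ (Fin n) × EuclideanSpace ℂ (Fin m)),
          OpenInSlice V ∧ OpenInSlice Ω ∧ S ⊆ V ∧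
          IsCompact (closure V) ∧ closure V ⊆ Ω ∧ Ω ⊆ U ∧
          ∀ u ∈ Prod.fst '' S,
            IsSteinOpen (fiberOf Ω u) ∧
            hullO (fiberOf Ω u) (fiberOf S u) ⊆ fiberOf V u) : IsSteinCompactum S := by
  intro W hW hSW
  obtain ⟨V, Ω, ⟨WV, hWV, hVe⟩, -, hSV, hVc, hVΩ, hΩU, hfib⟩ :=
    h (W ∩ (realSlice n ×ˢ univ)) ⟨W, hW, rfl⟩ fun x hx => ⟨hSW hx, hP (mem_image_of_mem _ hx), mem_univ _⟩
  have hVWV : V ⊆ WV := by rw [hVe]; exact inter_subset_left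
  have hSC : S ⊆ closure V := hSV.trans subset_closure
  have hPc : IsCompact (Prod.fst '' S) := hS.image continuous_fst
  have hL : IsCompact (closure V \ WV) := hVc.diff hWV
  letI : MeasurableSpace (EuclideanSpace ℂ (Fin m)) := borel _
  haveI : BorelSpace (EuclideanSpace ℂ (Fin m)) := ⟨rfl⟩
  have loc := fun u : (Prod.fst '' S : Set (EuclideanSpace ℂ (Fin n))) =>
    local_psh (μ := MeasureTheory.Measure.addHaar) (Module.finBasis ℂ (EuclideanSpace ℂ (Fin m)))
      hS hVc hL hSC diff_subset (u := (u : EuclideanSpace ℂ (Fin n))) (hfib u u.2).1.1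
      (fun z hz => hVΩ hz) (fun z hz hz2 => hz.2 (hVWV ((hfib u u.2).2 hz2)))
  choose r hr hrC hβ using loc
  obtain ⟨t, ht⟩ := hPc.elim_nhds_subcover' (fun x hx => Metric.ball x (r ⟨x, hx⟩ / 2))
    (fun x hx => Metric.ball_mem_nhds x (by have := hr ⟨x, hx⟩; linarith))
  set η : ℝ := 1 / (2 * ((t.card : ℝ) + 1)) with hη
  have hη0 : 0 < η := by positivity
  choose β βs β0 βl βS βL using fun u => hβ u η hη0
  choose χ χs χ1 χ01 χt using fun u : (Prod.fst '' S : Set (EuclideanSpace ℂ (Fin n))) =>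
    exists_bump (u : EuclideanSpace ℂ (Fin n)) (r := r u / 2) (R := 3 / 4 * r u)
      (by have := hr u; linarith) (by have := hr u; linarith)
  have χd : ∀ u y, χ u y ≠ 0 → dist y u ≤ 3 / 4 * r u := fun u y hy => χt u (subset_tsupport _ hy)
  have χd' : ∀ u y, χ u y ≠ 0 → dist y u ≤ r u := fun u y hy => (χd u y hy).trans (by linarith [hr u])
  let O : Set (EuclideanSpace ℂ (Fin n) × EuclideanSpace ℂ (Fin m)) :=
    ⋂ k ∈ t, ({x | 3 / 4 * r k < dist (reX n x.1) k} ∪ {x | x.2 ∈ fiberOf Ω (k : EuclideanSpace ℂ (Fin n))})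
  let P : EuclideanSpace ℂ (Fin n) × EuclideanSpace ℂ (Fin m) → ℝ := fun x => ∏ k ∈ t, (1 - χ k (reX n x.1))
  let T : EuclideanSpace ℂ (Fin n) × EuclideanSpace ℂ (Fin m) → ℝ := fun x =>
    ∑ k ∈ t, χ k (reX n x.1) * β k x.2 + P x
  have hOo : IsOpen O := isOpen_biInter_finset fun k _ => by
    refine IsOpen.union (isOpen_lt continuous_const ?_) ((hfib k k.2).1.1.preimage continuous_snd)
    exact ((reX n).continuous.comp continuous_fst).dist continuous_const
  have hCO : ∀ x, kap x ∈ closure V → x ∈ O := by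
    intro x hx
    refine mem_iInter₂.2 fun k hk => ?_
    by_cases hd : 3 / 4 * r k < dist (reX n x.1) k
    · exact Or.inl hd
    · exact Or.inr (hrC k (kap x) hx (by
        have := hr k
        show dist (reX n x.1) k ≤ r k
        linarith [not_lt.1 hd]))
  have hχr : ∀ k, ContDiff ℝ ∞ fun x : EuclideanSpace ℂ (Fin n) × EuclideanSpace ℂ (Fin m) =>
      χ k (reX n x.1) := fun k => (χs k).comp ((reX n).contDiff.comp contDiff_fst)
  have hPs : ContDiff ℝ ∞ P := contDiff_prod fun k _ => contDiff_const.sub (hχr k)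
  have hTs : ContDiffOn ℝ ∞ T O := by
    refine ContDiffOn.add (ContDiffOn.sum fun k hk => ?_) hPs.contDiffOn
    intro x hx
    refine ContDiffAt.contDiffWithinAt ?_
    rcases mem_iInter₂.1 hx k hk with hd | hd
    · have h1 : reX n x.1 ∉ tsupport (χ k) := fun h => by
        have h2 : dist (reX n x.1) k ≤ 3 / 4 * r k := χt k h
        exact absurd hd (not_lt.2 h2)
      have h2 := notMem_tsupport_iff_eventuallyEq.1 h1
      have h3 : ∀ᶠ y : EuclideanSpace ℂ (Fin n) × EuclideanSpace ℂ (Fin m) in 𝓝 x, χ k (reX n y.1) = 0 :=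
        (((reX n).continuous.comp continuous_fst).tendsto x).eventually h2
      refine (contDiffAt_const (c := (0:ℝ))).congr_of_eventuallyEq ?_
      filter_upwards [h3] with y hy
      rw [hy, zero_mul]
    · refine (hχr k).contDiffAt.mul ?_
      exact ((βs k).contDiffAt ((hfib k k.2).1.1.mem_nhds hd)).comp x contDiffAt_snd
  have hP0 : ∀ x, 0 ≤ P x := fun x => Finset.prod_nonneg fun k _ => by linarith [(χ01 k (reX n x.1)).2]
  refine glue (T := T) (O := O) hS hVc hWV hW hOo (fun x hx => hP (mem_image_of_mem _ hx))
    (hSV.trans hVWV) hSC (fun x hx => (hΩU (hVΩ hx)).1)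
    (fun x hx hr => subset_closure (by rw [hVe]; exact ⟨hx, hr, mem_univ _⟩)) hCO hTs ?_ ?_ ?_ ?_
  · intro x
    exact add_nonneg (Finset.sum_nonneg fun k _ => mul_nonneg (χ01 k _).1 (β0 k _)) (hP0 x)
  · rintro ⟨ζ, z⟩ hx w
    have hT2 : ContDiffAt ℝ 2 T (ζ, z) :=
      (hTs.contDiffAt (hOo.mem_nhds (hCO _ hx))).of_le ENat.LEInfty.out
    rw [← levi_slice hT2 w]
    have term : ∀ k ∈ t, ContDiffAt ℝ 2 (fun z' => χ k (reX n ζ) * β k z') z ∧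
        0 ≤ levi (fun z' => χ k (reX n ζ) * β k z') z w := by
      intro k hk
      by_cases h0 : χ k (reX n ζ) = 0
      · simp only [h0, zero_mul]
        exact ⟨contDiffAt_const, (levi_const _ _ _).ge⟩
      · have hz : z ∈ fiberOf Ω (k : EuclideanSpace ℂ (Fin n)) := hrC k (kap (ζ, z)) hx (χd' k _ h0)
        have hb : ContDiffAt ℝ 2 (β k) z :=
          ((βs k).contDiffAt ((hfib k k.2).1.1.mem_nhds hz)).of_le ENat.LEInfty.out
        refine ⟨contDiffAt_const.mul hb, ?_⟩
        rw [levi_const_mul hb]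
        exact mul_nonneg (χ01 k _).1 (βl k z hz w)
    have e : (fun z' => T (ζ, z')) = fun z' => (∑ k ∈ t, χ k (reX n ζ) * β k z') + P (ζ, z) := rfl
    rw [e, levi_add (ContDiffAt.sum fun k hk => (term k hk).1) contDiffAt_const, levi_const, add_zero,
      levi_fsum t (fun k hk => (term k hk).1)]
    exact Finset.sum_nonneg fun k hk => (term k hk).2
  · intro x hx
    have hxP : x.1 ∈ Prod.fst '' S := mem_image_of_mem _ hx
    have hre : reX n x.1 = x.1 := reX_real (hP hxP)
    have hPx : P x = 0 := by
      obtain ⟨k, hk, hkx⟩ := mem_iUnion₂.1 (ht hxP)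
      refine Finset.prod_eq_zero hk ?_
      rw [hre, χ1 k x.1 (Metric.ball_subset_closedBall hkx), sub_self]
    have hsum : ∑ k ∈ t, χ k (reX n x.1) * β k x.2 ≤ ∑ k ∈ t, η := by
      refine Finset.sum_le_sum fun k hk => ?_
      by_cases h0 : χ k (reX n x.1) = 0
      · rw [h0, zero_mul]; exact hη0.le
      · have h1 := βS k x hx (by rw [← hre]; exact χd' k _ h0)
        have h2 := (χ01 k (reX n x.1)).2
        have h3 := (χ01 k (reX n x.1)).1
        nlinarith [β0 k x.2]
    rw [Finset.sum_const, nsmul_eq_mul] at hsum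
    have hc : (t.card : ℝ) * η < 1 / 2 := by
      rw [hη, mul_one_div, div_lt_iff₀ (by positivity)]; linarith
    show _ + P x < 1 / 2
    rw [hPx]
    linarith
  · intro x hx hx2
    refine (one_le_sum_prod t (fun k => χ k (reX n x.1)) fun k => χ01 k _).trans ?_
    refine add_le_add (Finset.sum_le_sum fun k hk => ?_) le_rfl
    by_cases h0 : χ k (reX n x.1) = 0
    · simp [h0]
    · have h1 : 1 ≤ β k x.2 := βL k (kap x) ⟨hx, hx2⟩ (χd' k _ h0)
      have h3 := (χ01 k (reX n x.1)).1
      show χ k (reX n x.1) ≤ χ k (reX n x.1) * β k x.2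
      nlinarith

end Main
end SteinAux

/-- Theorem 1.1 (main theorem): a compact set `S ⊆ ℂⁿ × ℂᵐ` fibered over `ℝⁿ` is a Stein
compactum iff every neighborhood `U` of `S` in `ℝⁿ × ℂᵐ` contains `V ⋐ Ω ⊆ U` such that
every fiber `Ω_u` over `u ∈ π(S)` is Stein and the `𝒪(Ω_u)`-hull of `S_u` lies in `V_u`. -/
theorem stein_compactum_iff_fiberwise {n m : ℕ}
    (S : Set (EuclideanSpace ℂ (Fin n) × EuclideanSpace ℂ (Fin m)))
    (hS : IsCompact S) (hP : Prod.fst '' S ⊆ realSlice n) :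
    IsSteinCompactum S ↔
      ∀ U, OpenInSlice U → S ⊆ U →
        ∃ V Ω : Set (EuclideanSpace ℂ (Fin n) × EuclideanSpace ℂ (Fin m)),
          OpenInSlice V ∧ OpenInSlice Ω ∧ S ⊆ V ∧
          IsCompact (closure V) ∧ closure V ⊆ Ω ∧ Ω ⊆ U ∧
          ∀ u ∈ Prod.fst '' S,
            IsSteinOpen (fiberOf Ω u) ∧
            hullO (fiberOf Ω u) (fiberOf S u) ⊆ fiberOf V u := by
  exact ⟨SteinAux.easy_dir S hS hP, SteinAux.hard_dir S hS hP⟩
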